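/- For every A > 0 there exists a constant C = C(A) such that for all real x ≥ 2 and all real Q with 1 ≤ Q ≤ x (log x)^{−(A+1)}, one has V(x,Q) ≤ C x² (log x)^{−A}. -/

import Mathlib

open Finset

/-- `ψ(x;q,a) = Σ_{n ≤ x, n ≡ a (mod q)} Λ(n)`. -/
noncomputable def psi (x : ℝ) (q a : ℕ) : ℝ :=
  ∑ n ∈ (Finset.Icc 1 ⌊x⌋₊).filter (fun n => n % q = a % q),
    ArithmeticFunction.vonMangoldt n

/-- `V(x,Q) = Σ_{q ≤ Q} Σ_{1 ≤ a ≤ q, gcd(a,q)=1} |ψ(x;q,a) − x/φ(q)|²`. -/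
noncomputable def V (x Q : ℝ) : ℝ :=
  ∑ q ∈ Finset.Icc 1 ⌊Q⌋₊,
    ∑ a ∈ (Finset.Icc 1 q).filter (fun a => Nat.gcd a q = 1),
      (psi x q a - x / (Nat.totient q : ℝ)) ^ 2

namespace BDH

open Set Filter Topology MeasureTheory Complex

/-- Analytic continuation of a Mellin-type representation with a bounded kernel, together with
the resulting bound. -/
lemma norm_le_of_eq_mul_integral {g : ℝ → ℂ} {B N : ℝ} (hN : 1 ≤ N) (hg : Measurable g)
    (hb : ∀ u, ‖g u‖ ≤ B) (h0 : ∀ u < N, g u = 0) {f p : ℂ → ℂ}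
    (hf : ∀ s : ℂ, 0 < s.re → DifferentiableAt ℂ f s) (hp : Differentiable ℂ p)
    (h : ∀ s : ℂ, 1 < s.re → f s = p s * ∫ u in Ioi (1 : ℝ), g u * (u : ℂ) ^ (-(s + 1)))
    {s : ℂ} (hs : 0 < s.re) : ‖f s‖ ≤ ‖p s‖ * (B * N ^ (-s.re) / s.re) := by
  have hB : 0 ≤ B := (norm_nonneg _).trans (hb 0)
  have hmel : ∀ s : ℂ, (∫ u in Ioi N, g u * (u : ℂ) ^ (-(s + 1))) = mellin g (-s) := by
    intro s
    rw [mellin, ← integral_Ici_eq_integral_Ioi (x := N)]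
    refine (setIntegral_eq_of_subset_of_forall_sdiff_eq_zero (s := Ici N) (t := Ioi (0:ℝ))
      measurableSet_Ioi ?_ ?_).symm.trans ?_
    · exact fun u hu => lt_of_lt_of_le (show (0 : ℝ) < N by linarith) hu
    · intro u hu
      rw [h0 u (by simpa using hu.2), zero_mul]
    · refine integral_congr_ae (ae_of_all _ fun u => ?_)
      simp only [smul_eq_mul]
      rw [mul_comm]; congr 2; ring
  have hI : ∀ s : ℂ, (∫ u in Ioi (1 : ℝ), g u * (u : ℂ) ^ (-(s + 1)))
      = ∫ u in Ioi N, g u * (u : ℂ) ^ (-(s + 1)) := by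
    intro s
    rw [← integral_Ici_eq_integral_Ioi, ← integral_Ici_eq_integral_Ioi (x := N)]
    refine (setIntegral_eq_of_subset_of_forall_sdiff_eq_zero measurableSet_Ici ?_ ?_)
    · exact fun u hu => le_trans hN hu
    · intro u hu
      rw [h0 u (by simpa using hu.2), zero_mul]
  have hmd : ∀ s : ℂ, 0 < s.re → DifferentiableAt ℂ (fun s => mellin g (-s)) s := by
    intro s hs
    have : DifferentiableAt ℂ (mellin g) (-s) := by
      refine mellin_differentiableAt_of_isBigO_rpow (a := 0) (b := (-s).re - 1) ?_ ?_ ?_ ?_ ?_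
      · refine LocallyIntegrable.locallyIntegrableOn ?_ _
        refine (locallyIntegrable_const B).mono hg.aestronglyMeasurable (ae_of_all _ fun u => ?_)
        rw [Real.norm_of_nonneg hB]; exact hb u
      · simp only [neg_zero, Real.rpow_zero]
        exact Asymptotics.IsBigO.of_bound B (Eventually.of_forall fun u => by simpa using hb u)
      · simpa using hs
      · refine (Asymptotics.isBigO_zero _ _).congr' ?_ EventuallyEq.rfl
        have : Ioo (0 : ℝ) 1 ∈ 𝓝[>] (0 : ℝ) := Ioo_mem_nhdsGT one_pos
        filter_upwards [this] with u hu
        rw [h0 u (by linarith [hu.2])]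
      · linarith
    exact this.comp s differentiableAt_id.neg
  have hU : IsOpen {s : ℂ | 0 < s.re} := isOpen_lt continuous_const Complex.continuous_re
  have heq : EqOn f (fun s => p s * mellin g (-s)) {s : ℂ | 0 < s.re} := by
    refine AnalyticOnNhd.eqOn_of_preconnected_of_eventuallyEq (𝕜 := ℂ) (z₀ := 2) ?_ ?_ ?_ ?_ ?_
    · exact DifferentiableOn.analyticOnNhd (fun s hs => (hf s hs).differentiableWithinAt) hU
    · exact DifferentiableOn.analyticOnNhd
        (fun s hs => ((hp s).mul (hmd s hs)).differentiableWithinAt) hU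
    · have hc : Convex ℝ {s : ℂ | 0 < s.re} := convex_halfSpace_re_gt 0
      exact hc.isPreconnected
    · simp
    · have : {s : ℂ | 1 < s.re} ∈ 𝓝 (2 : ℂ) :=
        (isOpen_lt continuous_const Complex.continuous_re).mem_nhds (by simp)
      filter_upwards [this] with s hs
      rw [h s hs, hI, hmel]
  have h1 : f s = p s * mellin g (-s) := heq hs
  rw [h1, ← hmel, norm_mul]
  gcongr
  have h2 : ∫ u in Ioi N, B * u ^ (-s.re - 1) = B * N ^ (-s.re) / s.re := by
    rw [integral_const_mul, integral_Ioi_rpow_of_lt (by linarith) (by linarith)]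
    rw [show -s.re - 1 + 1 = -s.re by ring, neg_div_neg_eq, mul_div_assoc]
  rw [← h2]
  refine norm_integral_le_of_norm_le ?_ ?_
  · exact (integrableOn_Ioi_rpow_of_lt (by linarith) (by linarith)).const_mul B
  · refine (ae_restrict_iff' measurableSet_Ioi).2 (ae_of_all _ fun u hu => ?_)
    have hu0 : 0 < u := by have : N < u := hu; linarith
    rw [norm_mul, norm_cpow_eq_rpow_re_of_pos hu0]
    have : (-(s + 1)).re = -s.re - 1 := by simp; ring
    rw [this]
    gcongr
    exact hb u

end BDH

namespace BDH

open Set Filter Topology MeasureTheory Complex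

lemma sum_range_zmod {q : ℕ} [NeZero q] (f : ZMod q → ℂ) (c : ZMod q) :
    ∑ k ∈ Finset.range q, f (c + k) = ∑ a, f a := by
  rw [← Fintype.sum_equiv (Equiv.addLeft c) (fun a => f (c + a)) f (fun a => by simp)]
  refine Finset.sum_bij' (fun k _ => (k : ZMod q)) (fun a _ => a.val) ?_ ?_ ?_ ?_ ?_
  · simp
  · intro a _; simpa using ZMod.val_lt a
  · intro k hk; exact ZMod.val_cast_of_lt (by simpa using hk)
  · simp
  · simp

lemma norm_sum_range_char_le {q : ℕ} [NeZero q] {χ : DirichletCharacter ℂ q} (hχ : χ ≠ 1) (n : ℕ) :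
    ‖∑ k ∈ Finset.range n, χ k‖ ≤ q := by
  induction n using Nat.strong_induction_on with
  | _ n ih =>
    rcases lt_or_ge n q with h | h
    · calc _ ≤ ∑ k ∈ Finset.range n, ‖χ k‖ := norm_sum_le _ _
        _ ≤ ∑ k ∈ Finset.range n, 1 := Finset.sum_le_sum fun k _ => χ.norm_le_one _
        _ ≤ q := by simpa using h.le
    · obtain ⟨m, rfl⟩ := Nat.exists_eq_add_of_le' h
      rw [Finset.sum_range_add]
      have : ∑ x ∈ Finset.range q, χ ((m + x : ℕ) : ZMod q) = 0 := by
        simp only [Nat.cast_add]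
        rw [sum_range_zmod (fun a => χ a) (m : ZMod q)]
        exact MulChar.sum_eq_zero_of_ne_one hχ
      rw [this, add_zero]
      exact ih m (by have := NeZero.pos q; omega)

lemma norm_sum_Icc_char_le {q : ℕ} [NeZero q] {χ : DirichletCharacter ℂ q} (hχ : χ ≠ 1) (n : ℕ) :
    ‖∑ k ∈ Finset.Icc 1 n, χ k‖ ≤ 2 * q := by
  have h1 : ∑ k ∈ Finset.range (n + 1), χ k = χ (0 : ℕ) + ∑ k ∈ Finset.Icc 1 n, χ k := by
    rw [Finset.range_eq_Ico, Finset.sum_eq_sum_Ico_succ_bot (by omega)]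
    rfl
  have h2 : ∑ k ∈ Finset.Icc 1 n, χ k = ∑ k ∈ Finset.range (n + 1), χ k - χ (0 : ℕ) := by
    rw [h1]; ring
  rw [h2]
  refine (norm_sub_le _ _).trans ?_
  have h3 := norm_sum_range_char_le hχ (n + 1)
  have h4 := χ.norm_le_one (0 : ℕ)
  have h5 : (1 : ℝ) ≤ q := by exact_mod_cast NeZero.pos q
  linarith

/-- A Dirichlet series splits into its first `N` terms and the remaining ones. -/
lemma LSeries_eq_sum_add {a : ℕ → ℂ} {s : ℂ} (ha : LSeriesSummable a s) (N : ℕ) :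
    LSeriesSummable (fun n => if n ≤ N then 0 else a n) s ∧
    LSeries a s = ∑ n ∈ Finset.Icc 1 N, a n * (n : ℂ) ^ (-s) +
      LSeries (fun n => if n ≤ N then 0 else a n) s := by
  set c : ℕ → ℂ := fun n => if n ≤ N then 0 else a n
  set b : ℕ → ℂ := fun n => if n ≤ N then a n else 0
  have hab : a = b + c := by
    ext n; simp only [b, c, Pi.add_apply]; split_ifs <;> simp
  have hb0 : ∀ n ∉ Finset.Icc 1 N, LSeries.term b s n = 0 := by
    intro n hn
    rcases Nat.eq_zero_or_pos n with rfl | h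
    · simp
    · rw [LSeries.term_of_ne_zero h.ne']
      have : ¬ n ≤ N := fun h' => hn (Finset.mem_Icc.2 ⟨h, h'⟩)
      simp [b, this]
  have hbs : LSeriesSummable b s := summable_of_ne_finset_zero (s := Finset.Icc 1 N) hb0
  have hcs : LSeriesSummable c s := by
    have : c = a - b := by rw [hab]; ring
    rw [this]; exact ha.sub hbs
  refine ⟨hcs, ?_⟩
  rw [hab, LSeries_add hbs hcs]
  congr 1
  rw [LSeries, tsum_eq_sum hb0]
  refine Finset.sum_congr rfl fun n hn => ?_
  have hn' := Finset.mem_Icc.1 hn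
  have hc0 : c n = 0 := by simp [c, hn'.2]
  rw [LSeries.term_of_ne_zero (by omega), Pi.add_apply, hc0, add_zero, cpow_neg, div_eq_mul_inv]

/-- The zeta-type constant appearing in the trivial estimate for the head of a Dirichlet series. -/
lemma sum_rpow_le {ε : ℝ} (hε : 0 < ε) : ∃ K : ℝ, 1 ≤ K ∧ ∀ N : ℕ, ∀ σ : ℝ, 1 - ε ≤ σ →
    ∑ n ∈ Finset.Icc 1 N, (n : ℝ) ^ (-σ) ≤ K * (N : ℝ) ^ (2 * ε) := by
  have hs : Summable fun n : ℕ => (n : ℝ) ^ (-1 - ε) :=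
    Real.summable_nat_rpow.2 (by linarith)
  refine ⟨max 1 (∑' n : ℕ, (n : ℝ) ^ (-1 - ε)), le_max_left _ _, fun N σ hσ => ?_⟩
  calc _ ≤ ∑ n ∈ Finset.Icc 1 N, (n : ℝ) ^ (-1 - ε) * (N : ℝ) ^ (2 * ε) := by
        refine Finset.sum_le_sum fun n hn => ?_
        have hn' := Finset.mem_Icc.1 hn
        have h1 : (1 : ℝ) ≤ n := by exact_mod_cast hn'.1
        calc (n : ℝ) ^ (-σ) ≤ (n : ℝ) ^ ((-1 - ε) + 2 * ε) :=
              Real.rpow_le_rpow_of_exponent_le h1 (by linarith)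
          _ = (n : ℝ) ^ (-1 - ε) * (n : ℝ) ^ (2 * ε) := Real.rpow_add (by linarith) _ _
          _ ≤ _ := by
              gcongr
              exact_mod_cast hn'.2
    _ = (∑ n ∈ Finset.Icc 1 N, (n : ℝ) ^ (-1 - ε)) * (N : ℝ) ^ (2 * ε) := by
        rw [Finset.sum_mul]
    _ ≤ _ := by
        gcongr
        refine le_max_of_le_right (hs.sum_le_tsum _ fun n _ => by positivity)

lemma norm_sum_mul_cpow_le {a : ℕ → ℂ} (ha : ∀ n, ‖a n‖ ≤ 1) (N : ℕ) (s : ℂ) :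
    ‖∑ n ∈ Finset.Icc 1 N, a n * (n : ℂ) ^ (-s)‖ ≤ ∑ n ∈ Finset.Icc 1 N, (n : ℝ) ^ (-s.re) := by
  refine norm_sum_le_of_le _ fun n hn => ?_
  have hn' := (Finset.mem_Icc.1 hn).1
  rw [norm_mul, norm_natCast_cpow_of_pos (by omega), neg_re]
  exact mul_le_of_le_one_left (by positivity) (ha n)

lemma LFunction_eq_sum_add {q : ℕ} [NeZero q] {χ : DirichletCharacter ℂ q} (hχ : χ ≠ 1)
    {N : ℕ} (hN : 1 ≤ N) {s : ℂ} (hs : 0 < s.re) :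
    ‖χ.LFunction s - ∑ n ∈ Finset.Icc 1 N, χ n * (n : ℂ) ^ (-s)‖
      ≤ ‖s‖ * ((4 * q : ℝ) * (N : ℝ) ^ (-s.re) / s.re) := by
  set c : ℕ → ℂ := fun n => if n ≤ N then 0 else χ n with hc
  have hS : ∀ n, ∑ k ∈ Finset.Icc 1 n, c k
      = ∑ k ∈ Finset.Icc 1 n, χ k - ∑ k ∈ Finset.Icc 1 (min n N), χ k := by
    intro n
    have : Finset.Icc 1 (min n N) = (Finset.Icc 1 n).filter (· ≤ N) := by
      ext k; simp; omega
    rw [this, Finset.sum_filter, ← Finset.sum_sub_distrib]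
    refine Finset.sum_congr rfl fun k _ => ?_
    simp only [hc]; split_ifs <;> simp
  have hSb : ∀ n, ‖∑ k ∈ Finset.Icc 1 n, c k‖ ≤ 4 * q := by
    intro n
    rw [hS]
    refine (norm_sub_le _ _).trans ?_
    have := norm_sum_Icc_char_le hχ n
    have := norm_sum_Icc_char_le hχ (min n N)
    linarith
  refine norm_le_of_eq_mul_integral (g := fun u => ∑ k ∈ Finset.Icc 1 ⌊u⌋₊, c k) (p := id)
    (f := fun s => χ.LFunction s - ∑ n ∈ Finset.Icc 1 N, χ n * (n : ℂ) ^ (-s))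
    (N := N) (by exact_mod_cast hN) ?_ (fun u => hSb _) ?_ ?_ differentiable_id ?_ hs
  · exact (measurable_from_nat (f := fun n => ∑ k ∈ Finset.Icc 1 n, c k)).comp Nat.measurable_floor
  · intro u hu
    refine Finset.sum_eq_zero fun k hk => ?_
    have h1 := (Finset.mem_Icc.1 hk).2
    have h2 : ⌊u⌋₊ ≤ N := Nat.floor_le_of_le hu.le
    simp [hc, h1.trans h2]
  · intro s _
    refine (DirichletCharacter.differentiable_LFunction hχ s).sub ?_
    refine DifferentiableAt.fun_sum fun n hn => ?_
    have : (n : ℂ) ≠ 0 := by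
      have := (Finset.mem_Icc.1 hn).1
      exact_mod_cast (by omega : n ≠ 0)
    exact (DifferentiableAt.const_cpow differentiableAt_id.neg (Or.inl this)).const_mul _
  · intro s hs
    obtain ⟨h1, h2⟩ := LSeries_eq_sum_add
      (DirichletCharacter.LSeriesSummable_of_one_lt_re χ hs) N
    rw [DirichletCharacter.LFunction_eq_LSeries χ hs, h2, add_sub_cancel_left,
      LSeries_eq_mul_integral _ (r := 0) le_rfl (by linarith) h1]
    · rfl
    · refine Asymptotics.IsBigO.of_bound (4 * q) (Eventually.of_forall fun n => ?_)
      simpa using hSb n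

lemma norm_le_of_re_le {s : ℂ} (h0 : 0 ≤ s.re) (h4 : s.re ≤ 4) : ‖s‖ ≤ 2 * (|s.im| + 2) := by
  have := Complex.norm_le_abs_re_add_abs_im s
  rw [abs_of_nonneg h0] at this
  have := abs_nonneg s.im
  linarith

/-- The analytic conductor of height `s.im` at modulus `q`. -/
noncomputable def cond (q : ℕ) (s : ℂ) : ℝ := q * (|s.im| + 2)

lemma two_le_cond (q : ℕ) [NeZero q] (s : ℂ) : 2 ≤ cond q s := by
  have h1 : (1 : ℝ) ≤ q := by exact_mod_cast NeZero.pos q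
  have := abs_nonneg s.im
  unfold cond
  nlinarith

lemma exists_ceil_cond (q : ℕ) [NeZero q] (s : ℂ) : ∃ N : ℕ, 1 ≤ N ∧ cond q s ≤ N ∧
    (N : ℝ) ≤ 2 * cond q s := by
  have h := two_le_cond q s
  have h2 := Nat.ceil_lt_add_one (a := cond q s) (by linarith)
  have h3 := Nat.le_ceil (cond q s)
  refine ⟨⌈cond q s⌉₊, ?_, h3, by linarith⟩
  have : (1 : ℝ) ≤ (⌈cond q s⌉₊ : ℝ) := by linarith
  exact_mod_cast this

theorem norm_LFunction_le {ε : ℝ} (hε : 0 < ε) (hε' : ε ≤ 1 / 3) : ∃ K : ℝ, 1 ≤ K ∧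
    ∀ (q : ℕ) [NeZero q] (χ : DirichletCharacter ℂ q), χ ≠ 1 → ∀ s : ℂ, 1 - ε ≤ s.re →
      s.re ≤ 4 → ‖χ.LFunction s‖ ≤ K * cond q s ^ (2 * ε) := by
  obtain ⟨K, hK1, hK⟩ := sum_rpow_le hε
  refine ⟨(K + 12) * 2, by linarith, fun q _ χ hχ s hs hs4 => ?_⟩
  obtain ⟨N, hN1, hN2, hN3⟩ := exists_ceil_cond q s
  have hX := two_le_cond q s
  have hs0 : 2 / 3 ≤ s.re := by linarith
  have hN1' : (1 : ℝ) ≤ N := by exact_mod_cast hN1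
  have hN0 : (0 : ℝ) < N := by linarith
  have h1 := LFunction_eq_sum_add hχ hN1 (s := s) (by linarith)
  have h2 := (norm_sum_mul_cpow_le (a := fun n => χ n) (fun n => χ.norm_le_one _) N s).trans
    (hK N s.re hs)
  have h3 : ‖s‖ * ((4 * q : ℝ) * (N : ℝ) ^ (-s.re) / s.re) ≤ 12 * (N : ℝ) ^ (2 * ε) := by
    have e1 : ‖s‖ * q ≤ 2 * N := by
      calc ‖s‖ * q ≤ 2 * (|s.im| + 2) * q := by gcongr; exact norm_le_of_re_le (by linarith) hs4
        _ = 2 * cond q s := by unfold cond; ring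
        _ ≤ 2 * N := by linarith
    have e2 : (N : ℝ) ^ (-s.re) * N ≤ (N : ℝ) ^ (2 * ε) := by
      rw [← Real.rpow_add_one hN0.ne']
      exact Real.rpow_le_rpow_of_exponent_le hN1' (by linarith)
    have e3 : 0 ≤ (N : ℝ) ^ (-s.re) := by positivity
    calc _ = 4 * (‖s‖ * q) * (N : ℝ) ^ (-s.re) / s.re := by ring
      _ ≤ 4 * (2 * N) * (N : ℝ) ^ (-s.re) / s.re := by gcongr
      _ = 8 * ((N : ℝ) ^ (-s.re) * N) / s.re := by ring
      _ ≤ 8 * (N : ℝ) ^ (2 * ε) / (2 / 3) := by gcongr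
      _ = _ := by ring
  have h4 : (N : ℝ) ^ (2 * ε) ≤ 2 * cond q s ^ (2 * ε) := by
    calc (N : ℝ) ^ (2 * ε) ≤ (2 * cond q s) ^ (2 * ε) := by gcongr
      _ = 2 ^ (2 * ε) * cond q s ^ (2 * ε) := Real.mul_rpow (by norm_num) (by linarith)
      _ ≤ 2 ^ (1 : ℝ) * cond q s ^ (2 * ε) := by gcongr <;> linarith
      _ = _ := by rw [Real.rpow_one]
  calc ‖χ.LFunction s‖ = ‖(χ.LFunction s - ∑ n ∈ Finset.Icc 1 N, χ n * (n : ℂ) ^ (-s))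
        + ∑ n ∈ Finset.Icc 1 N, χ n * (n : ℂ) ^ (-s)‖ := by ring_nf
    _ ≤ _ := norm_add_le _ _
    _ ≤ (K + 12) * (N : ℝ) ^ (2 * ε) := by linarith
    _ ≤ (K + 12) * (2 * cond q s ^ (2 * ε)) := by gcongr
    _ = _ := by ring

end BDH

namespace BDH

open Set Filter Topology MeasureTheory Complex

/-- The entire function `(s - 1) ζ(s)`. -/
noncomputable abbrev Z : ℂ → ℂ := DirichletCharacter.LFunctionTrivChar₁ 1

lemma differentiable_Z : Differentiable ℂ Z := DirichletCharacter.differentiable_LFunctionTrivChar₁ 1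

lemma Z_one : Z 1 = 1 := by simp [Z]

lemma Z_eq {s : ℂ} (hs : s ≠ 1) : Z s = (s - 1) * riemannZeta s := by
  rw [Z, DirichletCharacter.LFunctionTrivChar₁, Function.update_of_ne hs,
    DirichletCharacter.LFunctionTrivChar, DirichletCharacter.LFunction_modOne_eq]

lemma integral_sub_mul_cpow {N : ℝ} (hN : 1 ≤ N) {s : ℂ} (hs : 1 < s.re) :
    IntegrableOn (fun u : ℝ => (if u < N then 0 else (u - N : ℂ)) * (u : ℂ) ^ (-(s + 1))) (Ioi 1) ∧
    s * ∫ u in Ioi (1 : ℝ), (if u < N then 0 else (u - N : ℂ)) * (u : ℂ) ^ (-(s + 1))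
      = (N : ℂ) ^ (1 - s) / (s - 1) := by
  have hN0 : 0 < N := by linarith
  have hs1 : s - 1 ≠ 0 := fun h => by
    have := congrArg re h; simp at this; linarith
  have hs0 : s ≠ 0 := fun h => by simp [h] at hs; linarith
  have hi1 : IntegrableOn (fun u : ℝ => (u : ℂ) ^ (-s)) (Ioi N) :=
    integrableOn_Ioi_cpow_of_lt (by simpa using hs) hN0
  have hi2 : IntegrableOn (fun u : ℝ => (N : ℂ) * (u : ℂ) ^ (-(s + 1))) (Ioi N) :=
    (integrableOn_Ioi_cpow_of_lt (by simp; linarith) hN0).const_mul _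
  have heq : EqOn (fun u : ℝ => (u : ℂ) ^ (-s) - (N : ℂ) * (u : ℂ) ^ (-(s + 1)))
      (fun u : ℝ => (if u < N then 0 else (u - N : ℂ)) * (u : ℂ) ^ (-(s + 1))) (Ioi N) := by
    intro u hu
    have hu' : N < u := hu
    have hu0 : (u : ℂ) ≠ 0 := by exact_mod_cast (by linarith : u ≠ 0)
    simp only [not_lt.2 hu'.le, if_false, sub_mul]
    congr 1
    rw [neg_add, cpow_add _ _ hu0, cpow_neg_one]
    field_simp
  have h0 : ∀ u ∈ Ioi (1 : ℝ) \ Ioi N,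
      (if u < N then 0 else (u - N : ℂ)) * (u : ℂ) ^ (-(s + 1)) = 0 := by
    intro u hu
    have hu' : u ≤ N := by simpa using hu.2
    rcases hu'.lt_or_eq with h | h
    · simp [h]
    · simp [h]
  constructor
  · refine IntegrableOn.of_forall_sdiff_eq_zero ?_ measurableSet_Ioi h0
    exact (hi1.sub hi2).congr_fun heq measurableSet_Ioi
  · rw [setIntegral_eq_of_subset_of_forall_sdiff_eq_zero measurableSet_Ioi
      (Ioi_subset_Ioi hN) h0, ← setIntegral_congr_fun measurableSet_Ioi heq,
      integral_sub hi1 hi2, integral_const_mul, integral_Ioi_cpow_of_lt (by simpa using hs) hN0,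
      integral_Ioi_cpow_of_lt (by simp; linarith) hN0]
    have hNc : (N : ℂ) ≠ 0 := by exact_mod_cast hN0.ne'
    have e1 : -(s + 1) + 1 = -s := by ring
    have e2 : -s + 1 = 1 - s := by ring
    have e3 : (N : ℂ) ^ (1 - s) = N * (N : ℂ) ^ (-s) := by
      rw [sub_eq_add_neg, cpow_add _ _ hNc, cpow_one]
    have hs2 : 1 - s ≠ 0 := fun h => hs1 (by linear_combination -h)
    rw [e1, e2, e3]
    field_simp
    ring

lemma Z_eq_sum_add {N : ℕ} (hN : 1 ≤ N) {s : ℂ} (hs : 0 < s.re) :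
    ‖Z s - (N : ℂ) ^ (1 - s) - (s - 1) * ∑ n ∈ Finset.Icc 1 N, (n : ℂ) ^ (-s)‖
      ≤ ‖(s - 1) * s‖ * (1 * (N : ℝ) ^ (-s.re) / s.re) := by
  have hN0 : (N : ℂ) ≠ 0 := by exact_mod_cast (by omega : N ≠ 0)
  have hN1 : (1 : ℝ) ≤ N := by exact_mod_cast hN
  refine norm_le_of_eq_mul_integral
    (g := fun u : ℝ => if u < N then 0 else ((⌊u⌋₊ : ℂ) - u)) (p := fun s => (s - 1) * s)
    (f := fun s => Z s - (N : ℂ) ^ (1 - s) - (s - 1) * ∑ n ∈ Finset.Icc 1 N, (n : ℂ) ^ (-s))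
    (N := N) hN1 ?_ ?_ ?_ ?_ (by fun_prop) ?_ hs
  · refine Measurable.ite measurableSet_Iio measurable_const ?_
    exact (((measurable_from_nat (f := fun n : ℕ => (n : ℂ))).comp Nat.measurable_floor)).sub
      measurable_ofReal
  · intro u
    split_ifs with h
    · simp
    · have hu0 : 0 ≤ u := by linarith [not_lt.1 h]
      have h1 := Nat.floor_le hu0
      have h2 := Nat.lt_floor_add_one u
      rw [show ((⌊u⌋₊ : ℂ) - u) = ((⌊u⌋₊ - u : ℝ) : ℂ) by push_cast; rfl, norm_real,
        Real.norm_eq_abs, abs_le]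
      constructor <;> linarith
  · intro u hu; simp [hu]
  · intro s _
    refine ((differentiable_Z s).sub ?_).sub (DifferentiableAt.mul (by fun_prop) ?_)
    · exact DifferentiableAt.const_cpow (by fun_prop) (Or.inl hN0)
    · refine DifferentiableAt.fun_sum fun n hn => ?_
      have : (n : ℂ) ≠ 0 := by
        have := (Finset.mem_Icc.1 hn).1
        exact_mod_cast (by omega : n ≠ 0)
      exact (DifferentiableAt.const_cpow differentiableAt_id.neg (Or.inl this))
  · intro s hs
    have hs1' : s ≠ 1 := fun h => by simp [h] at hs
    have hs1 : s - 1 ≠ 0 := sub_ne_zero.2 hs1'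
    obtain ⟨h1, h2⟩ := LSeries_eq_sum_add (LSeriesSummable_one_iff.2 hs) N
    set c : ℕ → ℂ := fun n => if n ≤ N then 0 else (1 : ℕ → ℂ) n with hc
    have hS : ∀ n, ∑ k ∈ Finset.Icc 1 n, c k = ((n - N : ℕ) : ℂ) := by
      intro n
      have : ∀ k, c k = if N < k then 1 else 0 := by
        intro k; simp only [hc]; split_ifs <;> first | rfl | omega
      simp only [this]
      rw [Finset.sum_boole]
      congr 1
      have : (Finset.Icc 1 n).filter (N < ·) = Finset.Ioc N n := by
        ext k; simp; omega
      rw [this]; simp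
    have h3 := LSeries_eq_mul_integral c (r := 1) (by norm_num) (by linarith) h1 (by
      refine Asymptotics.IsBigO.of_bound 1 (Eventually.of_forall fun n => ?_)
      rw [hS]
      simp only [Complex.norm_natCast, Real.rpow_one, one_mul, Real.norm_natCast]
      exact_mod_cast Nat.sub_le n N)
    obtain ⟨hi, h_int⟩ := integral_sub_mul_cpow hN1 hs
    have hg : ∀ u ∈ Ioi (1 : ℝ), (∑ k ∈ Finset.Icc 1 ⌊u⌋₊, c k) * (u : ℂ) ^ (-(s + 1))
        = (if u < N then 0 else ((⌊u⌋₊ : ℂ) - u)) * (u : ℂ) ^ (-(s + 1)) +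
        (if u < N then 0 else ((u : ℂ) - (N : ℝ))) * (u : ℂ) ^ (-(s + 1)) := by
      intro u hu
      rw [hS, ← add_mul]
      congr 1
      split_ifs with h
      · have : ⌊u⌋₊ ≤ N := Nat.floor_le_of_le h.le
        simp [Nat.sub_eq_zero_of_le this]
      · have : N ≤ ⌊u⌋₊ := Nat.le_floor (not_lt.1 h)
        push_cast [Nat.cast_sub this]
        ring
    have hi2 : IntegrableOn (fun u : ℝ => (∑ k ∈ Finset.Icc 1 ⌊u⌋₊, c k) * (u : ℂ) ^ (-(s + 1)))
        (Ioi 1) := by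
      have hb : IntegrableOn (fun u : ℝ => u ^ (-s.re)) (Ioi 1) :=
        integrableOn_Ioi_rpow_of_lt (by linarith) one_pos
      refine Integrable.mono' hb ?_ ?_
      · refine AEStronglyMeasurable.mul ?_ ?_
        · exact ((measurable_from_nat (f := fun n => ∑ k ∈ Finset.Icc 1 n, c k)).comp
            Nat.measurable_floor).aestronglyMeasurable
        · exact (Measurable.pow_const measurable_ofReal _).aestronglyMeasurable
      · refine (ae_restrict_iff' measurableSet_Ioi).2 (ae_of_all _ fun u hu => ?_)
        have hu1 : 1 < u := hu
        have hu0 : 0 < u := by linarith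
        rw [norm_mul, hS, norm_cpow_eq_rpow_re_of_pos hu0, Complex.norm_natCast]
        have e : (-(s + 1)).re = -s.re - 1 := by simp; ring
        rw [e, Real.rpow_sub_one hu0.ne']
        have : ((⌊u⌋₊ - N : ℕ) : ℝ) ≤ u :=
          (Nat.cast_le.2 (Nat.sub_le _ _)).trans (Nat.floor_le hu0.le)
        calc _ ≤ u * (u ^ (-s.re) / u) := by gcongr
          _ = _ := by field_simp
    have hi3 : IntegrableOn (fun u : ℝ => (if u < N then 0 else ((⌊u⌋₊ : ℂ) - u)) *
        (u : ℂ) ^ (-(s + 1))) (Ioi 1) := by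
      refine (hi2.sub hi).congr_fun (fun u hu => ?_) measurableSet_Ioi
      simp only [Pi.sub_apply]
      rw [hg u hu]; ring
    rw [setIntegral_congr_fun measurableSet_Ioi hg, integral_add hi3 hi, mul_add, h_int] at h3
    have h4 : riemannZeta s = ∑ n ∈ Finset.Icc 1 N, (n : ℂ) ^ (-s) + LSeries c s := by
      rw [← LSeries_one_eq_riemannZeta hs, h2]; simp
    rw [Z_eq hs1', h4, h3]
    simp only [ofReal_natCast]
    field_simp
    ring

theorem norm_Z_le {ε : ℝ} (hε : 0 < ε) (hε' : ε ≤ 1 / 3) : ∃ K : ℝ, 1 ≤ K ∧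
    ∀ s : ℂ, 1 - ε ≤ s.re → s.re ≤ 4 → ‖Z s‖ ≤ K * cond 1 s ^ (1 + 2 * ε) := by
  obtain ⟨K, hK1, hK⟩ := sum_rpow_le hε
  refine ⟨(1 + 3 * K + 9) * 2, by linarith, fun s hs hs4 => ?_⟩
  obtain ⟨N, hN1, hN2, hN3⟩ := exists_ceil_cond 1 s
  have hX := two_le_cond 1 s
  have hs0 : 2 / 3 ≤ s.re := by linarith
  have hN1' : (1 : ℝ) ≤ N := by exact_mod_cast hN1
  have hN0 : (0 : ℝ) < N := by linarith
  set X := cond 1 s with hXdef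
  have hsn : ‖s‖ ≤ 2 * X := by
    have := norm_le_of_re_le (by linarith) hs4
    simpa [hXdef, cond] using this
  have hsn1 : ‖s - 1‖ ≤ 3 * X := by
    have := norm_sub_le s 1
    simp only [norm_one] at this; linarith
  have h1 := Z_eq_sum_add hN1 (s := s) (by linarith)
  have h2 := (norm_sum_mul_cpow_le (a := fun _ => 1) (fun n => by simp) N s).trans (hK N s.re hs)
  simp only [one_mul] at h2 h1
  have h3 : ‖(s - 1) * s‖ * ((N : ℝ) ^ (-s.re) / s.re) ≤ 9 * X * (N : ℝ) ^ (2 * ε) := by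
    have e2 : (N : ℝ) ^ (-s.re) * N ≤ (N : ℝ) ^ (2 * ε) := by
      rw [← Real.rpow_add_one hN0.ne']
      exact Real.rpow_le_rpow_of_exponent_le hN1' (by linarith)
    have e3 : 0 ≤ (N : ℝ) ^ (-s.re) := by positivity
    rw [norm_mul]
    calc _ ≤ (3 * X) * (2 * N) * ((N : ℝ) ^ (-s.re) / (2 / 3)) := by gcongr; linarith
      _ = 9 * X * ((N : ℝ) ^ (-s.re) * N) := by ring
      _ ≤ _ := by gcongr
  have h5 : ‖(N : ℂ) ^ (1 - s)‖ ≤ X * (N : ℝ) ^ (2 * ε) := by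
    rw [norm_natCast_cpow_of_pos (by omega)]
    calc (N : ℝ) ^ (1 - s).re ≤ (N : ℝ) ^ (2 * ε) :=
          Real.rpow_le_rpow_of_exponent_le hN1' (by simp; linarith)
      _ = 1 * (N : ℝ) ^ (2 * ε) := by ring
      _ ≤ _ := by gcongr; linarith
  have h4 : (N : ℝ) ^ (2 * ε) ≤ 2 * X ^ (2 * ε) := by
    calc (N : ℝ) ^ (2 * ε) ≤ (2 * X) ^ (2 * ε) := by gcongr
      _ = 2 ^ (2 * ε) * X ^ (2 * ε) := Real.mul_rpow (by norm_num) (by linarith)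
      _ ≤ 2 ^ (1 : ℝ) * X ^ (2 * ε) := by gcongr <;> linarith
      _ = _ := by rw [Real.rpow_one]
  set S := ∑ n ∈ Finset.Icc 1 N, (n : ℂ) ^ (-s)
  calc ‖Z s‖ = ‖(Z s - (N : ℂ) ^ (1 - s) - (s - 1) * S) + ((N : ℂ) ^ (1 - s) + (s - 1) * S)‖ := by
        ring_nf
    _ ≤ _ + (_ + _) := (norm_add_le _ _).trans (add_le_add le_rfl (norm_add_le _ _))
    _ ≤ 9 * X * (N : ℝ) ^ (2 * ε) + (X * (N : ℝ) ^ (2 * ε) + 3 * X * (K * (N : ℝ) ^ (2 * ε))) := by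
        gcongr
        · exact h1.trans h3
        · rw [norm_mul]; gcongr
    _ = (1 + 3 * K + 9) * X * (N : ℝ) ^ (2 * ε) := by ring
    _ ≤ (1 + 3 * K + 9) * X * (2 * X ^ (2 * ε)) := by gcongr
    _ = (1 + 3 * K + 9) * 2 * (X ^ (1 : ℝ) * X ^ (2 * ε)) := by rw [Real.rpow_one]; ring
    _ = _ := by rw [← Real.rpow_add (by linarith)]

end BDH

namespace BDH

open Set Filter Topology MeasureTheory Complex

lemma prod_div_sub_one_le (S : Finset ℕ) (hS : ∀ p ∈ S, 2 ≤ p) :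
    ∏ p ∈ S, ((p : ℝ) / (p - 1)) ≤ S.card + 1 := by
  induction S using Finset.induction_on_max with
  | empty => simp
  | insert a s ha ih =>
    have has : a ∉ s := fun h => lt_irrefl _ (ha a h)
    have h2 : 2 ≤ a := hS a (Finset.mem_insert_self a s)
    have hsub : s ⊆ Finset.Ico 2 a := fun p hp =>
      Finset.mem_Ico.2 ⟨hS p (Finset.mem_insert_of_mem hp), ha p hp⟩
    have hcard : s.card + 2 ≤ a := by
      have := Finset.card_le_card hsub
      simp at this; omega
    have hcard' : (s.card : ℝ) + 2 ≤ a := by exact_mod_cast hcard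
    have hc0 : (0 : ℝ) ≤ s.card := by positivity
    rw [Finset.prod_insert has, Finset.card_insert_of_notMem has]
    have ih' := ih fun p hp => hS p (Finset.mem_insert_of_mem hp)
    calc (a : ℝ) / (a - 1) * ∏ p ∈ s, ((p : ℝ) / (p - 1))
        ≤ ((a : ℝ) / (a - 1)) * (s.card + 1) := by
          gcongr
          exact div_nonneg (by positivity) (by linarith)
      _ ≤ (s.card + 1 : ℕ) + 1 := by
          rw [div_mul_eq_mul_div, div_le_iff₀ (by linarith)]
          push_cast; nlinarith

lemma prod_primeFactors_le (q : ℕ) :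
    ∏ p ∈ q.primeFactors, ((p : ℝ) / (p - 1)) ≤ q.primeFactors.card + 1 :=
  prod_div_sub_one_le _ fun _ hp => (Nat.prime_of_mem_primeFactors hp).two_le

lemma div_totient_le (q : ℕ) : (q : ℝ) / q.totient ≤ q.primeFactors.card + 1 := by
  rcases Nat.eq_zero_or_pos q with rfl | hq
  · simp
  refine le_trans (le_of_eq ?_) (prod_primeFactors_le q)
  have h := congrArg (fun r : ℚ => (r : ℝ)) (Nat.totient_eq_mul_prod_factors q)
  push_cast at h
  rw [h, div_mul_cancel_left₀ (by exact_mod_cast hq.ne'), ← Finset.prod_inv_distrib]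
  refine Finset.prod_congr rfl fun p hp => ?_
  have h2 : (2 : ℝ) ≤ p := by exact_mod_cast (Nat.prime_of_mem_primeFactors hp).two_le
  have : (p : ℝ) - 1 ≠ 0 := by linarith
  field_simp

lemma two_pow_card_primeFactors_le {q : ℕ} (hq : q ≠ 0) : 2 ^ q.primeFactors.card ≤ q :=
  (Finset.pow_card_le_prod _ _ _ fun _ hp => (Nat.prime_of_mem_primeFactors hp).two_le).trans
    (Nat.le_of_dvd (Nat.pos_of_ne_zero hq) (Nat.prod_primeFactors_dvd q))

lemma card_primeFactors_le_log {q : ℕ} (hq : q ≠ 0) :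
    (q.primeFactors.card : ℝ) ≤ 2 * Real.log q := by
  have h : ((2 : ℝ) ^ q.primeFactors.card) ≤ q := by exact_mod_cast two_pow_card_primeFactors_le hq
  have h' := Real.log_le_log (by positivity) h
  rw [Real.log_pow] at h'
  have := Real.log_two_gt_d9
  have h0 : (0 : ℝ) ≤ q.primeFactors.card := by positivity
  nlinarith

lemma card_primeFactors_le_rpow {δ : ℝ} (hδ : 0 < δ) {q : ℕ} (hq : q ≠ 0) :
    (q.primeFactors.card : ℝ) + 1 ≤ (2 / δ + 1) * (q : ℝ) ^ δ := by
  have h1 : (1 : ℝ) ≤ q := by exact_mod_cast Nat.one_le_iff_ne_zero.2 hq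
  have := Real.log_le_rpow_div (by positivity : (0 : ℝ) ≤ q) hδ
  have h2 := card_primeFactors_le_log hq
  have h3 : (1 : ℝ) ≤ (q : ℝ) ^ δ := Real.one_le_rpow h1 hδ.le
  calc (q.primeFactors.card : ℝ) + 1 ≤ 2 * ((q : ℝ) ^ δ / δ) + (q : ℝ) ^ δ := by linarith
    _ = _ := by ring

lemma norm_eulerFactors_le (q : ℕ) {s : ℂ} (hs : 1 ≤ s.re) :
    ‖∏ p ∈ q.primeFactors, (1 - (p : ℂ) ^ (-s))‖ ≤ q.primeFactors.card + 1 := by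
  refine le_trans ?_ (prod_primeFactors_le q)
  rw [norm_prod]
  refine Finset.prod_le_prod (fun _ _ => norm_nonneg _) fun p hp => ?_
  have hp2 : (2 : ℝ) ≤ p := by exact_mod_cast (Nat.prime_of_mem_primeFactors hp).two_le
  have h1 : ‖(p : ℂ) ^ (-s)‖ ≤ (p : ℝ)⁻¹ := by
    rw [Complex.norm_natCast_cpow_of_pos (by exact_mod_cast (by linarith : (0 : ℝ) < p)),
      ← Real.rpow_neg_one]
    exact Real.rpow_le_rpow_of_exponent_le (by linarith) (by simpa using hs)
  calc ‖1 - (p : ℂ) ^ (-s)‖ ≤ 1 + (p : ℝ)⁻¹ := (norm_sub_le _ _).trans (by simpa using h1)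
    _ ≤ p / (p - 1) := by
      rw [le_div_iff₀ (by linarith)]
      have : (p : ℝ)⁻¹ * p = 1 := inv_mul_cancel₀ (by linarith)
      have : 0 < (p : ℝ)⁻¹ := by positivity
      nlinarith

/-- Trivial bound for an `L`-series with bounded coefficients. -/
lemma norm_LSeries_le_div : ∃ B : ℝ, 1 ≤ B ∧ ∀ a : ℕ → ℂ, (∀ n, ‖a n‖ ≤ 1) → ∀ s : ℂ,
    1 < s.re → s.re ≤ 2 → ‖LSeries a s‖ ≤ B / (s.re - 1) := by
  obtain ⟨K, hK, hZ⟩ := norm_Z_le (ε := 1 / 3) (by norm_num) le_rfl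
  refine ⟨K * 2 ^ (1 + 2 * (1 / 3) : ℝ), ?_, fun a ha s hs hs2 => ?_⟩
  · have : (1 : ℝ) ≤ 2 ^ (1 + 2 * (1 / 3) : ℝ) := Real.one_le_rpow (by norm_num) (by norm_num)
    nlinarith
  set σ := s.re
  have hne : (σ : ℂ) ≠ 1 := by
    intro h; have := congrArg re h; simp at this; linarith
  have hsum : Summable fun n : ℕ => ‖LSeries.term 1 (σ : ℂ) n‖ :=
    (LSeriesSummable_one_iff.2 (by simpa using hs)).norm
  have hle : ∀ n, ‖LSeries.term a s n‖ ≤ ‖LSeries.term 1 (σ : ℂ) n‖ := fun n => by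
    rw [LSeries.norm_term_eq, LSeries.norm_term_eq]
    split_ifs
    · rfl
    · simp only [Pi.one_apply, norm_one, ofReal_re]
      gcongr
      exact ha n
  have h1 : ‖LSeries a s‖ ≤ ∑' n, ‖LSeries.term 1 (σ : ℂ) n‖ :=
    tsum_of_norm_bounded hsum.hasSum hle
  have h2 : ((∑' n, ‖LSeries.term 1 (σ : ℂ) n‖ : ℝ) : ℂ) = riemannZeta σ := by
    rw [← LSeries_one_eq_riemannZeta (by simpa using hs), LSeries, ofReal_tsum]
    congr 1; ext n
    rw [LSeries.norm_term_eq, LSeries.term_def]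
    split_ifs
    · simp
    · simp [ofReal_cpow]
  have h3 : ∑' n, ‖LSeries.term 1 (σ : ℂ) n‖ = ‖riemannZeta σ‖ := by
    rw [← h2, norm_real, Real.norm_of_nonneg (tsum_nonneg fun _ => norm_nonneg _)]
  have h4 := hZ (σ : ℂ) (by simp; linarith) (by simp; linarith)
  rw [Z_eq hne, norm_mul] at h4
  have h5 : ‖(σ : ℂ) - 1‖ = σ - 1 := by
    rw [← ofReal_one, ← ofReal_sub, norm_real, Real.norm_of_nonneg (by linarith)]
  rw [h5] at h4
  simp only [cond, ofReal_im, abs_zero, Nat.cast_one, one_mul, zero_add] at h4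
  rw [le_div_iff₀ (by linarith)]
  calc ‖LSeries a s‖ * (σ - 1) ≤ ‖riemannZeta σ‖ * (σ - 1) := by
        gcongr
        linarith
    _ ≤ _ := by linarith

end BDH

namespace BDH

open Set Filter Topology MeasureTheory Complex

lemma norm_image_sub_le_horizontal {f : ℂ → ℂ} {A t : ℝ}
    (hf : ∀ σ : ℝ, 1 < σ → σ ≤ 2 → DifferentiableAt ℂ f (σ + t * I))
    (hd : ∀ σ : ℝ, 1 < σ → σ ≤ 2 → ‖deriv f (σ + t * I)‖ ≤ A) {σ σ' : ℝ}
    (hσ : 1 < σ) (hσ' : 1 < σ') (h2 : σ ≤ 2) (h2' : σ' ≤ 2) :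
    ‖f (σ + t * I) - f (σ' + t * I)‖ ≤ A * |σ - σ'| := by
  have key : ∀ x ∈ Ioc (1 : ℝ) 2, HasDerivWithinAt (fun u : ℝ => f (u + t * I))
      (deriv f (x + t * I)) (Ioc 1 2) x := by
    intro x hx
    have h1 := (hf x hx.1 hx.2).hasDerivAt
    have h2 : HasDerivAt (fun z : ℂ => z + t * I) 1 (x : ℂ) := (hasDerivAt_id _).add_const _
    have h3 := (HasDerivAt.comp (x : ℂ) h1 h2).comp_ofReal
    simpa using h3.hasDerivWithinAt
  have := Convex.norm_image_sub_le_of_norm_hasDerivWithin_le key (fun x hx => hd x hx.1 hx.2)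
    (convex_Ioc 1 2) (x := σ') (y := σ) ⟨hσ', h2'⟩ ⟨hσ, h2⟩
  simpa using this

/-- Quantitative form of the `3-4-1` argument. -/
lemma three_four_one {A B : ℝ} (hB : 1 ≤ B) (hA : 1 ≤ A) (hBs : ∀ a : ℕ → ℂ, (∀ n, ‖a n‖ ≤ 1) →
      ∀ s : ℂ, 1 < s.re → s.re ≤ 2 → ‖LSeries a s‖ ≤ B / (s.re - 1))
    {q : ℕ} [NeZero q] (χ : DirichletCharacter ℂ q) (t : ℝ)
    (hd : ∀ σ : ℝ, 1 < σ → σ ≤ 2 → ‖deriv χ.LFunction (σ + t * I)‖ ≤ A)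
    (h2 : ∀ σ : ℝ, 1 < σ → σ ≤ 2 → ‖(χ ^ 2).LFunction (σ + 2 * t * I)‖ ≤ A)
    {σ : ℝ} (hσ : 1 < σ) (hσ2 : σ ≤ 2) :
    1 / (16 * B ^ 3 * A ^ 4) ≤ ‖χ.LFunction (σ + t * I)‖ := by
  have hB0 : 0 < B := by linarith
  have hA0 : 0 < A := by linarith
  have key : ∀ x : ℝ, 0 < x → x ≤ 1 →
      x ^ 3 / (B ^ 3 * A) ≤ ‖χ.LFunction ((1 + x : ℝ) + t * I)‖ ^ 4 := by
    intro x hx hx1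
    have h := χ.norm_LFunction_product_ge_one hx t
    rw [norm_mul, norm_mul, norm_pow, norm_pow] at h
    have e1 : (1 + x + I * t : ℂ) = (1 + x : ℝ) + t * I := by push_cast; ring
    have e2 : (1 + x + 2 * I * t : ℂ) = (1 + x : ℝ) + 2 * t * I := by push_cast; ring
    have e3 : (1 + x : ℂ) = (1 + x : ℝ) := by push_cast; ring
    rw [e1, e2, e3] at h
    have b1 : ‖DirichletCharacter.LFunctionTrivChar q ((1 + x : ℝ) : ℂ)‖ ≤ B / x := by
      have hre : 1 < (((1 + x : ℝ) : ℂ)).re := by simp; linarith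
      rw [DirichletCharacter.LFunctionTrivChar, DirichletCharacter.LFunction_eq_LSeries 1 hre]
      have := hBs (fun n : ℕ => (1 : DirichletCharacter ℂ q) n)
        (fun n => DirichletCharacter.norm_le_one _ _) _ hre (by simp; linarith)
      simpa using this
    have b2 := h2 (1 + x) (by linarith) (by linarith)
    set ℓ := ‖χ.LFunction ((1 + x : ℝ) + t * I)‖
    have h' : 1 ≤ (B / x) ^ 3 * ℓ ^ 4 * A := le_trans h (by gcongr)
    rw [div_le_iff₀ (by positivity)]
    have : (B / x) ^ 3 * x ^ 3 = B ^ 3 := by rw [div_pow, div_mul_cancel₀]; positivity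
    calc x ^ 3 = x ^ 3 * 1 := by ring
      _ ≤ x ^ 3 * ((B / x) ^ 3 * ℓ ^ 4 * A) := by gcongr
      _ = ((B / x) ^ 3 * x ^ 3) * ℓ ^ 4 * A := by ring
      _ = _ := by rw [this]; ring
  set x0 : ℝ := 1 / (16 * B ^ 3 * A ^ 5) with hx0
  have hB3 : 1 ≤ B ^ 3 := one_le_pow₀ hB
  have hA5 : 1 ≤ A ^ 5 := one_le_pow₀ hA
  have hx0p : 0 < x0 := by positivity
  have hx01 : x0 ≤ 1 := by
    rw [hx0, div_le_one (by positivity)]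
    nlinarith
  have big : ∀ x : ℝ, x0 ≤ x → x ≤ 1 →
      1 / (8 * B ^ 3 * A ^ 4) ≤ ‖χ.LFunction ((1 + x : ℝ) + t * I)‖ := by
    intro x hx hx1
    have h := key x (by linarith) hx1
    refine le_of_pow_le_pow_left₀ (n := 4) (by norm_num) (norm_nonneg _) (le_trans ?_ h)
    calc (1 / (8 * B ^ 3 * A ^ 4)) ^ 4 = x0 ^ 3 / (B ^ 3 * A) := by
          rw [hx0]; field_simp; norm_num
      _ ≤ _ := by gcongr
  have hle : 1 / (16 * B ^ 3 * A ^ 4) ≤ 1 / (8 * B ^ 3 * A ^ 4) := by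
    gcongr; norm_num
  rcases le_total x0 (σ - 1) with h | h
  · have := big (σ - 1) h (by linarith)
    rw [show (1 + (σ - 1)) = σ by ring] at this
    exact hle.trans this
  · have h1 := big x0 le_rfl hx01
    have h3 := norm_image_sub_le_horizontal (f := χ.LFunction) (A := A) (t := t)
      (fun σ hσ _ => χ.differentiableAt_LFunction _ (Or.inl fun h => by
        have := congrArg re h; simp at this; linarith)) hd
      (σ := 1 + x0) (σ' := σ) (by linarith) hσ (by linarith) hσ2
    have h4 : |1 + x0 - σ| ≤ x0 := by rw [abs_le]; constructor <;> linarith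
    have h5 : A * x0 = 1 / (16 * B ^ 3 * A ^ 4) := by rw [hx0]; field_simp
    have h6 : 1 / (8 * B ^ 3 * A ^ 4) = 2 * (1 / (16 * B ^ 3 * A ^ 4)) := by field_simp; norm_num
    have h7 := norm_sub_norm_le (χ.LFunction ((1 + x0 : ℝ) + t * I)) (χ.LFunction (σ + t * I))
    have h8 : A * |1 + x0 - σ| ≤ A * x0 := by gcongr
    linarith

lemma cond_le_two_mul {q : ℕ} {s z : ℂ} (h : ‖z - s‖ ≤ 1) : cond q z ≤ 2 * cond q s := by
  have := (abs_im_le_norm (z - s)).trans h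
  rw [sub_im] at this
  have h2 := abs_sub_abs_le_abs_sub z.im s.im
  unfold cond
  have h3 : |z.im| + 2 ≤ 2 * (|s.im| + 2) := by have := abs_nonneg s.im; linarith
  calc (q : ℝ) * (|z.im| + 2) ≤ q * (2 * (|s.im| + 2)) := by gcongr
    _ = _ := by ring

lemma cond_pos (q : ℕ) [NeZero q] (s : ℂ) : 0 < cond q s := by linarith [two_le_cond q s]

lemma norm_deriv_le_of_cond {f : ℂ → ℂ} {K a r : ℝ} {q : ℕ} [NeZero q] (ha : 0 ≤ a) (ha2 : a ≤ 2)
    (hr : 0 < r) (hr1 : r ≤ 1) (hK : 0 ≤ K) {s : ℂ}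
    (hf : DifferentiableOn ℂ f (Metric.closedBall s r))
    (hb : ∀ z, ‖z - s‖ ≤ r → ‖f z‖ ≤ K * cond q z ^ a) :
    ‖deriv f s‖ ≤ 4 * K / r * cond q s ^ a := by
  have hc := cond_pos q s
  refine (Complex.norm_deriv_le_of_forall_mem_sphere_norm_le hr
    (hf.diffContOnCl_ball subset_rfl) (C := K * (4 * cond q s ^ a))
    fun z hz => ?_).trans (le_of_eq (by ring))
  have hz' : ‖z - s‖ = r := by simpa [dist_eq_norm] using hz
  refine (hb z hz'.le).trans ?_
  gcongr
  calc cond q z ^ a ≤ (2 * cond q s) ^ a := by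
        gcongr
        · exact (cond_pos q z).le
        · exact cond_le_two_mul (by linarith)
    _ = 2 ^ a * cond q s ^ a := Real.mul_rpow (by norm_num) hc.le
    _ ≤ 4 * cond q s ^ a := by
      gcongr
      calc (2 : ℝ) ^ a ≤ 2 ^ (2 : ℝ) := Real.rpow_le_rpow_of_exponent_le (by norm_num) ha2
        _ = 4 := by norm_num

lemma re_bounds_of_norm_sub_le {z s : ℂ} {r : ℝ} (h : ‖z - s‖ ≤ r) :
    s.re - r ≤ z.re ∧ z.re ≤ s.re + r := by
  have := (abs_re_le_norm (z - s)).trans h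
  rw [sub_re, abs_le] at this
  constructor <;> linarith

theorem norm_deriv_LFunction_le {ε : ℝ} (hε : 0 < ε) (hε' : ε ≤ 1 / 3) : ∃ K : ℝ, 1 ≤ K ∧
    ∀ (q : ℕ) [NeZero q] (χ : DirichletCharacter ℂ q), χ ≠ 1 → ∀ s : ℂ, 1 - ε / 2 ≤ s.re →
    s.re ≤ 3 → ‖deriv χ.LFunction s‖ ≤ K * cond q s ^ (2 * ε) := by
  obtain ⟨K, hK, hb⟩ := norm_LFunction_le hε hε'
  refine ⟨4 * K / (ε / 2), ?_, fun q _ χ hχ s h1 h3 => ?_⟩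
  · rw [le_div_iff₀ (by positivity)]; linarith
  · refine norm_deriv_le_of_cond (by positivity) (by linarith) (by positivity) (by linarith)
      (by linarith) (DirichletCharacter.differentiable_LFunction hχ).differentiableOn fun z hz => ?_
    have := re_bounds_of_norm_sub_le hz
    exact hb q χ hχ z (by linarith) (by linarith)

theorem norm_deriv_Z_le {ε : ℝ} (hε : 0 < ε) (hε' : ε ≤ 1 / 3) : ∃ K : ℝ, 1 ≤ K ∧
    ∀ s : ℂ, 1 - ε / 2 ≤ s.re →
    s.re ≤ 3 → ‖deriv Z s‖ ≤ K * cond 1 s ^ (1 + 2 * ε) := by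
  obtain ⟨K, hK, hb⟩ := norm_Z_le hε hε'
  refine ⟨4 * K / (ε / 2), ?_, fun s h1 h3 => ?_⟩
  · rw [le_div_iff₀ (by positivity)]; linarith
  · refine norm_deriv_le_of_cond (by positivity) (by linarith) (by positivity) (by linarith)
      (by linarith) differentiable_Z.differentiableOn fun z hz => ?_
    have := re_bounds_of_norm_sub_le hz
    exact hb z (by linarith) (by linarith)

lemma norm_zeta_le {ε : ℝ} (hε : 0 < ε) (hε' : ε ≤ 1 / 3) : ∃ K : ℝ, 1 ≤ K ∧
    ∀ θ : ℝ, 0 < θ → θ ≤ 1 → ∀ s : ℂ, 1 - ε ≤ s.re → s.re ≤ 4 → θ ≤ |s.im| →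
    ‖riemannZeta s‖ ≤ K / θ * cond 1 s ^ (2 * ε) := by
  obtain ⟨K, hK, hb⟩ := norm_Z_le hε hε'
  refine ⟨3 * K, by linarith, fun θ hθ hθ1 s h1 h4 ht => ?_⟩
  have hs : s ≠ 1 := fun h => by simp [h] at ht; linarith
  have h := hb s h1 h4
  rw [Z_eq hs, norm_mul] at h
  have hc := cond_pos 1 s
  rw [Real.rpow_add hc, Real.rpow_one] at h
  have h5 : |s.im| ≤ ‖s - 1‖ := by simpa using abs_im_le_norm (s - 1)
  have h6 : cond 1 s ≤ 3 / θ * |s.im| := by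
    unfold cond
    rw [div_mul_eq_mul_div, le_div_iff₀ hθ]
    push_cast
    nlinarith
  have h7 : 0 < |s.im| := by linarith
  have h8 : |s.im| * ‖riemannZeta s‖ ≤ |s.im| * (3 * K / θ * cond 1 s ^ (2 * ε)) := by
    calc |s.im| * ‖riemannZeta s‖ ≤ ‖s - 1‖ * ‖riemannZeta s‖ := by gcongr
      _ ≤ K * (cond 1 s * cond 1 s ^ (2 * ε)) := h
      _ ≤ K * ((3 / θ * |s.im|) * cond 1 s ^ (2 * ε)) := by gcongr
      _ = _ := by ring
  exact le_of_mul_le_mul_left h8 h7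

lemma cond_one_le (q : ℕ) [NeZero q] (s : ℂ) : cond 1 s ≤ cond q s := by
  unfold cond
  have : (1 : ℝ) ≤ q := by exact_mod_cast NeZero.one_le
  gcongr
  exact_mod_cast NeZero.one_le

lemma le_cond (q : ℕ) (s : ℂ) : (q : ℝ) ≤ cond q s := by
  unfold cond
  have : 0 ≤ |s.im| := abs_nonneg _
  have : (0 : ℝ) ≤ q := by positivity
  nlinarith

lemma norm_LFunctionTrivChar_le {ε : ℝ} (hε : 0 < ε) (hε' : ε ≤ 1 / 3) : ∃ K : ℝ, 1 ≤ K ∧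
    ∀ θ : ℝ, 0 < θ → θ ≤ 1 → ∀ (q : ℕ) [NeZero q] (s : ℂ), 1 ≤ s.re → s.re ≤ 4 → θ ≤ |s.im| →
    ‖DirichletCharacter.LFunctionTrivChar q s‖ ≤ K / θ * cond q s ^ (3 * ε) := by
  obtain ⟨K, hK, hb⟩ := norm_zeta_le hε hε'
  have h2 : 0 < 2 / ε := by positivity
  refine ⟨(2 / ε + 1) * K, by nlinarith, fun θ hθ hθ1 q _ s h1 h4 ht => ?_⟩
  have hs : s ≠ 1 := fun h => by simp [h] at ht; linarith
  rw [DirichletCharacter.LFunctionTrivChar_eq_mul_riemannZeta hs, norm_mul]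
  have hc := cond_pos q s
  have h3 := (norm_eulerFactors_le q h1).trans (card_primeFactors_le_rpow hε (NeZero.ne q))
  have h5 := hb θ hθ hθ1 s (by linarith) h4 ht
  calc _ ≤ (2 / ε + 1) * (q : ℝ) ^ ε * (K / θ * cond 1 s ^ (2 * ε)) := by gcongr
    _ ≤ (2 / ε + 1) * cond q s ^ ε * (K / θ * cond q s ^ (2 * ε)) := by
      have := cond_pos 1 s
      gcongr
      · exact le_cond q s
      · exact cond_one_le q s
    _ = (2 / ε + 1) * K / θ * (cond q s ^ ε * cond q s ^ (2 * ε)) := by ring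
    _ = _ := by rw [← Real.rpow_add hc]; congr 2; ring

end BDH

namespace BDH

open Set Filter Topology MeasureTheory Complex

lemma norm_LFunction_ge_of_deriv_le {ε D : ℝ} (hε : 0 < ε) (hε' : ε ≤ 1 / 3) (hD : 1 ≤ D) :
    ∃ κ : ℝ, 0 < κ ∧ ∀ θ : ℝ, 0 < θ → θ ≤ 1 → ∀ (q : ℕ) [NeZero q] (χ : DirichletCharacter ℂ q)
      (t : ℝ), (∀ σ : ℝ, 1 < σ → σ ≤ 2 →
        ‖deriv χ.LFunction (σ + t * I)‖ ≤ D * cond q (σ + t * I) ^ (2 * ε)) →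
      (χ ^ 2 ≠ 1 ∨ θ ≤ |t|) → ∀ σ : ℝ, 1 < σ → σ ≤ 2 →
      κ * θ ^ 4 * cond q (σ + t * I) ^ (-(12 * ε)) ≤ ‖χ.LFunction (σ + t * I)‖ := by
  obtain ⟨B, hB, hBs⟩ := norm_LSeries_le_div
  obtain ⟨K₁, hK₁, hb₁⟩ := norm_LFunction_le hε hε'
  obtain ⟨K₂, hK₂, hb₂⟩ := norm_LFunctionTrivChar_le hε hε'
  set K := D + 2 * K₁ + 2 * K₂ with hKdef
  have hK : 1 ≤ K := by linarith
  refine ⟨1 / (16 * B ^ 3 * K ^ 4), by positivity, fun θ hθ hθ1 q _ χ t hd hχ σ hσ hσ2 => ?_⟩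
  have hcond : ∀ σ : ℝ, cond q (σ + t * I) = q * (|t| + 2) := fun σ => by simp [cond]
  have hX2 := two_le_cond q (σ + t * I)
  simp only [hcond] at hd hX2 ⊢
  set X : ℝ := q * (|t| + 2) with hX
  have hX0 : 0 < X := by linarith
  have hX3 : 1 ≤ X ^ (3 * ε) := Real.one_le_rpow (by linarith) (by positivity)
  have hX23 : X ^ (2 * ε) ≤ X ^ (3 * ε) :=
    Real.rpow_le_rpow_of_exponent_le (by linarith) (by linarith)
  have hθi : 1 ≤ 1 / θ := (one_le_div hθ).2 hθ1
  have hcond2 : ∀ σ : ℝ, cond q (σ + 2 * t * I) ≤ 2 * X := fun σ => by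
    have : cond q (σ + 2 * t * I) = q * (2 * |t| + 2) := by simp [cond, abs_mul]
    rw [this, hX]
    have : (0 : ℝ) ≤ q := by positivity
    nlinarith
  have h2rpow : ∀ a : ℝ, 0 ≤ a → a ≤ 1 → ∀ σ : ℝ, cond q (σ + 2 * t * I) ^ a ≤ 2 * X ^ a := by
    intro a ha ha1 σ
    calc cond q (σ + 2 * t * I) ^ a ≤ (2 * X) ^ a := by
          have := cond_pos q (σ + 2 * t * I)
          gcongr
          exact hcond2 σ
      _ = 2 ^ a * X ^ a := Real.mul_rpow (by norm_num) hX0.le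
      _ ≤ 2 ^ (1 : ℝ) * X ^ a := by gcongr; norm_num
      _ = _ := by rw [Real.rpow_one]
  have main := three_four_one (A := K / θ * X ^ (3 * ε)) hB ?_ hBs χ t ?_ ?_ hσ hσ2
  · refine le_trans (le_of_eq ?_) main
    rw [Real.rpow_neg hX0.le, mul_pow, ← Real.rpow_natCast (X ^ (3 * ε)), ← Real.rpow_mul hX0.le]
    rw [show 3 * ε * ((4 : ℕ) : ℝ) = 12 * ε by push_cast; ring]
    field_simp
  · rw [div_mul_eq_mul_div, le_div_iff₀ hθ]; nlinarith
  · intro σ hσ hσ2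
    refine (hd σ hσ hσ2).trans ?_
    calc D * X ^ (2 * ε) ≤ K * 1 * X ^ (3 * ε) := by gcongr; linarith
      _ ≤ K * (1 / θ) * X ^ (3 * ε) := by gcongr
      _ = _ := by ring
  · intro σ hσ hσ2
    by_cases h : χ ^ 2 = 1
    · have ht := hχ.resolve_left (not_not.2 h)
      rw [h]
      have := hb₂ θ hθ hθ1 q (σ + 2 * t * I) (by simpa using hσ.le) (by simp; linarith)
        (by simp [abs_mul]; linarith)
      refine this.trans ?_
      calc K₂ / θ * cond q (σ + 2 * t * I) ^ (3 * ε) ≤ K₂ / θ * (2 * X ^ (3 * ε)) := by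
            gcongr; exact h2rpow _ (by positivity) (by linarith) σ
        _ = (2 * K₂) / θ * X ^ (3 * ε) := by ring
        _ ≤ _ := by gcongr; linarith
    · have := hb₁ q (χ ^ 2) h (σ + 2 * t * I) (by simp; linarith) (by simp; linarith)
      refine this.trans ?_
      calc K₁ * cond q (σ + 2 * t * I) ^ (2 * ε) ≤ K₁ * (2 * X ^ (2 * ε)) := by
            gcongr; exact h2rpow _ (by positivity) (by linarith) σ
        _ ≤ K₁ * (2 * X ^ (3 * ε)) := by gcongr
        _ = (2 * K₁) * 1 * X ^ (3 * ε) := by ring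
        _ ≤ K * (1 / θ) * X ^ (3 * ε) := by gcongr; linarith
        _ = _ := by ring

end BDH

namespace BDH

open Set Filter Topology MeasureTheory Complex
open scoped ComplexOrder

lemma norm_LFunction_ge_sub_one : ∃ B : ℝ, 1 ≤ B ∧ ∀ (q : ℕ) [NeZero q]
    (χ : DirichletCharacter ℂ q) (s : ℂ), 1 < s.re → s.re ≤ 2 →
    (s.re - 1) / B ≤ ‖χ.LFunction s‖ := by
  obtain ⟨B, hB, hb⟩ := norm_LSeries_le_div
  refine ⟨B, hB, fun q _ χ s hs hs2 => ?_⟩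
  rw [χ.LFunction_eq_LSeries hs]
  have h := DirichletCharacter.LSeries.mul_mu_eq_one χ hs
  have h1 := congrArg norm h
  rw [norm_mul, norm_one] at h1
  have hμ : ∀ n : ℕ, ‖((fun n : ℕ => χ n) * fun n : ℕ => ((ArithmeticFunction.moebius n : ℤ) : ℂ)) n‖ ≤ 1 := by
    intro n
    rw [Pi.mul_apply, norm_mul]
    have h2 : ‖((ArithmeticFunction.moebius n : ℤ) : ℂ)‖ ≤ 1 := by
      rw [Complex.norm_intCast]
      exact_mod_cast ArithmeticFunction.abs_moebius_le_one
    exact mul_le_one₀ (χ.norm_le_one _) (norm_nonneg _) h2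
  have h3 := hb _ hμ s hs hs2
  have h4 : 0 < s.re - 1 := by linarith
  rw [div_le_iff₀ (by linarith)]
  set m := ‖LSeries ((fun n : ℕ => χ n) * fun n : ℕ => ((ArithmeticFunction.moebius n : ℤ) : ℂ)) s‖
  have h5 : 1 ≤ ‖LSeries (fun n : ℕ => χ n) s‖ * (B / (s.re - 1)) := by
    calc 1 = _ := h1.symm
      _ ≤ _ := by gcongr
  rw [← mul_div_assoc, le_div_iff₀ h4] at h5
  linarith

lemma apply_of_sq_eq_one {q : ℕ} {χ : DirichletCharacter ℂ q} (h : χ ^ 2 = 1) (a : ZMod q) :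
    χ a = 0 ∨ χ a = 1 ∨ χ a = -1 := by
  by_cases ha : IsUnit a
  · right
    rw [← sq_eq_one_iff, ← MulChar.pow_apply' χ two_ne_zero, h, MulChar.one_apply ha]
  · left; exact χ.map_nonunit ha

lemma apply_eq_ofReal_of_sq_eq_one {q : ℕ} {χ : DirichletCharacter ℂ q} (h : χ ^ 2 = 1)
    (a : ZMod q) : ∃ r : ℝ, χ a = r ∧ -1 ≤ r ∧ r ≤ 1 := by
  rcases apply_of_sq_eq_one h a with h | h | h
  · exact ⟨0, by simp [h], by norm_num, by norm_num⟩
  · exact ⟨1, by simp [h], by norm_num, by norm_num⟩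
  · exact ⟨-1, by simp [h], by norm_num, by norm_num⟩

lemma LSeries_pos_of_sq_eq_one {q : ℕ} {χ : DirichletCharacter ℂ q} (h : χ ^ 2 = 1)
    {σ : ℝ} (hσ : 1 < σ) : 0 < LSeries (fun n : ℕ => χ n) σ := by
  rw [← DirichletCharacter.LSeries_eulerProduct_exp_log χ (by simpa using hσ)]
  have : ∀ p : Nat.Primes, ∃ r : ℝ, -log (1 - χ p * (p : ℂ) ^ (-(σ : ℂ))) = r := by
    intro p
    obtain ⟨r, hr, h1, h2⟩ := apply_eq_ofReal_of_sq_eq_one h (p : ZMod q)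
    have hp : (p : ℝ) ^ (-σ) ≤ 1 := Real.rpow_le_one_of_one_le_of_nonpos
      (by exact_mod_cast p.2.one_lt.le) (by linarith)
    have hp0 : 0 ≤ (p : ℝ) ^ (-σ) := by positivity
    refine ⟨-Real.log (1 - r * (p : ℝ) ^ (-σ)), ?_⟩
    rw [ofReal_neg, ofReal_log (by nlinarith), hr]
    push_cast
    rw [ofReal_cpow (by positivity)]
    simp
  choose r hr using this
  simp_rw [hr]
  rw [← ofReal_tsum, ← ofReal_exp]
  exact_mod_cast Real.exp_pos _

lemma LFunction_pos_of_sq_eq_one {q : ℕ} [NeZero q] {χ : DirichletCharacter ℂ q} (h : χ ^ 2 = 1)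
    {σ : ℝ} (hσ : 1 < σ) : 0 < χ.LFunction σ := by
  rw [χ.LFunction_eq_LSeries (by simpa using hσ)]
  exact LSeries_pos_of_sq_eq_one h hσ

/-- The product `ζ(s) L(s, χ₁) L(s, χ₂) L(s, χ₁χ₂)`. -/
noncomputable def quadProd {q : ℕ} [NeZero q] (χ₁ χ₂ : DirichletCharacter ℂ q) (s : ℂ) : ℂ :=
  riemannZeta s * (χ₁.LFunction s * χ₂.LFunction s * (χ₁ * χ₂).LFunction s)

/-- Coefficients of the logarithmic derivative of `quadProd`. -/
noncomputable def quadCoeff {q : ℕ} (χ₁ χ₂ : DirichletCharacter ℂ q) (n : ℕ) : ℂ :=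
  (1 + χ₁ n) * (1 + χ₂ n) * (ArithmeticFunction.vonMangoldt n : ℂ)

lemma quadCoeff_nonneg {q : ℕ} {χ₁ χ₂ : DirichletCharacter ℂ q} (h₁ : χ₁ ^ 2 = 1)
    (h₂ : χ₂ ^ 2 = 1) : 0 ≤ quadCoeff χ₁ χ₂ := by
  intro n
  obtain ⟨r₁, hr₁, h1, -⟩ := apply_eq_ofReal_of_sq_eq_one h₁ (n : ZMod q)
  obtain ⟨r₂, hr₂, h2, -⟩ := apply_eq_ofReal_of_sq_eq_one h₂ (n : ZMod q)
  simp only [quadCoeff, hr₁, hr₂, Pi.zero_apply]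
  have : 0 ≤ (1 + r₁) * (1 + r₂) * ArithmeticFunction.vonMangoldt n :=
    mul_nonneg (mul_nonneg (by linarith) (by linarith)) ArithmeticFunction.vonMangoldt_nonneg
  exact_mod_cast this

lemma hasDerivAt_LFunction {q : ℕ} [NeZero q] (χ : DirichletCharacter ℂ q) {s : ℂ}
    (hs : 1 < s.re) : HasDerivAt χ.LFunction
      (-(LSeries (fun n : ℕ => χ n * (ArithmeticFunction.vonMangoldt n : ℂ)) s * χ.LFunction s)) s := by
  have hs1 : s ≠ 1 := fun h => by simp [h] at hs
  have h := (χ.differentiableAt_LFunction s (Or.inl hs1)).hasDerivAt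
  refine h.congr_deriv ?_
  have h2 := DirichletCharacter.LSeries_twist_vonMangoldt_eq χ hs
  have h3 : LSeries (fun n : ℕ => χ n) s ≠ 0 := DirichletCharacter.LSeries_ne_zero_of_one_lt_re χ hs
  rw [← χ.deriv_LFunction_eq_deriv_LSeries hs] at h2
  change LSeries (fun n : ℕ => χ n * (ArithmeticFunction.vonMangoldt n : ℂ)) s = _ at h2
  rw [h2, χ.LFunction_eq_LSeries hs]
  field_simp

lemma LSeriesSummable_quadCoeff {q : ℕ} (χ₁ χ₂ : DirichletCharacter ℂ q) {s : ℂ}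
    (hs : 1 < s.re) : LSeriesSummable (quadCoeff χ₁ χ₂) s := by
  have s0 := DirichletCharacter.LSeriesSummable_twist_vonMangoldt (1 : DirichletCharacter ℂ 1) hs
  have s1 := DirichletCharacter.LSeriesSummable_twist_vonMangoldt χ₁ hs
  have s2 := DirichletCharacter.LSeriesSummable_twist_vonMangoldt χ₂ hs
  have s3 := DirichletCharacter.LSeriesSummable_twist_vonMangoldt (χ₁ * χ₂) hs
  refine (LSeriesSummable_congr s fun {n} _ => ?_).1 (s0.add ((s1.add s2).add s3))
  simp only [quadCoeff, Pi.add_apply, Pi.mul_apply, MulChar.mul_apply]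
  rw [MulChar.one_apply (isUnit_of_subsingleton _)]
  ring

lemma abscissaOfAbsConv_quadCoeff {q : ℕ} (χ₁ χ₂ : DirichletCharacter ℂ q) :
    LSeries.abscissaOfAbsConv (quadCoeff χ₁ χ₂) ≤ 1 :=
  LSeries.abscissaOfAbsConv_le_of_forall_lt_LSeriesSummable' fun y hy =>
    LSeriesSummable_quadCoeff χ₁ χ₂ (by rw [ofReal_re]; exact_mod_cast hy)

lemma hasDerivAt_quadProd {q : ℕ} [NeZero q] (χ₁ χ₂ : DirichletCharacter ℂ q) {s : ℂ}
    (hs : 1 < s.re) : HasDerivAt (quadProd χ₁ χ₂)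
      (-(LSeries (quadCoeff χ₁ χ₂) s * quadProd χ₁ χ₂ s)) s := by
  have h0 := hasDerivAt_LFunction (1 : DirichletCharacter ℂ 1) hs
  rw [DirichletCharacter.LFunction_modOne_eq] at h0
  have h1 := hasDerivAt_LFunction χ₁ hs
  have h2 := hasDerivAt_LFunction χ₂ hs
  have h3 := hasDerivAt_LFunction (χ₁ * χ₂) hs
  have H := h0.mul ((h1.mul h2).mul h3)
  have e : LSeries (quadCoeff χ₁ χ₂) s =
      LSeries (fun n : ℕ => (1 : DirichletCharacter ℂ 1) n * (ArithmeticFunction.vonMangoldt n : ℂ)) s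
      + (LSeries (fun n : ℕ => χ₁ n * (ArithmeticFunction.vonMangoldt n : ℂ)) s
      + LSeries (fun n : ℕ => χ₂ n * (ArithmeticFunction.vonMangoldt n : ℂ)) s
      + LSeries (fun n : ℕ => (χ₁ * χ₂) n * (ArithmeticFunction.vonMangoldt n : ℂ)) s) := by
    have s0 := DirichletCharacter.LSeriesSummable_twist_vonMangoldt (1 : DirichletCharacter ℂ 1) hs
    have s1 := DirichletCharacter.LSeriesSummable_twist_vonMangoldt χ₁ hs
    have s2 := DirichletCharacter.LSeriesSummable_twist_vonMangoldt χ₂ hs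
    have s3 := DirichletCharacter.LSeriesSummable_twist_vonMangoldt (χ₁ * χ₂) hs
    have e1 := LSeries_add s1 s2
    have e2 := LSeries_add (s1.add s2) s3
    have e3 := LSeries_add s0 ((s1.add s2).add s3)
    rw [e2, e1] at e3
    refine Eq.trans ?_ e3
    congr 1
    ext n
    simp only [quadCoeff, Pi.add_apply, Pi.mul_apply, MulChar.mul_apply]
    rw [MulChar.one_apply (isUnit_of_subsingleton _)]
    ring
  have hfun : quadProd χ₁ χ₂ = riemannZeta * (χ₁.LFunction * χ₂.LFunction * (χ₁ * χ₂).LFunction) := by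
    ext; rfl
  rw [hfun]
  refine H.congr_deriv ?_
  rw [e]
  simp only [Pi.mul_apply]
  ring

lemma quadProd_alternating {q : ℕ} [NeZero q] {χ₁ χ₂ : DirichletCharacter ℂ q} (h₁ : χ₁ ^ 2 = 1)
    (h₂ : χ₂ ^ 2 = 1) (m : ℕ) : 0 ≤ (-1) ^ m * iteratedDeriv m (quadProd χ₁ χ₂) 2 := by
  have hopen : IsOpen {s : ℂ | 1 < s.re} := continuous_re.isOpen_preimage _ isOpen_Ioi
  have hmem : (2 : ℂ) ∈ {s : ℂ | 1 < s.re} := by simp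
  have hab : LSeries.abscissaOfAbsConv (quadCoeff χ₁ χ₂) < ((2 : ℝ) : EReal) :=
    (abscissaOfAbsConv_quadCoeff χ₁ χ₂).trans_lt (by exact_mod_cast one_lt_two)
  have hF : AnalyticAt ℂ (quadProd χ₁ χ₂) 2 :=
    (DifferentiableOn.analyticOnNhd (fun s hs =>
      (hasDerivAt_quadProd χ₁ χ₂ hs).differentiableAt.differentiableWithinAt) hopen) 2 hmem
  have hH : AnalyticAt ℂ (LSeries (quadCoeff χ₁ χ₂)) 2 := by
    refine LSeries_analyticOnNhd _ _ ?_
    simpa using hab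
  have hder : deriv (quadProd χ₁ χ₂) =ᶠ[𝓝 2] -(LSeries (quadCoeff χ₁ χ₂) * quadProd χ₁ χ₂) := by
    filter_upwards [hopen.mem_nhds hmem] with s hs
    exact (hasDerivAt_quadProd χ₁ χ₂ hs).deriv
  induction m using Nat.strong_induction_on with
  | _ m ih =>
    rcases m with _ | m
    · simp only [pow_zero, iteratedDeriv_zero, one_mul, quadProd]
      have p0 := LFunction_pos_of_sq_eq_one (χ := (1 : DirichletCharacter ℂ 1)) (one_pow 2)
        (σ := 2) (by norm_num)
      rw [DirichletCharacter.LFunction_modOne_eq] at p0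
      have p1 := LFunction_pos_of_sq_eq_one h₁ (σ := 2) (by norm_num)
      have p2 := LFunction_pos_of_sq_eq_one h₂ (σ := 2) (by norm_num)
      have p3 := LFunction_pos_of_sq_eq_one (χ := χ₁ * χ₂) (by rw [mul_pow, h₁, h₂, one_mul])
        (σ := 2) (by norm_num)
      push_cast at p0 p1 p2 p3
      exact (mul_pos p0 (mul_pos (mul_pos p1 p2) p3)).le
    · rw [iteratedDeriv_succ', hder.iteratedDeriv_eq, iteratedDeriv_neg,
        iteratedDeriv_mul hH.contDiffAt hF.contDiffAt, pow_succ]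
      have : (-1 : ℂ) ^ m * -1 * -∑ i ∈ Finset.range (m + 1), (m.choose i : ℂ) *
          iteratedDeriv i (LSeries (quadCoeff χ₁ χ₂)) 2 *
          iteratedDeriv (m - i) (quadProd χ₁ χ₂) 2 =
          ∑ i ∈ Finset.range (m + 1), (m.choose i : ℂ) *
          ((-1) ^ i * iteratedDeriv i (LSeries (quadCoeff χ₁ χ₂)) 2) *
          ((-1) ^ (m - i) * iteratedDeriv (m - i) (quadProd χ₁ χ₂) 2) := by
        rw [mul_neg_one, neg_mul_neg, Finset.mul_sum]
        refine Finset.sum_congr rfl fun i hi => ?_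
        have : m = i + (m - i) := by have := Finset.mem_range.1 hi; omega
        rw [show (-1 : ℂ) ^ m = (-1) ^ i * (-1) ^ (m - i) by rw [← pow_add, ← this]]
        ring
      rw [this]
      refine Finset.sum_nonneg fun i hi => ?_
      have a1 := LSeries.iteratedDeriv_alternating (quadCoeff_nonneg h₁ h₂) hab i
      push_cast at a1
      have a2 := ih (m - i) (by omega)
      exact mul_nonneg (mul_nonneg (by positivity) a1) a2

end BDH

namespace BDH

open Set Filter Topology MeasureTheory Complex

lemma iteratedDeriv_div_sub_one (c : ℂ) (m : ℕ) :
    iteratedDeriv m (fun s : ℂ => c / (s - 1)) 2 = c * ((-1) ^ m * m.factorial) := by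
  have h : (fun s : ℂ => c / (s - 1)) = fun s => c * (fun z : ℂ => z⁻¹) (s - 1) := by
    ext s; rw [div_eq_mul_inv]
  rw [h, iteratedDeriv_const_mul_field, iteratedDeriv_comp_sub_const m (fun z : ℂ => z⁻¹) 1]
  simp only [iteratedDeriv_eq_iterate, iter_deriv_inv']
  norm_num

/-- Estermann's inequality. -/
lemma estermann {Φ F : ℂ → ℂ} {l : ℂ} {M β : ℝ} (hΦ : Differentiable ℂ Φ)
    (hM : ∀ z ∈ Metric.sphere (2 : ℂ) (4 / 3), ‖Φ z‖ ≤ M)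
    (hF : ∀ s, s ≠ 1 → F s = Φ s + l / (s - 1))
    (halt : ∀ m : ℕ, 0 ≤ ((-1) ^ m * iteratedDeriv m F 2).re)
    (hβ : 7 / 8 < β) (hβ1 : β < 1) (hFβ : (F β).re ≤ 0) {k : ℕ} (hk0 : 1 ≤ k)
    (hk : M * (27 / 32) ^ k * (32 / 5) ≤ (F 2).re / 2) :
    (F 2).re / 2 ≤ l.re * (2 - β) ^ k / (1 - β) := by
  set y : ℝ := 2 - β with hy
  have hy1 : 1 < y := by linarith
  have hM0 : 0 ≤ M := (norm_nonneg _).trans (hM (2 + (4 / 3 : ℝ)) (by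
    simp))
  set c : ℕ → ℂ := fun m => (-1) ^ m * ((m.factorial : ℂ)⁻¹ * iteratedDeriv m Φ 2) with hc
  have hcb : ∀ m, ‖c m‖ ≤ M * (3 / 4) ^ m := by
    intro m
    have := norm_iteratedDeriv_le_of_forall_mem_sphere_norm_le m (by norm_num : (0 : ℝ) < 4 / 3)
      hΦ.diffContOnCl hM
    simp only [hc, norm_mul, norm_pow, norm_neg, norm_one, one_pow, one_mul, norm_inv,
      Complex.norm_natCast]
    have hf : (0 : ℝ) < m.factorial := by exact_mod_cast m.factorial_pos
    rw [inv_mul_le_iff₀ hf]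
    refine this.trans (le_of_eq ?_)
    rw [show (3 / 4 : ℝ) = (4 / 3)⁻¹ by norm_num, inv_pow]
    field_simp
  have hder : ∀ m, iteratedDeriv m F 2 = iteratedDeriv m Φ 2 + l * ((-1) ^ m * m.factorial) := by
    intro m
    have he : F =ᶠ[𝓝 2] (Φ + fun s : ℂ => l / (s - 1)) := by
      filter_upwards [isOpen_ne.mem_nhds (show (2 : ℂ) ≠ 1 by norm_num)] with s hs using hF s hs
    rw [he.iteratedDeriv_eq, iteratedDeriv_add, iteratedDeriv_div_sub_one]
    · exact (hΦ.analyticAt 2).contDiffAt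
    · have : AnalyticAt ℂ (fun s : ℂ => l / (s - 1)) 2 :=
        analyticAt_const.div (analyticAt_id.sub analyticAt_const) (by norm_num)
      exact this.contDiffAt
  have hcl : ∀ m, c m + l = (m.factorial : ℂ)⁻¹ * ((-1) ^ m * iteratedDeriv m F 2) := by
    intro m
    have hf : (m.factorial : ℂ) ≠ 0 := by exact_mod_cast m.factorial_ne_zero
    have h1 : ((-1 : ℂ) ^ m) * (-1) ^ m = 1 := by rw [← mul_pow]; simp
    rw [hder, hc]
    calc _ = (-1) ^ m * ((m.factorial : ℂ)⁻¹ * iteratedDeriv m Φ 2)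
          + l * (((-1) ^ m * (-1) ^ m) * ((m.factorial : ℂ)⁻¹ * m.factorial)) := by
            rw [h1, inv_mul_cancel₀ hf]; ring
      _ = _ := by ring
  have hcl0 : ∀ m, 0 ≤ (c m).re + l.re := by
    intro m
    rw [← add_re, hcl, show ((m.factorial : ℂ)⁻¹) = (((m.factorial : ℝ)⁻¹ : ℝ) : ℂ) by push_cast; rfl,
      re_ofReal_mul]
    exact mul_nonneg (by positivity) (halt m)
  have hc0 : (c 0).re + l.re = (F 2).re := by
    rw [← add_re, hcl]; simp
  have hsum : HasSum (fun m => (c m).re * y ^ m) (Φ β).re := by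
    have := hasSum_taylorSeries_on_ball (f := Φ) (c := 2) (r := 4 / 3) (z := β)
      hΦ.differentiableOn (by
        rw [Metric.mem_ball, dist_eq_norm, show (β : ℂ) - 2 = ((β - 2 : ℝ) : ℂ) by push_cast; ring,
          norm_real, Real.norm_eq_abs, abs_lt]
        constructor <;> linarith)
    have h2 := hasSum_re this
    have e : (fun m => (c m).re * y ^ m) = fun m : ℕ => ((m.factorial : ℂ)⁻¹ • ((β : ℂ) - 2) ^ m •
        iteratedDeriv m Φ 2).re := by
      ext m
      rw [← re_mul_ofReal, hc]
      congr 1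
      simp only [smul_eq_mul]
      rw [show (β : ℂ) - 2 = -1 * (y : ℂ) by rw [hy]; push_cast; ring, mul_pow]
      push_cast
      ring
    rwa [e]
  have hb : ∀ m, |(c m).re * y ^ m| ≤ M * (27 / 32) ^ m := by
    intro m
    rw [abs_mul, abs_of_pos (by positivity : 0 < y ^ m)]
    calc |(c m).re| * y ^ m ≤ (M * (3 / 4) ^ m) * (9 / 8) ^ m := by
          gcongr
          · exact (abs_re_le_norm _).trans (hcb m)
          · linarith
      _ = _ := by rw [mul_assoc, ← mul_pow]; norm_num
  have htail : -(M * (27 / 32) ^ k * (32 / 5)) ≤ ∑' m, (c (m + k)).re * y ^ (m + k) := by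
    have hg : HasSum (fun m : ℕ => M * (27 / 32 : ℝ) ^ k * (27 / 32) ^ m)
        (M * (27 / 32) ^ k * (32 / 5)) := by
      have := (hasSum_geometric_of_lt_one (r := (27 / 32 : ℝ)) (by norm_num) (by norm_num)).mul_left
        (M * (27 / 32 : ℝ) ^ k)
      rwa [show (1 - 27 / 32 : ℝ)⁻¹ = 32 / 5 by norm_num] at this
    have := tsum_of_norm_bounded hg (f := fun m => (c (m + k)).re * y ^ (m + k)) fun m => by
      refine (hb (m + k)).trans (le_of_eq ?_)
      rw [pow_add]; ring
    exact (abs_le.1 this).1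
  have hhead : (F 2).re - l.re * ∑ m ∈ Finset.range k, y ^ m ≤
      ∑ m ∈ Finset.range k, (c m).re * y ^ m := by
    have h1 : (F 2).re ≤ ∑ m ∈ Finset.range k, ((c m).re + l.re) * y ^ m := by
      have := Finset.single_le_sum (s := Finset.range k) (f := fun m => ((c m).re + l.re) * y ^ m)
        (fun m _ => mul_nonneg (hcl0 m) (by positivity)) (Finset.mem_range.2 hk0)
      simpa [hc0] using this
    simp only [add_mul, Finset.sum_add_distrib, ← Finset.mul_sum] at h1
    linarith
  have hsplit := hsum.summable.sum_add_tsum_nat_add k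
  rw [hsum.tsum_eq] at hsplit
  rw [geom_sum_eq hy1.ne'] at hhead
  have hFβ' : (F β).re = (Φ β).re - l.re / (1 - β) := by
    rw [hF β (by exact_mod_cast hβ1.ne), add_re,
      show l / ((β : ℂ) - 1) = -(l / ((1 - β : ℝ) : ℂ)) by
        rw [← div_neg]; push_cast; ring_nf, neg_re, div_ofReal_re]
    ring
  have h1β : 0 < 1 - β := by linarith
  have e1 : l.re * ((y ^ k - 1) / (y - 1)) = l.re * y ^ k / (1 - β) - l.re / (1 - β) := by
    rw [show y - 1 = 1 - β by rw [hy]; ring]; ring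
  rw [e1] at hhead
  linarith

end BDH

namespace BDH

open Set Filter Topology MeasureTheory Complex
open scoped ComplexOrder

lemma norm_apply_mul_cpow_le {q p : ℕ} (hp : 2 ≤ p) (χ : DirichletCharacter ℂ q) {s : ℂ}
    (hs : 1 ≤ s.re) : ‖χ p * (p : ℂ) ^ (-s)‖ ≤ (p : ℝ)⁻¹ := by
  have hp2 : (2 : ℝ) ≤ p := by exact_mod_cast hp
  have h1 : ‖(p : ℂ) ^ (-s)‖ ≤ (p : ℝ)⁻¹ := by
    rw [Complex.norm_natCast_cpow_of_pos (by exact_mod_cast (by linarith : (0 : ℝ) < p)),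
      ← Real.rpow_neg_one]
    exact Real.rpow_le_rpow_of_exponent_le (by linarith) (by simpa using hs)
  rw [norm_mul]
  calc _ ≤ 1 * (p : ℝ)⁻¹ := by gcongr; exact χ.norm_le_one _
    _ = _ := one_mul _

lemma norm_eulerFactors_char_le {q : ℕ} (N : ℕ) (χ : DirichletCharacter ℂ q) {s : ℂ}
    (hs : 1 ≤ s.re) :
    ‖∏ p ∈ N.primeFactors, (1 - χ p * (p : ℂ) ^ (-s))‖ ≤ N.primeFactors.card + 1 := by
  refine le_trans ?_ (prod_primeFactors_le N)
  rw [norm_prod]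
  refine Finset.prod_le_prod (fun _ _ => norm_nonneg _) fun p hp => ?_
  have hp2' := (Nat.prime_of_mem_primeFactors hp).two_le
  have hp2 : (2 : ℝ) ≤ p := by exact_mod_cast hp2'
  have h1 := norm_apply_mul_cpow_le hp2' χ hs
  calc ‖1 - χ p * (p : ℂ) ^ (-s)‖ ≤ 1 + (p : ℝ)⁻¹ := (norm_sub_le _ _).trans (by simpa using h1)
    _ ≤ p / (p - 1) := by
      rw [le_div_iff₀ (by linarith)]
      have : (p : ℝ)⁻¹ * p = 1 := inv_mul_cancel₀ (by linarith)
      have : 0 < (p : ℝ)⁻¹ := by positivity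
      nlinarith

lemma norm_eulerFactors_char_ge {q : ℕ} (N : ℕ) (χ : DirichletCharacter ℂ q) {s : ℂ}
    (hs : 1 ≤ s.re) :
    1 / ((N.primeFactors.card : ℝ) + 1) ≤ ‖∏ p ∈ N.primeFactors, (1 - χ p * (p : ℂ) ^ (-s))‖ := by
  have h : (∏ p ∈ N.primeFactors, ((p : ℝ) / (p - 1)))⁻¹ ≤
      ‖∏ p ∈ N.primeFactors, (1 - χ p * (p : ℂ) ^ (-s))‖ := by
    rw [norm_prod, ← Finset.prod_inv_distrib]
    have hp2 : ∀ p ∈ N.primeFactors, (2 : ℝ) ≤ p := fun p hp => by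
      exact_mod_cast (Nat.prime_of_mem_primeFactors hp).two_le
    refine Finset.prod_le_prod (fun p hp => ?_) fun p hp => ?_
    · have := hp2 p hp
      exact inv_nonneg.2 (div_nonneg (by linarith) (by linarith))
    · have h2 := hp2 p hp
      have h1 := norm_apply_mul_cpow_le (Nat.prime_of_mem_primeFactors hp).two_le χ hs
      have h3 := norm_sub_norm_le (1 : ℂ) (χ p * (p : ℂ) ^ (-s))
      rw [norm_one] at h3
      have : ((p : ℝ) / (p - 1))⁻¹ = 1 - (p : ℝ)⁻¹ := by field_simp
      linarith
  refine le_trans ?_ h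
  rw [← one_div]
  refine one_div_le_one_div_of_le (Finset.prod_pos fun p hp => ?_) (prod_primeFactors_le N)
  have : (2 : ℝ) ≤ p := by exact_mod_cast (Nat.prime_of_mem_primeFactors hp).two_le
  exact div_pos (by linarith) (by linarith)

lemma quadProd_two_ge : ∃ b : ℝ, 0 < b ∧ ∀ (q : ℕ) [NeZero q] (χ₁ χ₂ : DirichletCharacter ℂ q),
    χ₁ ^ 2 = 1 → χ₂ ^ 2 = 1 → b ≤ (quadProd χ₁ χ₂ 2).re := by
  obtain ⟨B, hB, hb⟩ := norm_LFunction_ge_sub_one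
  refine ⟨1 / B * (1 / B * (1 / B) * (1 / B)), by positivity, fun q _ χ₁ χ₂ h₁ h₂ => ?_⟩
  have h0 := quadProd_alternating h₁ h₂ 0
  simp only [pow_zero, iteratedDeriv_zero, one_mul] at h0
  have h3 : (quadProd χ₁ χ₂ 2).re = ‖quadProd χ₁ χ₂ 2‖ := by
    have := Complex.norm_of_nonneg' h0
    have h4 := congrArg re this
    simpa using h4.symm
  have key : ∀ (n : ℕ) [NeZero n] (χ : DirichletCharacter ℂ n), 1 / B ≤ ‖χ.LFunction 2‖ := by
    intro n _ χ
    have := hb n χ 2 (by simp) (by simp)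
    norm_num at this ⊢
    exact this
  have hz := key 1 1
  rw [DirichletCharacter.LFunction_modOne_eq] at hz
  rw [h3, quadProd, norm_mul, norm_mul, norm_mul]
  gcongr
  · exact key q χ₁
  · exact key q χ₂
  · exact key q _

lemma norm_quadProd_dslope_le : ∃ K : ℝ, 1 ≤ K ∧ ∀ (q : ℕ) [NeZero q]
    (χ₁ χ₂ : DirichletCharacter ℂ q), χ₁ ≠ 1 → χ₂ ≠ 1 → χ₁ * χ₂ ≠ 1 →
    ∀ z ∈ Metric.sphere (2 : ℂ) (4 / 3),
    ‖dslope (fun s => Z s * (χ₁.LFunction s * χ₂.LFunction s * (χ₁ * χ₂).LFunction s)) 1 z‖ ≤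
      K * (q : ℝ) ^ 2 := by
  obtain ⟨K, hK, hb⟩ := norm_LFunction_le (ε := 1 / 3) (by norm_num) le_rfl
  obtain ⟨K', hK', hZ⟩ := norm_Z_le (ε := 1 / 3) (by norm_num) le_rfl
  refine ⟨3 * (64 * K' * (16 * K ^ 3) + 16 * K ^ 3), ?_, fun q _ χ₁ χ₂ h₁ h₂ h₃ z hz => ?_⟩
  · have : 1 ≤ K ^ 3 := one_le_pow₀ hK
    nlinarith
  have hz' : ‖z - 2‖ = 4 / 3 := by simpa [dist_eq_norm] using hz
  have hre := re_bounds_of_norm_sub_le hz'.le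
  simp only [re_ofNat] at hre
  have him : |z.im| ≤ 2 := by
    have := abs_im_le_norm (z - 2)
    simp only [sub_im, im_ofNat, sub_zero] at this
    linarith
  have hq1 : (1 : ℝ) ≤ q := by exact_mod_cast NeZero.one_le
  have hc : cond q z ≤ 4 * q := by unfold cond; nlinarith
  have hc1 : cond 1 z ≤ 4 := by unfold cond; push_cast; linarith
  have hz1 : z ≠ 1 := fun h => by rw [h] at hz'; norm_num at hz'
  have h13 : 1 / 3 ≤ ‖z - 1‖ := by
    have := norm_sub_norm_le (z - 2) (z - 2 - (z - 1))
    have h1 : ‖z - 2 - (z - 1)‖ = 1 := by ring_nf; norm_num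
    have h2 : z - 2 - (z - 2 - (z - 1)) = z - 1 := by ring
    rw [h1, h2, hz'] at this
    linarith
  have bound : ∀ χ : DirichletCharacter ℂ q, χ ≠ 1 → ∀ s : ℂ, 1 - 1 / 3 ≤ s.re → s.re ≤ 4 →
      cond q s ≤ 4 * q → ‖χ.LFunction s‖ ≤ K * (4 * q : ℝ) ^ (2 * (1 / 3) : ℝ) := by
    intro χ hχ s h1 h2 h3
    refine (hb q χ hχ s h1 h2).trans ?_
    have := cond_pos q s
    gcongr
  set X : ℝ := (4 * q : ℝ) ^ (2 * (1 / 3) : ℝ) with hX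
  have hX3 : X ^ 3 = 16 * (q : ℝ) ^ 2 := by
    rw [hX, ← Real.rpow_natCast, ← Real.rpow_mul (by positivity)]
    norm_num
    ring
  have hP : ∀ s : ℂ, 1 - 1 / 3 ≤ s.re → s.re ≤ 4 → cond q s ≤ 4 * q →
      ‖χ₁.LFunction s * χ₂.LFunction s * (χ₁ * χ₂).LFunction s‖ ≤ 16 * K ^ 3 * (q : ℝ) ^ 2 := by
    intro s h1 h2 h3
    rw [norm_mul, norm_mul]
    calc _ ≤ (K * X) * (K * X) * (K * X) := by
          gcongr
          · exact bound _ h₁ s h1 h2 h3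
          · exact bound _ h₂ s h1 h2 h3
          · exact bound _ h₃ s h1 h2 h3
      _ = K ^ 3 * X ^ 3 := by ring
      _ = _ := by rw [hX3]; ring
  have hZz : ‖Z z‖ ≤ 64 * K' := by
    refine (hZ z (by linarith) (by linarith)).trans ?_
    have : cond 1 z ^ (1 + 2 * (1 / 3) : ℝ) ≤ 64 := by
      calc cond 1 z ^ (1 + 2 * (1 / 3) : ℝ) ≤ 4 ^ (1 + 2 * (1 / 3) : ℝ) := by
            have := cond_pos 1 z
            gcongr
        _ ≤ 4 ^ (3 : ℝ) := Real.rpow_le_rpow_of_exponent_le (by norm_num) (by norm_num)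
        _ = 64 := by norm_num
    nlinarith
  have hP1 := hP 1 (by norm_num) (by norm_num) (by unfold cond; simp; linarith)
  rw [dslope_of_ne _ hz1, slope_def_module, norm_smul, norm_inv, Z_one, one_mul,
    inv_mul_le_iff₀ (by linarith)]
  calc _ ≤ ‖Z z * (χ₁.LFunction z * χ₂.LFunction z * (χ₁ * χ₂).LFunction z)‖ + _ := norm_sub_le _ _
    _ ≤ 64 * K' * (16 * K ^ 3 * (q : ℝ) ^ 2) + 16 * K ^ 3 * (q : ℝ) ^ 2 := by
      rw [norm_mul]
      gcongr
      exact hP z (by linarith) (by linarith) hc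
    _ = 1 / 3 * (3 * (64 * K' * (16 * K ^ 3) + 16 * K ^ 3) * (q : ℝ) ^ 2) := by ring
    _ ≤ _ := by gcongr

lemma norm_prod_LFunction_one_ge : ∃ c : ℝ, 0 < c ∧ ∀ (q : ℕ) [NeZero q]
    (χ₁ χ₂ : DirichletCharacter ℂ q), χ₁ ^ 2 = 1 → χ₂ ^ 2 = 1 → χ₁ ≠ 1 → χ₂ ≠ 1 → χ₁ * χ₂ ≠ 1 →
    ∀ β : ℝ, 7 / 8 < β → β < 1 → (quadProd χ₁ χ₂ β).re ≤ 0 →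
    c * (1 - β) * (q : ℝ) ^ (-(13 * (1 - β))) ≤
      ‖χ₁.LFunction 1 * χ₂.LFunction 1 * (χ₁ * χ₂).LFunction 1‖ := by
  obtain ⟨b, hb, hb2⟩ := quadProd_two_ge
  obtain ⟨K, hK, hΦ⟩ := norm_quadProd_dslope_le
  set C₁ : ℝ := 1 + 64 / 5 * K / b with hC₁
  have hC₁1 : 1 < C₁ := by rw [hC₁]; linarith [show 0 < 64 / 5 * K / b by positivity]
  set E : ℝ := Real.exp (32 / 5 * Real.log C₁ + 1) with hE
  refine ⟨b / 2 / E, by positivity, fun q _ χ₁ χ₂ h₁ h₂ n₁ n₂ n₃ β hβ hβ1 hF => ?_⟩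
  have hq1 : (1 : ℝ) ≤ q := by exact_mod_cast NeZero.one_le
  set P : ℂ → ℂ := fun s => χ₁.LFunction s * χ₂.LFunction s * (χ₁ * χ₂).LFunction s with hP
  have hdP : Differentiable ℂ P := ((DirichletCharacter.differentiable_LFunction n₁).mul
    (DirichletCharacter.differentiable_LFunction n₂)).mul
    (DirichletCharacter.differentiable_LFunction n₃)
  have hdG : Differentiable ℂ (fun s => Z s * P s) := differentiable_Z.mul hdP
  have hdΦ : Differentiable ℂ (dslope (fun s => Z s * P s) 1) := by
    rw [← differentiableOn_univ] at hdG ⊢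
    exact (Complex.differentiableOn_dslope univ_mem).2 hdG
  set T : ℝ := C₁ * (q : ℝ) ^ 2 with hT
  have hT1 : 1 < T := by have : (1 : ℝ) ≤ (q : ℝ) ^ 2 := one_le_pow₀ hq1; nlinarith
  have hlogT : 0 < Real.log T := Real.log_pos hT1
  set k : ℕ := ⌈32 / 5 * Real.log T⌉₊ with hk
  have hkl : 32 / 5 * Real.log T ≤ k := Nat.le_ceil _
  have hku : (k : ℝ) ≤ 32 / 5 * Real.log T + 1 := (Nat.ceil_lt_add_one (by positivity)).le
  have hk1 : 1 ≤ k := Nat.one_le_iff_ne_zero.2 (Nat.ceil_pos.2 (by positivity)).ne'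
  have hpow : (27 / 32 : ℝ) ^ k ≤ T⁻¹ := by
    have h1 : (27 / 32 : ℝ) ≤ Real.exp (-(5 / 32)) := by
      have := Real.add_one_le_exp (-(5 / 32 : ℝ)); linarith
    calc (27 / 32 : ℝ) ^ k ≤ Real.exp (-(5 / 32)) ^ k := by gcongr
      _ = Real.exp (-(5 / 32 * k)) := by rw [← Real.exp_nat_mul]; ring_nf
      _ ≤ Real.exp (-Real.log T) := Real.exp_le_exp.2 (by linarith)
      _ = T⁻¹ := by rw [Real.exp_neg, Real.exp_log (by linarith)]
  have main := estermann (F := quadProd χ₁ χ₂) (l := P 1) (M := K * (q : ℝ) ^ 2) (β := β) (k := k)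
    hdΦ (hΦ q χ₁ χ₂ n₁ n₂ n₃) (fun s hs => ?_) (fun m => ?_) hβ hβ1 hF hk1 ?_
  · have h1β : 0 < 1 - β := by linarith
    have hy : (2 - β) ^ k ≤ E * (q : ℝ) ^ (13 * (1 - β)) := by
      calc (2 - β) ^ k ≤ Real.exp (1 - β) ^ k := by
            have := Real.add_one_le_exp (1 - β)
            gcongr
            · linarith
            · linarith
        _ = Real.exp (k * (1 - β)) := by rw [← Real.exp_nat_mul]
        _ ≤ Real.exp ((32 / 5 * Real.log T + 1) * (1 - β)) := by
          apply Real.exp_le_exp.2; gcongr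
        _ = Real.exp ((32 / 5 * Real.log C₁ + 1) * (1 - β) + Real.log q * (64 / 5 * (1 - β))) := by
          rw [hT, Real.log_mul (by linarith) (by positivity), Real.log_pow]
          push_cast; ring_nf
        _ ≤ Real.exp ((32 / 5 * Real.log C₁ + 1) + Real.log q * (13 * (1 - β))) := by
          have l1 := Real.log_pos hC₁1
          have l2 := Real.log_nonneg hq1
          apply Real.exp_le_exp.2
          apply add_le_add
          · nlinarith
          · gcongr
            norm_num
        _ = _ := by rw [Real.exp_add, Real.rpow_def_of_pos (by linarith)]
    have h2 := hb2 q χ₁ χ₂ h₁ h₂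
    have h3 : (P 1).re ≤ ‖P 1‖ := re_le_norm _
    have hy0 : 0 < (2 - β) ^ k := pow_pos (by linarith) k
    have hE0 : 0 < E := Real.exp_pos _
    have hqr : 0 < (q : ℝ) ^ (13 * (1 - β)) := by positivity
    have h4 : b / 2 ≤ ‖P 1‖ * (E * (q : ℝ) ^ (13 * (1 - β))) / (1 - β) := by
      calc b / 2 ≤ (quadProd χ₁ χ₂ 2).re / 2 := by gcongr
        _ ≤ _ := main
        _ ≤ ‖P 1‖ * (E * (q : ℝ) ^ (13 * (1 - β))) / (1 - β) := by gcongr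
    rw [le_div_iff₀ h1β] at h4
    change _ ≤ ‖P 1‖
    rw [Real.rpow_neg (by positivity), ← div_eq_mul_inv, div_le_iff₀ hqr, div_mul_eq_mul_div,
      div_le_iff₀ hE0]
    linarith
  · rw [dslope_of_ne _ hs, slope_def_module, smul_eq_mul, Z_one, one_mul, Z_eq hs]
    have : s - 1 ≠ 0 := sub_ne_zero.2 hs
    simp only [quadProd, hP]
    field_simp
    ring
  · exact (Complex.nonneg_iff.1 (quadProd_alternating h₁ h₂ m)).1
  · refine le_trans ?_ (div_le_div_of_nonneg_right (hb2 q χ₁ χ₂ h₁ h₂) (by norm_num))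
    calc K * (q : ℝ) ^ 2 * (27 / 32) ^ k * (32 / 5) ≤ K * (q : ℝ) ^ 2 * T⁻¹ * (32 / 5) := by gcongr
      _ = K * (32 / 5) / C₁ := by rw [hT]; field_simp
      _ ≤ b / 2 := by
        rw [div_le_iff₀ (by linarith), hC₁]
        have : b / 2 * (64 / 5 * K / b) = 32 / 5 * K := by field_simp; norm_num
        nlinarith

end BDH

namespace BDH
open Set Filter Topology MeasureTheory Complex
open scoped ComplexOrder

lemma im_eq_zero_of_differentiable {f : ℂ → ℂ} (hf : Differentiable ℂ f)
    (h : ∀ σ : ℝ, 1 < σ → (f σ).im = 0) (x : ℝ) : (f x).im = 0 := by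
  have h1 : Differentiable ℂ (starRingEnd ℂ ∘ f ∘ starRingEnd ℂ) := fun z => by
    have := (hf (starRingEnd ℂ z)).conj_conj
    rwa [Complex.conj_conj] at this
  have h2 : (starRingEnd ℂ ∘ f ∘ starRingEnd ℂ) = f := by
    refine AnalyticOnNhd.eq_of_frequently_eq (z₀ := 2)
      (h1.differentiableOn.analyticOnNhd isOpen_univ) (hf.differentiableOn.analyticOnNhd isOpen_univ) ?_
    have hu : Tendsto (fun n : ℕ => ((2 + 1 / ((n : ℝ) + 1) : ℝ) : ℂ)) atTop (𝓝[≠] 2) := by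
      refine tendsto_nhdsWithin_iff.2 ⟨?_, Eventually.of_forall fun n => ?_⟩
      · have := (tendsto_one_div_add_atTop_nhds_zero_nat (𝕜 := ℝ)).const_add 2
        have h3 := (Complex.continuous_ofReal.tendsto (2 + 0)).comp this
        simpa [Function.comp_def] using h3
      · have : (0 : ℝ) < 1 / ((n : ℝ) + 1) := by positivity
        intro h
        have h5 := mem_singleton_iff.1 h
        have h4 : (2 + 1 / ((n : ℝ) + 1) : ℝ) = 2 := by exact_mod_cast h5
        linarith
    refine hu.frequently (Frequently.of_forall fun n => ?_)
    simp only [Function.comp_apply, Complex.conj_ofReal]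
    refine Complex.conj_eq_iff_im.2 (h _ ?_)
    have : (0 : ℝ) < 1 / ((n : ℝ) + 1) := by positivity
    linarith
  have h3 := congrFun h2 x
  simp only [Function.comp_apply, Complex.conj_ofReal] at h3
  exact Complex.conj_eq_iff_im.1 h3

lemma LFunction_im_eq_zero {q : ℕ} [NeZero q] {χ : DirichletCharacter ℂ q} (h : χ ^ 2 = 1)
    (h1 : χ ≠ 1) (x : ℝ) : (χ.LFunction x).im = 0 :=
  im_eq_zero_of_differentiable (DirichletCharacter.differentiable_LFunction h1)
    (fun _ hσ => (Complex.lt_def.1 (LFunction_pos_of_sq_eq_one h hσ)).2.symm) x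

lemma Z_im_eq_zero (x : ℝ) : (Z x).im = 0 := by
  refine im_eq_zero_of_differentiable differentiable_Z (fun σ hσ => ?_) x
  have h := (Complex.lt_def.1 (LFunction_pos_of_sq_eq_one
    (χ := (1 : DirichletCharacter ℂ 1)) (one_pow 2) hσ)).2
  rw [DirichletCharacter.LFunction_modOne_eq] at h
  have h1 : (σ : ℂ) ≠ 1 := by
    intro h
    have : σ = 1 := by exact_mod_cast h
    linarith
  rw [Z_eq h1, Complex.mul_im]
  simp [← h]

lemma LFunction_re_pos {q : ℕ} [NeZero q] {χ : DirichletCharacter ℂ q} (h : χ ^ 2 = 1)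
    (h1 : χ ≠ 1) {b : ℝ} (hb : b < 1) (hz : ∀ x : ℝ, b < x → x < 1 → χ.LFunction x ≠ 0) {x : ℝ}
    (hx : b < x) : 0 < (χ.LFunction x).re := by
  have hc : Continuous fun y : ℝ => (χ.LFunction y).re :=
    Complex.continuous_re.comp
      ((DirichletCharacter.differentiable_LFunction h1).continuous.comp Complex.continuous_ofReal)
  by_contra hneg
  have h2 : 0 < (χ.LFunction (2 : ℝ)).re :=
    (Complex.lt_def.1 (LFunction_pos_of_sq_eq_one h (σ := 2) (by norm_num))).1
  obtain ⟨y, hy, hy0⟩ := (isPreconnected_Ioi (a := b)).intermediate_value (mem_Ioi.2 hx)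
    (mem_Ioi.2 (show b < 2 by linarith)) hc.continuousOn (show (0 : ℝ) ∈ Set.Icc _ _ from
      ⟨not_lt.1 hneg, h2.le⟩)
  have h0 : χ.LFunction y = 0 := Complex.ext hy0 (LFunction_im_eq_zero h h1 y)
  rcases lt_or_ge y 1 with h3 | h3
  · exact hz y hy h3 h0
  · exact DirichletCharacter.LFunction_ne_zero_of_one_le_re χ (Or.inl h1) (by simpa using h3) h0

/-- A character and a point near `1` at which `quadProd` is nonpositive for every partner. -/
lemma exists_exceptional {ε : ℝ} (hε : 0 < ε) {q₀ : ℕ} [NeZero q₀] {χ₀ : DirichletCharacter ℂ q₀}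
    (h₀ : χ₀ ^ 2 = 1) (h₀' : χ₀ ≠ 1) :
    ∃ (q₁ : ℕ) (_ : NeZero q₁) (χ₁ : DirichletCharacter ℂ q₁), χ₁ ^ 2 = 1 ∧ χ₁ ≠ 1 ∧
      ∃ β : ℝ, 1 - ε < β ∧ β < 1 ∧ ∀ (N : ℕ) [NeZero N] (hN : q₁ ∣ N) (ψ : DirichletCharacter ℂ N),
        ψ ^ 2 = 1 → ψ ≠ 1 → DirichletCharacter.changeLevel hN χ₁ * ψ ≠ 1 →
        (quadProd (DirichletCharacter.changeLevel hN χ₁) ψ β).re ≤ 0 := by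
  by_cases H : ∃ (q₁ : ℕ) (_ : NeZero q₁) (χ₁ : DirichletCharacter ℂ q₁), χ₁ ^ 2 = 1 ∧ χ₁ ≠ 1 ∧
      ∃ β : ℝ, 1 - ε < β ∧ β < 1 ∧ χ₁.LFunction β = 0
  · obtain ⟨q₁, hq, χ₁, h1, h2, β, hβ, hβ', h3⟩ := H
    refine ⟨q₁, hq, χ₁, h1, h2, β, hβ, hβ', fun N _ hN ψ _ _ _ => ?_⟩
    rw [quadProd, DirichletCharacter.LFunction_changeLevel hN χ₁ (Or.inl h2), h3]
    simp
  · push Not at H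
    have hcont : ContinuousAt (fun x : ℝ => (Z x).re) 1 :=
      (Complex.continuous_re.comp
        (differentiable_Z.continuous.comp Complex.continuous_ofReal)).continuousAt
    have hev : ∀ᶠ x : ℝ in 𝓝 1, 0 < (Z x).re :=
      hcont.eventually (lt_mem_nhds (by simp))
    obtain ⟨r, hr, hball⟩ := Metric.eventually_nhds_iff.1 hev
    refine ⟨q₀, inferInstance, χ₀, h₀, h₀', 1 - min (ε / 2) (r / 2), ?_, ?_, ?_⟩
    · have := min_le_left (ε / 2) (r / 2)
      linarith
    · have : 0 < min (ε / 2) (r / 2) := by positivity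
      linarith
    intro N _ hN ψ h1 h2 h3
    have hm : 0 < min (ε / 2) (r / 2) := by positivity
    have hm1 := min_le_left (ε / 2) (r / 2)
    have hm2 := min_le_right (ε / 2) (r / 2)
    set β := 1 - min (ε / 2) (r / 2) with hβ
    have hZ : 0 < (Z β).re := by
      refine hball ?_
      rw [Real.dist_eq, hβ, abs_lt]
      constructor <;> linarith
    have hβ1 : (β : ℂ) ≠ 1 := by
      intro h
      have : β = 1 := by exact_mod_cast h
      linarith
    set ψ₁ := DirichletCharacter.changeLevel hN χ₀ with hψ₁
    have h4 : ψ₁ ^ 2 = 1 := by rw [hψ₁, ← map_pow, h₀, map_one]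
    have h5 : ψ₁ ≠ 1 := fun h => h₀' ((DirichletCharacter.changeLevel_eq_one_iff hN).1 h)
    have h6 : (ψ₁ * ψ) ^ 2 = 1 := by rw [mul_pow, h4, h1, one_mul]
    have key : ∀ χ : DirichletCharacter ℂ N, χ ^ 2 = 1 → χ ≠ 1 →
        ∃ r : ℝ, 0 < r ∧ χ.LFunction β = r := fun χ hχ hχ' => by
      refine ⟨(χ.LFunction β).re, LFunction_re_pos hχ hχ' (b := 1 - ε) (by linarith)
        (fun x hx hx' => H N inferInstance χ hχ hχ' x hx hx') (by linarith), ?_⟩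
      exact Complex.ext (by simp) (by simpa using LFunction_im_eq_zero hχ hχ' β)
    obtain ⟨r1, hr1, e1⟩ := key _ h4 h5
    obtain ⟨r2, hr2, e2⟩ := key _ h1 h2
    obtain ⟨r3, hr3, e3⟩ := key _ h6 h3
    have hz : riemannZeta β = (((Z β).re / (β - 1) : ℝ) : ℂ) := by
      have h7 := Z_eq hβ1
      have h8 : Z β = ((Z β).re : ℂ) :=
        Complex.ext (by simp) (by simpa using Z_im_eq_zero β)
      have h9 : (β : ℂ) - 1 ≠ 0 := sub_ne_zero.2 hβ1
      rw [ofReal_div, ← h8, h7]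
      push_cast
      field_simp
    rw [quadProd, e1, e2, e3, hz, ← ofReal_mul, ← ofReal_mul, ← ofReal_mul, ofReal_re]
    refine mul_nonpos_of_nonpos_of_nonneg ?_ (by positivity)
    exact div_nonpos_of_nonneg_of_nonpos hZ.le (by linarith)

/-- Siegel's theorem. -/
theorem norm_LFunction_one_ge {ε : ℝ} (hε : 0 < ε) : ∃ c : ℝ, 0 < c ∧ ∀ (q : ℕ) [NeZero q]
    (χ : DirichletCharacter ℂ q), χ ^ 2 = 1 → χ ≠ 1 →
    c * (q : ℝ) ^ (-ε) ≤ ‖χ.LFunction 1‖ := by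
  by_cases H : ∃ (q₁ : ℕ) (_ : NeZero q₁) (χ₁ : DirichletCharacter ℂ q₁), χ₁ ^ 2 = 1 ∧ χ₁ ≠ 1
  swap
  · push Not at H
    exact ⟨1, one_pos, fun q _ χ h1 h2 => absurd (H q inferInstance χ h1) h2⟩
  obtain ⟨q₀, _, χ₀, h₀, h₀'⟩ := H
  obtain ⟨q₁, _, χ₁, hχ₁, hχ₁', β, hβ, hβ1, hexc⟩ :=
    exists_exceptional (ε := min (1 / 8) (ε / 52)) (by positivity) h₀ h₀'
  obtain ⟨c, hc, hlow⟩ := norm_prod_LFunction_one_ge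
  obtain ⟨K, hK, hup⟩ := norm_LFunction_le (ε := min (ε / 16) (1 / 3)) (by positivity)
    (min_le_right _ _)
  have hβ8 : 7 / 8 < β := by
    have := min_le_left (1 / 8) (ε / 52)
    linarith
  have hβε : 13 * (1 - β) ≤ ε / 4 := by
    have := min_le_right (1 / 8) (ε / 52)
    linarith
  set D : ℝ := 2 / (ε / 2) + 1 with hD
  have hD0 : 0 < D := by positivity
  have hL1 : 0 < ‖χ₁.LFunction 1‖ :=
    norm_pos_iff.2 (DirichletCharacter.LFunction_apply_one_ne_zero hχ₁')
  set c₁ : ℝ := c * (1 - β) / (K ^ 2 * (2 : ℝ) ^ (ε / 4) * D) with hc₁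
  have hc₁0 : 0 < c₁ := by
    have : 0 < 1 - β := by linarith
    positivity
  set c₂ : ℝ := ‖χ₁.LFunction 1‖ / D ^ 2 with hc₂
  have hc₂0 : 0 < c₂ := by positivity
  have hq₁ : 0 < (q₁ : ℝ) := by exact_mod_cast Nat.pos_of_ne_zero (NeZero.ne q₁)
  refine ⟨min c₁ c₂ * (q₁ : ℝ) ^ (-ε), by positivity, fun q _ χ h1 h2 => ?_⟩
  have hq : 0 < (q : ℝ) := by exact_mod_cast Nat.pos_of_ne_zero (NeZero.ne q)
  set N := q₁ * q with hN
  have hN0 : N ≠ 0 := mul_ne_zero (NeZero.ne _) (NeZero.ne _)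
  have hNp : 0 < (N : ℝ) := by exact_mod_cast Nat.pos_of_ne_zero hN0
  have : NeZero N := ⟨hN0⟩
  have hd1 : q₁ ∣ N := Dvd.intro _ rfl
  have hd : q ∣ N := Dvd.intro_left _ rfl
  suffices h : min c₁ c₂ * (N : ℝ) ^ (-ε) ≤ ‖χ.LFunction 1‖ by
    rw [mul_assoc, ← Real.mul_rpow hq₁.le hq.le]
    rw [hN] at h
    exact_mod_cast h
  have hω : ((N.primeFactors.card : ℝ) + 1) ≤ D * (N : ℝ) ^ (ε / 2) :=
    card_primeFactors_le_rpow (by positivity) hN0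
  set ω : ℝ := (N.primeFactors.card : ℝ) + 1 with hωd
  have hω0 : 0 < ω := by positivity
  set ψ₁ := DirichletCharacter.changeLevel hd1 χ₁ with hψ₁
  set ψ := DirichletCharacter.changeLevel hd χ with hψ
  have h3 : ψ₁ ^ 2 = 1 := by rw [hψ₁, ← map_pow, hχ₁, map_one]
  have h4 : ψ₁ ≠ 1 := fun h => hχ₁' ((DirichletCharacter.changeLevel_eq_one_iff hd1).1 h)
  have h5 : ψ ^ 2 = 1 := by rw [hψ, ← map_pow, h1, map_one]
  have h6 : ψ ≠ 1 := fun h => h2 ((DirichletCharacter.changeLevel_eq_one_iff hd).1 h)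
  have e1 : ‖ψ₁.LFunction 1‖ = ‖χ₁.LFunction 1‖ *
      ‖∏ p ∈ N.primeFactors, (1 - χ₁ p * (p : ℂ) ^ (-(1 : ℂ)))‖ := by
    rw [hψ₁, DirichletCharacter.LFunction_changeLevel hd1 χ₁ (Or.inl hχ₁'), norm_mul]
  have e2 : ‖ψ.LFunction 1‖ = ‖χ.LFunction 1‖ *
      ‖∏ p ∈ N.primeFactors, (1 - χ p * (p : ℂ) ^ (-(1 : ℂ)))‖ := by
    rw [hψ, DirichletCharacter.LFunction_changeLevel hd χ (Or.inl h2), norm_mul]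
  have g2 := norm_eulerFactors_char_le N χ (s := 1) (by simp)
  have g1 := norm_eulerFactors_char_ge N χ₁ (s := 1) (by simp)
  have hψle : ‖ψ.LFunction 1‖ ≤ ‖χ.LFunction 1‖ * ω := by
    rw [e2]
    gcongr
  by_cases hprod : ψ₁ * ψ = 1
  · have h7 : ψ₁ = ψ := by
      calc ψ₁ = ψ₁ * ψ ^ 2 := by rw [h5, mul_one]
        _ = ψ := by rw [pow_two, ← mul_assoc, hprod, one_mul]
    have h8 : ‖χ₁.LFunction 1‖ * (1 / ω) ≤ ‖χ.LFunction 1‖ * ω := by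
      refine le_trans ?_ hψle
      rw [← h7, e1]
      gcongr
    have h9 : ‖χ₁.LFunction 1‖ ≤ ‖χ.LFunction 1‖ * ω ^ 2 := by
      calc ‖χ₁.LFunction 1‖ = ‖χ₁.LFunction 1‖ * (1 / ω) * ω := by field_simp
        _ ≤ ‖χ.LFunction 1‖ * ω * ω := by gcongr
        _ = _ := by ring
    have h10 : ω ^ 2 ≤ D ^ 2 * (N : ℝ) ^ ε := by
      calc ω ^ 2 ≤ (D * (N : ℝ) ^ (ε / 2)) ^ 2 := by gcongr
        _ = D ^ 2 * (N : ℝ) ^ ε := by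
          rw [mul_pow, ← Real.rpow_natCast ((N : ℝ) ^ (ε / 2)), ← Real.rpow_mul hNp.le]
          norm_num
    calc min c₁ c₂ * (N : ℝ) ^ (-ε) ≤ c₂ * (N : ℝ) ^ (-ε) := by
          gcongr
          exact min_le_right _ _
      _ ≤ ‖χ.LFunction 1‖ := by
          rw [hc₂, Real.rpow_neg hNp.le, ← div_eq_mul_inv, div_div, div_le_iff₀ (by positivity)]
          exact h9.trans (by gcongr)
  · have g3 := hlow N ψ₁ ψ h3 h5 h4 h6 hprod β hβ8 hβ1 (hexc N hd1 ψ h5 h6 hprod)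
    have hu : ∀ χ' : DirichletCharacter ℂ N, χ' ≠ 1 →
        ‖χ'.LFunction 1‖ ≤ K * ((2 : ℝ) ^ (ε / 8) * (N : ℝ) ^ (ε / 8)) := fun χ' hne => by
      have hm : 0 < min (ε / 16) (1 / 3 : ℝ) := by positivity
      have := hup N χ' hne 1 (by rw [one_re]; linarith) (by rw [one_re]; norm_num)
      refine this.trans ?_
      rw [← Real.mul_rpow (by norm_num) hNp.le]
      have h1N : (1 : ℝ) ≤ N := by exact_mod_cast Nat.pos_of_ne_zero hN0
      have e : cond N 1 = 2 * N := by simp [cond]; ring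
      rw [e]
      gcongr
      · linarith
      · have := min_le_left (ε / 16) (1 / 3 : ℝ)
        linarith
    have g4 := hu ψ₁ h4
    have g5 := hu _ hprod
    set T : ℝ := (2 : ℝ) ^ (ε / 8) * (N : ℝ) ^ (ε / 8) with hT
    have hT2 : T ^ 2 = (2 : ℝ) ^ (ε / 4) * (N : ℝ) ^ (ε / 4) := by
      rw [hT, mul_pow, ← Real.rpow_natCast, ← Real.rpow_natCast, ← Real.rpow_mul (by norm_num),
        ← Real.rpow_mul hNp.le]
      norm_num
      ring_nf
    have hT0 : 0 < T := by positivity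
    have g6 : c * (1 - β) * (N : ℝ) ^ (-(ε / 4)) ≤ ‖χ.LFunction 1‖ * ω * (K ^ 2 * T ^ 2) := by
      have h1N : (1 : ℝ) ≤ N := by exact_mod_cast Nat.pos_of_ne_zero hN0
      calc c * (1 - β) * (N : ℝ) ^ (-(ε / 4)) ≤ c * (1 - β) * (N : ℝ) ^ (-(13 * (1 - β))) := by
            have : 0 ≤ 1 - β := by linarith
            gcongr
        _ ≤ _ := g3
        _ = ‖ψ₁.LFunction 1‖ * ‖ψ.LFunction 1‖ * ‖(ψ₁ * ψ).LFunction 1‖ := by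
            rw [norm_mul, norm_mul]
        _ ≤ (K * T) * (‖χ.LFunction 1‖ * ω) * (K * T) := by gcongr
        _ = _ := by ring
    have g7 : c * (1 - β) * (N : ℝ) ^ (-(ε / 4)) ≤
        ‖χ.LFunction 1‖ * (D * (N : ℝ) ^ (ε / 2)) * (K ^ 2 * T ^ 2) :=
      g6.trans (by gcongr)
    calc min c₁ c₂ * (N : ℝ) ^ (-ε) ≤ c₁ * (N : ℝ) ^ (-ε) := by
          gcongr
          exact min_le_left _ _
      _ ≤ ‖χ.LFunction 1‖ := by
          rw [hc₁, div_mul_eq_mul_div, div_le_iff₀ (by positivity)]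
          have e : (N : ℝ) ^ (-ε) = (N : ℝ) ^ (-(ε / 4)) * (N : ℝ) ^ (-(3 * ε / 4)) := by
            rw [← Real.rpow_add hNp]; congr 1; ring
          have e' : (N : ℝ) ^ (ε / 2) * (N : ℝ) ^ (ε / 4) * (N : ℝ) ^ (-(3 * ε / 4)) = 1 := by
            rw [← Real.rpow_add hNp, ← Real.rpow_add hNp, ← Real.rpow_zero (N : ℝ)]
            congr 1; ring
          calc c * (1 - β) * (N : ℝ) ^ (-ε)
              = c * (1 - β) * (N : ℝ) ^ (-(ε / 4)) * (N : ℝ) ^ (-(3 * ε / 4)) := by rw [e]; ring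
            _ ≤ ‖χ.LFunction 1‖ * (D * (N : ℝ) ^ (ε / 2)) * (K ^ 2 * T ^ 2) *
                (N : ℝ) ^ (-(3 * ε / 4)) := by gcongr
            _ = ‖χ.LFunction 1‖ * (K ^ 2 * (2 : ℝ) ^ (ε / 4) * D) *
                ((N : ℝ) ^ (ε / 2) * (N : ℝ) ^ (ε / 4) * (N : ℝ) ^ (-(3 * ε / 4))) := by
                rw [hT2]; ring
            _ = _ := by rw [e', mul_one]

end BDH

namespace BDH
open Set Filter Topology MeasureTheory Complex

lemma cond_eq_of_im_eq (q : ℕ) {z s : ℂ} (h : z.im = s.im) : cond q z = cond q s := by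
  rw [cond, cond, h]

lemma norm_sub_le_of_deriv_le {f : ℂ → ℂ} (hf : Differentiable ℂ f) {A : ℝ} (z w : ℂ)
    (h : ∀ y ∈ segment ℝ z w, ‖deriv f y‖ ≤ A) : ‖f w - f z‖ ≤ A * ‖w - z‖ :=
  (convex_segment z w).norm_image_sub_le_of_norm_deriv_le (fun y _ => hf y) h
    (left_mem_segment ℝ z w) (right_mem_segment ℝ z w)

/-- Lower bound for `L(s, χ)` to the right of the line `re s = 1`. -/
theorem norm_LFunction_ge {ε : ℝ} (hε : 0 < ε) (hε' : ε ≤ 1 / 3) : ∃ κ : ℝ, 0 < κ ∧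
    ∀ (q : ℕ) [NeZero q] (χ : DirichletCharacter ℂ q), χ ≠ 1 → ∀ s : ℂ, 1 < s.re → s.re ≤ 2 →
    κ * cond q s ^ (-(24 * ε)) ≤ ‖χ.LFunction s‖ := by
  obtain ⟨D, hD, hder⟩ := norm_deriv_LFunction_le hε hε'
  obtain ⟨κ, hκ, hlow⟩ := norm_LFunction_ge_of_deriv_le hε hε' hD
  obtain ⟨B, hB, hBs⟩ := norm_LFunction_ge_sub_one
  obtain ⟨c', hc', hSi'⟩ := norm_LFunction_one_ge hε
  set c := min c' 1 with hcdef
  have hc : 0 < c := by positivity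
  have hc1 : c ≤ 1 := min_le_right _ _
  have hSi : ∀ (q : ℕ) [NeZero q] (χ : DirichletCharacter ℂ q), χ ^ 2 = 1 → χ ≠ 1 →
      c * (q : ℝ) ^ (-ε) ≤ ‖χ.LFunction 1‖ := fun q _ χ h1 h2 =>
    le_trans (by gcongr; exact min_le_left _ _) (hSi' q χ h1 h2)
  set η := c / (4 * D) with hη
  have hη0 : 0 < η := by positivity
  have hη1 : η ≤ 1 := by
    rw [hη, div_le_one (by positivity)]
    linarith
  have hη4 : η ^ 4 ≤ 1 := pow_le_one₀ hη0.le hη1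
  refine ⟨min (min (κ * η ^ 4) (c / 2)) (η / B), by positivity, fun q _ χ hχ s h1 h2 => ?_⟩
  have hX2 : 2 ≤ cond q s := two_le_cond q s
  set X := cond q s with hX
  have hX0 : 0 < X := by linarith
  have hX1 : 1 ≤ X := by linarith
  have hs : ((s.re : ℝ) : ℂ) + (s.im : ℝ) * I = s := Complex.re_add_im s
  have hd : ∀ σ : ℝ, 1 < σ → σ ≤ 2 →
      ‖deriv χ.LFunction (σ + s.im * I)‖ ≤ D * cond q (σ + s.im * I) ^ (2 * ε) :=
    fun σ h h' => hder q χ hχ _ (by simp; linarith) (by simp; linarith)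
  have hmono : ∀ {a b : ℝ}, a ≤ b → X ^ (-(b * ε)) ≤ X ^ (-(a * ε)) := fun h =>
    Real.rpow_le_rpow_of_exponent_le hX1 (by nlinarith)
  by_cases hχ2 : χ ^ 2 = 1
  swap
  · have h3 := hlow 1 one_pos le_rfl q χ s.im hd (Or.inl hχ2) s.re h1 h2
    rw [hs] at h3
    refine le_trans ?_ h3
    rw [one_pow, mul_one]
    refine mul_le_mul ?_ (hmono (by norm_num)) (by positivity) hκ.le
    refine (min_le_left _ _).trans ((min_le_left _ _).trans ?_)
    exact mul_le_of_le_one_right hκ.le hη4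
  set θ := η * X ^ (-(3 * ε)) with hθ
  have hθ0 : 0 < θ := by positivity
  have hXle : X ^ (-(3 * ε)) ≤ 1 := Real.rpow_le_one_of_one_le_of_nonpos hX1 (by linarith)
  have hθ1 : θ ≤ 1 := mul_le_one₀ hη1 (by positivity) hXle
  by_cases hσ : θ ≤ s.re - 1
  · calc _ ≤ η / B * X ^ (-(24 * ε)) := by gcongr; exact min_le_right _ _
      _ ≤ η / B * X ^ (-(3 * ε)) := by
        gcongr 1
        exact hmono (by norm_num)
      _ = θ / B := by rw [hθ]; ring
      _ ≤ (s.re - 1) / B := by gcongr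
      _ ≤ _ := hBs q χ s h1 h2
  by_cases ht : θ ≤ |s.im|
  · have h3 := hlow θ hθ0 hθ1 q χ s.im hd (Or.inr ht) s.re h1 h2
    rw [hs] at h3
    refine le_trans ?_ h3
    have e : κ * θ ^ 4 * X ^ (-(12 * ε)) = κ * η ^ 4 * X ^ (-(24 * ε)) := by
      have : X ^ (-(24 * ε)) = (X ^ (-(3 * ε))) ^ 4 * X ^ (-(12 * ε)) := by
        rw [← Real.rpow_natCast, ← Real.rpow_mul hX0.le, ← Real.rpow_add hX0]
        congr 1
        push_cast
        ring
      rw [hθ, this]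
      ring
    rw [← hX, e]
    gcongr
    exact (min_le_left _ _).trans (min_le_left _ _)
  · push Not at hσ ht
    have hdist : ‖s - 1‖ ≤ 2 * θ := by
      refine (Complex.norm_le_abs_re_add_abs_im _).trans ?_
      rw [Complex.sub_re, Complex.sub_im, Complex.one_re, Complex.one_im, sub_zero,
        abs_of_pos (by linarith)]
      linarith
    have hseg : ∀ y ∈ segment ℝ (1 : ℂ) s, ‖deriv χ.LFunction y‖ ≤ D * X ^ (2 * ε) := by
      rintro y ⟨a, b, ha, hb, hab, rfl⟩
      have hre : (a • (1 : ℂ) + b • s).re = a + b * s.re := by simp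
      have him : (a • (1 : ℂ) + b • s).im = b * s.im := by simp
      have hb1 : b ≤ 1 := by linarith
      refine (hder q χ hχ _ (by rw [hre]; nlinarith) (by rw [hre]; nlinarith)).trans ?_
      have h0 := cond_pos q (a • (1 : ℂ) + b • s)
      gcongr
      rw [hX, cond, cond, him, abs_mul, abs_of_nonneg hb]
      gcongr
      exact mul_le_of_le_one_left (abs_nonneg _) hb1
    have h3 := norm_sub_le_of_deriv_le (DirichletCharacter.differentiable_LFunction hχ) 1 s hseg
    have h4 : c * X ^ (-ε) ≤ ‖χ.LFunction 1‖ := by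
      refine le_trans ?_ (hSi q χ hχ2 hχ)
      have hq : 0 < (q : ℝ) := by exact_mod_cast Nat.pos_of_ne_zero (NeZero.ne q)
      refine mul_le_mul_of_nonneg_left ?_ hc.le
      exact Real.rpow_le_rpow_of_nonpos hq (le_cond q s) (by linarith)
    have h5 : D * X ^ (2 * ε) * ‖s - 1‖ ≤ c / 2 * X ^ (-ε) := by
      have e : X ^ (2 * ε) * X ^ (-(3 * ε)) = X ^ (-ε) := by
        rw [← Real.rpow_add hX0]
        congr 1
        ring
      calc D * X ^ (2 * ε) * ‖s - 1‖ ≤ D * X ^ (2 * ε) * (2 * θ) := by gcongr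
        _ = D * (2 * (c / (4 * D))) * (X ^ (2 * ε) * X ^ (-(3 * ε))) := by rw [hθ, hη]; ring
        _ = c / 2 * X ^ (-ε) := by
          rw [e]
          field_simp
          ring
    have h6 := norm_sub_norm_le (χ.LFunction 1) (χ.LFunction 1 - χ.LFunction s)
    rw [sub_sub_cancel, norm_sub_rev] at h6
    calc _ ≤ c / 2 * X ^ (-(24 * ε)) := by
          gcongr
          exact (min_le_left _ _).trans (min_le_right _ _)
      _ ≤ c / 2 * X ^ (-(1 * ε)) := by
          gcongr 1
          exact hmono (by norm_num)
      _ ≤ ‖χ.LFunction s‖ := by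
          rw [one_mul]
          linarith

lemma exists_le_norm_of_isCompact {f : ℂ → ℂ} {S : Set ℂ} (hS : IsCompact S)
    (hf : ContinuousOn f S) (h0 : ∀ s ∈ S, f s ≠ 0) : ∃ m : ℝ, 0 < m ∧ ∀ s ∈ S, m ≤ ‖f s‖ := by
  rcases S.eq_empty_or_nonempty with rfl | hne
  · exact ⟨1, one_pos, fun s hs => absurd hs (notMem_empty s)⟩
  · obtain ⟨z, hz, hmin⟩ := hS.exists_isMinOn hne hf.norm
    exact ⟨‖f z‖, norm_pos_iff.2 (h0 z hz), fun s hs => hmin hs⟩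

lemma Z_ne_zero {s : ℂ} (hs : 1 ≤ s.re) : Z s ≠ 0 := by
  rcases eq_or_ne s 1 with rfl | h
  · rw [Z_one]
    exact one_ne_zero
  · rw [Z_eq h]
    exact mul_ne_zero (sub_ne_zero.2 h) (riemannZeta_ne_zero_of_one_le_re hs)

lemma norm_deriv_zeta_le {ε : ℝ} (hε : 0 < ε) (hε' : ε ≤ 1 / 3) : ∃ K : ℝ, 1 ≤ K ∧
    ∀ s : ℂ, 1 ≤ s.re → s.re ≤ 3 → 1 ≤ |s.im| →
    ‖deriv riemannZeta s‖ ≤ K * cond 1 s ^ (2 * ε) := by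
  obtain ⟨K, hK, hb⟩ := norm_zeta_le hε hε'
  refine ⟨4 * (2 * K) / ε, ?_, fun s h1 h3 ht => ?_⟩
  · rw [le_div_iff₀ hε]
    linarith
  · have him : ∀ z, ‖z - s‖ ≤ ε → 1 / 2 ≤ |z.im| := fun z hz => by
      have := (Complex.abs_im_le_norm (z - s)).trans hz
      rw [Complex.sub_im] at this
      have h5 := abs_sub_abs_le_abs_sub s.im z.im
      rw [abs_sub_comm] at h5
      linarith
    refine norm_deriv_le_of_cond (by positivity) (by linarith) hε (by linarith)
      (by linarith) (fun z hz => ?_) fun z hz => ?_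
    · refine (differentiableAt_riemannZeta fun h => ?_).differentiableWithinAt
      have := him z (by simpa [dist_eq_norm] using hz)
      rw [h] at this
      norm_num at this
    · have := re_bounds_of_norm_sub_le hz
      refine (hb (1 / 2) (by norm_num) (by norm_num) z (by linarith) (by linarith)
        (him z hz)).trans (le_of_eq ?_)
      ring

theorem norm_Z_ge {ε : ℝ} (hε : 0 < ε) (hε' : ε ≤ 1 / 3) : ∃ κ : ℝ, 0 < κ ∧
    ∀ s : ℂ, 1 < s.re → s.re ≤ 2 → κ * cond 1 s ^ (1 - 24 * ε) ≤ ‖Z s‖ := by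
  obtain ⟨D, hD, hder⟩ := norm_deriv_zeta_le hε hε'
  obtain ⟨κ, hκ, hlow⟩ := norm_LFunction_ge_of_deriv_le hε hε' hD
  obtain ⟨m, hm, hmin⟩ := exists_le_norm_of_isCompact (S := Set.Icc 1 2 ×ℂ Set.Icc (-1) 1)
    (isCompact_Icc.reProdIm isCompact_Icc) differentiable_Z.continuous.continuousOn
    (fun s hs => Z_ne_zero hs.1.1)
  refine ⟨min (κ / 3) (m / 3), by positivity, fun s h1 h2 => ?_⟩
  have hX2 : 2 ≤ cond 1 s := two_le_cond 1 s
  set X := cond 1 s with hX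
  have hX0 : 0 < X := by linarith
  have hX1 : 1 ≤ X := by linarith
  have hXeq : X = |s.im| + 2 := by simp [hX, cond]
  by_cases ht : 1 ≤ |s.im|
  · have hs : ((s.re : ℝ) : ℂ) + (s.im : ℝ) * I = s := Complex.re_add_im s
    have h3 := hlow 1 one_pos le_rfl 1 (1 : DirichletCharacter ℂ 1) s.im (fun σ hσ hσ' => by
      rw [DirichletCharacter.LFunction_modOne_eq]
      exact hder _ (by simp; linarith) (by simp; linarith) (by simpa using ht)) (Or.inr ht)
      s.re h1 h2
    rw [hs, DirichletCharacter.LFunction_modOne_eq, one_pow, mul_one] at h3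
    have hs1 : s ≠ 1 := fun h => by simp [h] at h1
    rw [Z_eq hs1, norm_mul]
    have h4 : X / 3 ≤ ‖s - 1‖ := by
      have := Complex.abs_im_le_norm (s - 1)
      rw [Complex.sub_im, Complex.one_im, sub_zero] at this
      linarith
    calc min (κ / 3) (m / 3) * X ^ (1 - 24 * ε) ≤ κ / 3 * X ^ (1 - 12 * ε) := by
          gcongr
          · exact min_le_left _ _
          · norm_num
      _ = X / 3 * (κ * X ^ (-(12 * ε))) := by
          rw [sub_eq_add_neg, Real.rpow_add hX0, Real.rpow_one]
          ring
      _ ≤ _ := by gcongr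
  · push Not at ht
    calc min (κ / 3) (m / 3) * X ^ (1 - 24 * ε) ≤ m / 3 * X ^ (1 : ℝ) := by
          gcongr
          · exact min_le_right _ _
          · linarith
      _ ≤ m := by
          rw [Real.rpow_one]
          nlinarith
      _ ≤ _ := hmin s ⟨⟨h1.le, h2⟩, abs_le.1 ht.le⟩

/-- A lower bound near the line `re s = 1` together with a derivative bound gives a zero-free
region and a bound for the logarithmic derivative there. -/
lemma logDeriv_bound {ε κ D : ℝ} (hε : 0 < ε) (hε' : ε ≤ 1 / 3) (hκ : 0 < κ) (hD : 1 ≤ D) :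
    ∃ ρ K : ℝ, 0 < ρ ∧ 1 ≤ K ∧ ∀ (q : ℕ) [NeZero q] (a : ℝ) (f : ℂ → ℂ), Differentiable ℂ f →
    (∀ s : ℂ, 1 - ε / 2 ≤ s.re → s.re ≤ 3 → ‖deriv f s‖ ≤ D * cond q s ^ (a + 2 * ε)) →
    (∀ s : ℂ, 1 < s.re → s.re ≤ 2 → κ * cond q s ^ (a - 24 * ε) ≤ ‖f s‖) →
    ∀ s : ℂ, 1 - ρ * cond q s ^ (-(26 * ε)) ≤ s.re → s.re ≤ 2 →
      f s ≠ 0 ∧ ‖deriv f s / f s‖ ≤ K * cond q s ^ (26 * ε) := by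
  set ρ := min (ε / 2) (κ / (4 * D)) with hρ
  have hρ0 : 0 < ρ := by positivity
  refine ⟨ρ, 1 + D / (κ / 2), hρ0, by linarith [show 0 < D / (κ / 2) by positivity],
    fun q _ a f hf hd hlow s h1 h2 => ?_⟩
  have hX2 : 2 ≤ cond q s := two_le_cond q s
  set X := cond q s with hX
  have hX0 : 0 < X := by linarith
  have hX1 : 1 ≤ X := by linarith
  have hXle : X ^ (-(26 * ε)) ≤ 1 := Real.rpow_le_one_of_one_le_of_nonpos hX1 (by linarith)
  have hXp : 0 < X ^ (-(26 * ε)) := by positivity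
  have hre : 1 - ε / 2 ≤ s.re := by
    have : ρ * X ^ (-(26 * ε)) ≤ ε / 2 * 1 :=
      mul_le_mul (min_le_left _ _) hXle hXp.le (by positivity)
    linarith
  have hlow2 : κ / 2 * X ^ (a - 24 * ε) ≤ ‖f s‖ := by
    rcases lt_or_ge 1 s.re with h | h
    · refine le_trans ?_ (hlow s h h2)
      gcongr
      linarith
    · set d : ℝ := 1 + ρ * X ^ (-(26 * ε)) - s.re with hdd
      have hd0 : 0 < d := by
        have : 0 < ρ * X ^ (-(26 * ε)) := by positivity
        linarith
      have hd2 : d ≤ 2 * (ρ * X ^ (-(26 * ε))) := by linarith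
      have hd3 : d ≤ 1 := by
        have : ρ * X ^ (-(26 * ε)) ≤ ε / 2 * 1 :=
          mul_le_mul (min_le_left _ _) hXle hXp.le (by positivity)
        linarith
      have hseg : ∀ y ∈ segment ℝ s (s + d), ‖deriv f y‖ ≤ D * X ^ (a + 2 * ε) := by
        rintro y ⟨u, v, hu, hv, huv, rfl⟩
        have e : u • s + v • (s + (d : ℂ)) = s + ((v * d : ℝ) : ℂ) := by
          simp only [Complex.real_smul]
          have : (u : ℂ) + v = 1 := by exact_mod_cast huv
          push_cast
          linear_combination s * this
        rw [e, hX, ← cond_eq_of_im_eq q (z := s + ((v * d : ℝ) : ℂ)) (by simp)]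
        have hvd : 0 ≤ v * d := by positivity
        have hvd1 : v * d ≤ 1 := mul_le_one₀ (by linarith) hd0.le hd3
        refine hd _ ?_ ?_ <;> rw [Complex.add_re, Complex.ofReal_re] <;> linarith
      have h3 := norm_sub_le_of_deriv_le hf s (s + d) hseg
      have h4 := hlow (s + d) (by
        rw [Complex.add_re, Complex.ofReal_re, hdd]
        have : 0 < ρ * X ^ (-(26 * ε)) := by positivity
        linarith) (by rw [Complex.add_re, Complex.ofReal_re]; linarith)
      rw [cond_eq_of_im_eq q (s := s) (by simp), ← hX] at h4
      rw [add_sub_cancel_left, Complex.norm_real, Real.norm_of_nonneg hd0.le] at h3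
      have h5 : D * X ^ (a + 2 * ε) * d ≤ κ / 2 * X ^ (a - 24 * ε) := by
        have e : X ^ (a + 2 * ε) * X ^ (-(26 * ε)) = X ^ (a - 24 * ε) := by
          rw [← Real.rpow_add hX0]
          congr 1
          ring
        have hρ2 : ρ ≤ κ / (4 * D) := min_le_right _ _
        calc D * X ^ (a + 2 * ε) * d
            ≤ D * X ^ (a + 2 * ε) * (2 * (κ / (4 * D) * X ^ (-(26 * ε)))) := by
              gcongr
              exact hd2.trans (by gcongr)
          _ = D * (2 * (κ / (4 * D))) * (X ^ (a + 2 * ε) * X ^ (-(26 * ε))) := by ring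
          _ = κ / 2 * X ^ (a - 24 * ε) := by
            rw [e]
            field_simp
            ring
      have h6 := norm_sub_norm_le (f (s + d)) (f (s + d) - f s)
      rw [sub_sub_cancel] at h6
      linarith
  have hpos : 0 < κ / 2 * X ^ (a - 24 * ε) := by positivity
  refine ⟨norm_pos_iff.1 (hpos.trans_le hlow2), ?_⟩
  rw [norm_div, div_le_iff₀ (hpos.trans_le hlow2)]
  calc ‖deriv f s‖ ≤ D * X ^ (a + 2 * ε) := hd s hre (by linarith)
    _ = D / (κ / 2) * X ^ (26 * ε) * (κ / 2 * X ^ (a - 24 * ε)) := by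
      have e : X ^ (a + 2 * ε) = X ^ (26 * ε) * X ^ (a - 24 * ε) := by
        rw [← Real.rpow_add hX0]
        congr 1
        ring
      rw [e]
      field_simp
    _ ≤ (1 + D / (κ / 2)) * X ^ (26 * ε) * ‖f s‖ := by
      gcongr
      linarith

/-- `LSeries a` continues to a region `re s ≥ 1 - ρ (q(|t|+2))^(-b)` with a power bound. -/
def HasExtension (b ρ K : ℝ) (q : ℕ) (a : ℕ → ℂ) : Prop :=
  ∃ G : ℂ → ℂ, (∀ s : ℂ, 1 - ρ * cond q s ^ (-b) ≤ s.re → s.re ≤ 2 →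
    DifferentiableAt ℂ G s ∧ ‖G s‖ ≤ K * cond q s ^ b) ∧ ∀ s : ℂ, 1 < s.re → LSeries a s = G s

theorem hasExtension_char {b : ℝ} (hb : 0 < b) (hb1 : b ≤ 1) : ∃ ρ K : ℝ, 0 < ρ ∧ 1 ≤ K ∧
    ∀ (q : ℕ) [NeZero q] (χ : DirichletCharacter ℂ q), χ ≠ 1 →
    HasExtension b ρ K q (fun n => χ n * (ArithmeticFunction.vonMangoldt n : ℂ)) := by
  have hε : 0 < b / 26 := by positivity
  have hε' : b / 26 ≤ 1 / 3 := by linarith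
  obtain ⟨D, hD, hder⟩ := norm_deriv_LFunction_le hε hε'
  obtain ⟨κ, hκ, hlow⟩ := norm_LFunction_ge hε hε'
  obtain ⟨ρ, K, hρ, hK, h⟩ := logDeriv_bound hε hε' hκ hD
  refine ⟨ρ, K, hρ, hK, fun q _ χ hχ =>
    ⟨fun s => -(deriv χ.LFunction s / χ.LFunction s), fun s h1 h2 => ?_, fun s hs => ?_⟩⟩
  · have hd := DirichletCharacter.differentiable_LFunction hχ
    have e : 26 * (b / 26) = b := by ring
    obtain ⟨h0, hn⟩ := h q 0 χ.LFunction hd (fun s h1 h2 => by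
      simpa using hder q χ hχ s h1 h2) (fun s h1 h2 => by
      simpa using hlow q χ hχ s h1 h2) s (by rwa [e]) h2
    refine ⟨?_, ?_⟩
    · exact (((hd.analyticAt s).deriv.differentiableAt).div (hd s) h0).neg
    · rwa [norm_neg, ← e]
  · beta_reduce
    rw [(hasDerivAt_LFunction χ hs).deriv]
    have h0 : χ.LFunction s ≠ 0 :=
      DirichletCharacter.LFunction_ne_zero_of_one_le_re χ (Or.inl hχ) hs.le
    field_simp

theorem hasExtension_vonMangoldt_sub_one {b : ℝ} (hb : 0 < b) (hb1 : b ≤ 1) :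
    ∃ ρ K : ℝ, 0 < ρ ∧ 1 ≤ K ∧
    HasExtension b ρ K 1 (fun n => (ArithmeticFunction.vonMangoldt n : ℂ) - 1) := by
  have hε : 0 < b / 26 := by positivity
  have hε' : b / 26 ≤ 1 / 3 := by linarith
  obtain ⟨D, hD, hder⟩ := norm_deriv_Z_le hε hε'
  obtain ⟨κ, hκ, hlow⟩ := norm_Z_ge hε hε'
  obtain ⟨ρ, K, hρ, hK, h⟩ := logDeriv_bound hε hε' hκ hD
  obtain ⟨K', hK', hZ⟩ := norm_Z_le hε hε'
  have hds : Differentiable ℂ (dslope Z 1) := by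
    have := (differentiableOn_dslope (f := Z) (s := univ) (c := 1) univ_mem).2
      differentiable_Z.differentiableOn
    exact differentiableOn_univ.1 this
  obtain ⟨M, hM⟩ := ((isCompact_Icc (a := (0 : ℝ)) (b := 2)).reProdIm
    (isCompact_Icc (a := (-1 : ℝ)) (b := 1))).exists_bound_of_continuousOn
    (hds.continuous.continuousOn)
  have e : 26 * (b / 26) = b := by ring
  refine ⟨min ρ (b / 26), K + (|M| + 6 * K'), by positivity, by
    linarith [abs_nonneg M], fun s => -(deriv Z s / Z s) - dslope Z 1 s, fun s h1 h2 => ?_,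
    fun s hs => ?_⟩
  · have hX2 : 2 ≤ cond 1 s := two_le_cond 1 s
    have hXeq : cond 1 s = |s.im| + 2 := by simp [cond]
    set X := cond 1 s with hX
    have hX0 : 0 < X := by linarith
    have hX1 : 1 ≤ X := by linarith
    have hXle : X ^ (-b) ≤ 1 := Real.rpow_le_one_of_one_le_of_nonpos hX1 (by linarith)
    have hXp : 0 < X ^ (-b) := by positivity
    have hXb : 1 ≤ X ^ b := Real.one_le_rpow hX1 hb.le
    have hre : 1 - b / 26 ≤ s.re := by
      have : min ρ (b / 26) * X ^ (-b) ≤ b / 26 * 1 :=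
        mul_le_mul (min_le_right _ _) hXle hXp.le (by positivity)
      linarith
    obtain ⟨h0, hn⟩ := h 1 1 Z differentiable_Z hder hlow s (by
      rw [e]
      refine le_trans ?_ h1
      gcongr
      exact min_le_left _ _) h2
    refine ⟨?_, ?_⟩
    · exact (((differentiable_Z.analyticAt s).deriv.differentiableAt).div
        (differentiable_Z s) h0).neg.sub (hds s)
    · have hE : ‖dslope Z 1 s‖ ≤ (|M| + 6 * K') * X ^ b := by
        by_cases ht : 1 ≤ |s.im|
        · have hs1 : s ≠ 1 := fun h => by simp [h] at ht; linarith
          rw [dslope_of_ne _ hs1, slope_def_field, Z_one, norm_div]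
          have h4 : X / 3 ≤ ‖s - 1‖ := by
            have := Complex.abs_im_le_norm (s - 1)
            rw [Complex.sub_im, Complex.one_im, sub_zero] at this
            linarith
          rw [div_le_iff₀ (by linarith)]
          have h5 : ‖Z s‖ ≤ K' * (X * X ^ b) := by
            refine (hZ s hre (by linarith)).trans ?_
            rw [← Real.rpow_one_add' hX0.le (by linarith)]
            gcongr
            linarith
          have h6 : ‖Z s - 1‖ ≤ 2 * K' * (X * X ^ b) := by
            refine (norm_sub_le _ _).trans ?_
            rw [norm_one]
            have : 1 ≤ X * X ^ b := one_le_mul_of_one_le_of_one_le hX1 hXb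
            nlinarith
          refine h6.trans ?_
          calc 2 * K' * (X * X ^ b) = 6 * K' * X ^ b * (X / 3) := by ring
            _ ≤ (|M| + 6 * K') * X ^ b * ‖s - 1‖ := by
              gcongr
              linarith [abs_nonneg M]
        · push Not at ht
          refine (hM s ⟨⟨by linarith, h2⟩, abs_le.1 ht.le⟩).trans ((le_abs_self M).trans ?_)
          have : |M| ≤ |M| + 6 * K' := by linarith
          exact this.trans (le_mul_of_one_le_right (by positivity) hXb)
      refine (norm_sub_le _ _).trans ?_
      rw [norm_neg, add_mul]
      rw [e] at hn
      exact add_le_add hn hE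
  · have hs1 : s ≠ 1 := fun h => by simp [h] at hs
    have h1 := hasDerivAt_LFunction (1 : DirichletCharacter ℂ 1) hs
    have hone : ∀ n : ℕ, (1 : DirichletCharacter ℂ 1) n = 1 := fun n =>
      MulChar.one_apply (isUnit_of_subsingleton _)
    rw [DirichletCharacter.LFunction_modOne_eq] at h1
    simp only [hone, one_mul] at h1
    have sΛ : LSeriesSummable (fun n => (ArithmeticFunction.vonMangoldt n : ℂ)) s :=
      ArithmeticFunction.LSeriesSummable_vonMangoldt hs
    have s1 : LSeriesSummable 1 s := LSeriesSummable_one_iff.2 hs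
    have h2 := LSeries_sub sΛ s1
    have h3 : LSeries (fun n => (ArithmeticFunction.vonMangoldt n : ℂ) - 1) s =
      LSeries (fun n => (ArithmeticFunction.vonMangoldt n : ℂ)) s - LSeries 1 s := h2
    beta_reduce
    rw [h3, LSeries_one_eq_riemannZeta hs, dslope_of_ne _ hs1, slope_def_field, Z_one]
    have hz : riemannZeta s ≠ 0 := riemannZeta_ne_zero_of_one_le_re hs.le
    have hZ' : HasDerivAt Z (1 * riemannZeta s + (s - 1) *
        (-(LSeries (fun n => (ArithmeticFunction.vonMangoldt n : ℂ)) s * riemannZeta s))) s := by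
      refine (((hasDerivAt_id s).sub_const 1).mul h1).congr_of_eventuallyEq ?_
      filter_upwards [isOpen_ne.mem_nhds hs1] with z hz
      rw [Z_eq hz]
      simp
    have h9 : s - 1 ≠ 0 := sub_ne_zero.2 hs1
    rw [hZ'.deriv, Z_eq hs1]
    field_simp
    ring

end BDH

namespace BDH
open Set Filter Topology MeasureTheory Complex
open scoped FourierTransform

lemma integrableOn_mul_exp_neg {c : ℝ} (hc : 0 < c) :
    IntegrableOn (fun u : ℝ => u * Real.exp (-c * u)) (Ioi 0) := by
  have := integrableOn_rpow_mul_exp_neg_mul_rpow (p := 1) (s := 1) (b := c) (by norm_num)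
    one_pos hc
  simpa using this

lemma norm_cexp_neg_mul (s : ℂ) (u : ℝ) : ‖cexp (-s * u)‖ = Real.exp (-s.re * u) := by
  rw [Complex.norm_exp]
  simp

lemma integral_mul_cexp_neg {s : ℂ} (hs : 0 < s.re) :
    ∫ u in Ioi (0 : ℝ), (u : ℂ) * cexp (-s * u) = 1 / s ^ 2 := by
  have hs0 : s ≠ 0 := fun h => by simp [h] at hs
  have h_int : IntegrableOn (fun u : ℝ => (u : ℂ) * cexp (-s * u)) (Ioi 0) := by
    refine Integrable.mono' (integrableOn_mul_exp_neg hs) (by fun_prop) ?_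
    filter_upwards [ae_restrict_mem measurableSet_Ioi] with u hu
    rw [norm_mul, norm_cexp_neg_mul, Complex.norm_real, Real.norm_of_nonneg (le_of_lt hu)]
  have hder : ∀ u ∈ Ici (0 : ℝ), HasDerivAt
      (fun u : ℝ => -((u : ℂ) / s + 1 / s ^ 2) * cexp (-s * u)) ((u : ℂ) * cexp (-s * u)) u := by
    intro u _
    have h1 : HasDerivAt (fun u : ℝ => (u : ℂ)) 1 u := Complex.ofRealCLM.hasDerivAt
    have h2 : HasDerivAt (fun u : ℝ => -s * (u : ℂ)) (-s * 1) u := h1.const_mul _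
    have h3 := (((h1.div_const s).add_const (1 / s ^ 2)).neg).mul h2.cexp
    refine h3.congr_deriv ?_
    simp only [Pi.neg_apply]
    field_simp
    ring
  have hlim : Tendsto (fun u : ℝ => -((u : ℂ) / s + 1 / s ^ 2) * cexp (-s * u)) atTop (𝓝 0) := by
    have hb : Tendsto (fun u : ℝ => 1 / ‖s‖ * (u ^ 1 * Real.exp (-s.re * u)) +
        1 / ‖s‖ ^ 2 * (u ^ 0 * Real.exp (-s.re * u))) atTop (𝓝 (1 / ‖s‖ * 0 + 1 / ‖s‖ ^ 2 * 0)) :=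
      Tendsto.add
        (Tendsto.const_mul _ (by
          simpa using tendsto_rpow_mul_exp_neg_mul_atTop_nhds_zero 1 s.re hs))
        (Tendsto.const_mul _ (by
          simpa using tendsto_rpow_mul_exp_neg_mul_atTop_nhds_zero 0 s.re hs))
    simp only [mul_zero, add_zero] at hb
    refine squeeze_zero_norm' ?_ hb
    filter_upwards [eventually_ge_atTop 0] with u hu
    rw [norm_mul, norm_cexp_neg_mul, norm_neg]
    have : ‖(u : ℂ) / s + 1 / s ^ 2‖ ≤ u / ‖s‖ + 1 / ‖s‖ ^ 2 := by
      refine (norm_add_le _ _).trans (le_of_eq ?_)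
      rw [norm_div, norm_div, norm_pow, Complex.norm_real, Real.norm_of_nonneg hu, norm_one]
    calc _ ≤ (u / ‖s‖ + 1 / ‖s‖ ^ 2) * Real.exp (-s.re * u) := by gcongr
      _ = _ := by ring
  rw [integral_Ioi_of_hasDerivAt_of_tendsto' hder h_int hlim]
  simp

lemma integrable_inv_sq_add {c : ℝ} (hc : 0 < c) :
    Integrable (fun t : ℝ => 1 / ((c : ℂ) + t * I) ^ 2) := by
  have hne : ∀ t : ℝ, (c : ℂ) + t * I ≠ 0 := fun t h => by
    have := congrArg Complex.re h
    simp at this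
    linarith
  have h0 : Integrable (fun t : ℝ => (min 1 (c ^ 2))⁻¹ * (1 + t ^ 2)⁻¹) :=
    integrable_inv_one_add_sq.const_mul _
  refine h0.mono' (Continuous.aestronglyMeasurable ?_) (ae_of_all _ fun t => ?_)
  · refine continuous_const.div (by fun_prop) fun t => pow_ne_zero _ (hne t)
  · have h1 : ‖(c : ℂ) + t * I‖ ^ 2 = c ^ 2 + t ^ 2 := by
      rw [Complex.sq_norm, Complex.normSq_add_mul_I]
    rw [norm_div, norm_one, norm_pow, h1, ← mul_inv, one_div]
    have hm : 0 < min 1 (c ^ 2) := lt_min one_pos (by positivity)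
    refine inv_anti₀ (by positivity) ?_
    have h2 : min 1 (c ^ 2) ≤ c ^ 2 := min_le_right _ _
    have h3 : min 1 (c ^ 2) * t ^ 2 ≤ 1 * t ^ 2 := by gcongr; exact min_le_left _ _
    linarith

/-- Perron's formula with the kernel `1 / s ^ 2`. -/
lemma integral_cexp_div_sq {c : ℝ} (hc : 0 < c) (v : ℝ) :
    ∫ t : ℝ, cexp (I * v * t) / ((c : ℂ) + t * I) ^ 2 =
      2 * Real.pi * (max v 0 * Real.exp (-c * v) : ℝ) := by
  set f : ℝ → ℂ := fun u => ((max u 0 * Real.exp (-c * u) : ℝ) : ℂ) with hf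
  have hfi : f = (Ioi (0 : ℝ)).indicator (fun u : ℝ => (u : ℂ) * cexp (-c * u)) := by
    ext u
    by_cases hu : 0 < u
    · simp [hf, hu, max_eq_left hu.le]
    · simp [hf, hu, max_eq_right (not_lt.1 hu)]
  have hcont : Continuous f := by
    simp only [hf]
    fun_prop
  have h_int : Integrable f := by
    rw [hfi, integrable_indicator_iff measurableSet_Ioi]
    refine Integrable.mono' (integrableOn_mul_exp_neg hc) (by fun_prop) ?_
    filter_upwards [ae_restrict_mem measurableSet_Ioi] with u hu
    rw [norm_mul, norm_cexp_neg_mul, Complex.norm_real, Real.norm_of_nonneg (le_of_lt hu),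
      Complex.ofReal_re]
  have hF : 𝓕 f = fun ξ : ℝ => 1 / ((c : ℂ) + ((2 * Real.pi * ξ : ℝ) : ℂ) * I) ^ 2 := by
    ext ξ
    rw [Real.fourier_real_eq_integral_exp_smul,
      ← integral_mul_cexp_neg (s := (c : ℂ) + ((2 * Real.pi * ξ : ℝ) : ℂ) * I) (by simp [hc]),
      ← integral_indicator measurableSet_Ioi]
    congr 1
    ext u
    rw [hfi]
    by_cases hu : 0 < u
    · have hu' : u ∈ Set.Ioi (0 : ℝ) := hu
      rw [indicator_of_mem hu', indicator_of_mem hu', smul_eq_mul, mul_left_comm, ← Complex.exp_add]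
      congr 2
      push_cast
      ring
    · have hu' : u ∉ Set.Ioi (0 : ℝ) := hu
      rw [indicator_of_notMem hu', indicator_of_notMem hu', smul_zero]
  have hFi : Integrable (𝓕 f) := by
    rw [hF]
    exact (integrable_inv_sq_add hc).comp_mul_left' (R := 2 * Real.pi) (by positivity)
  have hinv := congrFun (hcont.fourierInv_fourier_eq h_int hFi) v
  rw [Real.fourierInv_eq', hF] at hinv
  have hchg := Measure.integral_comp_mul_left
    (fun t : ℝ => cexp (I * v * t) / ((c : ℂ) + t * I) ^ 2) (2 * Real.pi)
  have h2 : ∫ ξ : ℝ, cexp (I * v * ((2 * Real.pi * ξ : ℝ) : ℂ)) /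
      ((c : ℂ) + ((2 * Real.pi * ξ : ℝ) : ℂ) * I) ^ 2 = f v := by
    rw [← hinv]
    congr 1
    ext ξ
    rw [smul_eq_mul, mul_one_div]
    congr 2
    simp
    ring
  rw [h2, abs_of_pos (by positivity)] at hchg
  have : (∫ t : ℝ, cexp (I * v * t) / ((c : ℂ) + t * I) ^ 2) = (2 * Real.pi : ℝ) • f v := by
    rw [hchg, smul_smul, mul_inv_cancel₀ (by positivity), one_smul]
  rw [this, hf]
  simp

end BDH

namespace BDH
open Set Filter Topology MeasureTheory Complex

lemma norm_integral_mul_cexp_mul_pow (f : ℕ → ℝ → ℂ) (k : ℕ) (u : ℝ)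
    (hf : ∀ j < k, ∀ t, HasDerivAt (f j) (I * f (j + 1) t) t)
    (hi : ∀ j ≤ k, Integrable (f j)) :
    |u| ^ k * ‖∫ t : ℝ, f 0 t * cexp (I * u * t)‖ ≤ ∫ t : ℝ, ‖f k t‖ := by
  have hn : ∀ t : ℝ, ‖cexp (I * u * t)‖ = 1 := fun t => by
    rw [mul_assoc, mul_comm, ← Complex.ofReal_mul, Complex.norm_exp_ofReal_mul_I]
  have hie : ∀ g : ℝ → ℂ, Integrable g → Integrable fun t : ℝ => g t * cexp (I * u * t) := by
    intro g hg
    refine hg.mono (hg.1.mul (by fun_prop)) (ae_of_all _ fun t => ?_)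
    rw [norm_mul, hn, mul_one]
  have key : ∀ j ≤ k, |u| ^ j * ‖∫ t : ℝ, f 0 t * cexp (I * u * t)‖ =
      ‖∫ t : ℝ, f j t * cexp (I * u * t)‖ := by
    intro j
    induction j with
    | zero => intro _; simp
    | succ j ih =>
      intro hj
      have hder : ∀ t : ℝ, HasDerivAt (fun t : ℝ => cexp (I * u * t)) (I * u * cexp (I * u * t)) t := by
        intro t
        have h1 : HasDerivAt (fun t : ℝ => (t : ℂ)) 1 t := Complex.ofRealCLM.hasDerivAt
        refine ((h1.const_mul (I * u)).cexp).congr_deriv ?_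
        ring
      have := integral_mul_deriv_eq_deriv_mul_of_integrable (u := f j)
        (v := fun t : ℝ => cexp (I * u * t)) (u' := fun t => I * f (j + 1) t)
        (v' := fun t : ℝ => I * u * cexp (I * u * t)) (fun t _ => hf j (by lia) t)
        (fun t _ => hder t)
        (by
          have := (hie _ (hi j (by lia))).const_mul (I * u)
          refine this.congr (ae_of_all _ fun t => ?_)
          simp only [Pi.mul_apply]
          ring)
        (by
          have := (hie _ (hi (j + 1) hj)).const_mul I
          refine this.congr (ae_of_all _ fun t => ?_)
          simp only [Pi.mul_apply]
          ring)
        (hie _ (hi j (by lia)))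
      have e1 : ∫ t : ℝ, f j t * (I * u * cexp (I * u * t)) =
          I * u * ∫ t : ℝ, f j t * cexp (I * u * t) := by
        rw [← integral_const_mul]
        congr 1; ext t; ring
      have e2 : ∫ t : ℝ, I * f (j + 1) t * cexp (I * u * t) =
          I * ∫ t : ℝ, f (j + 1) t * cexp (I * u * t) := by
        rw [← integral_const_mul]
        congr 1; ext t; ring
      rw [e1, e2] at this
      have h := congrArg norm this
      rw [norm_neg, norm_mul, norm_mul, norm_mul, norm_I, one_mul, one_mul, Complex.norm_real,
        Real.norm_eq_abs] at h
      rw [pow_succ', mul_assoc, ih (by lia), h]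
  rw [key k le_rfl]
  refine (norm_integral_le_integral_norm _).trans (le_of_eq ?_)
  congr 1; ext t
  rw [norm_mul, hn, mul_one]

lemma norm_iteratedDeriv_div_sq_le {b ρ K : ℝ} (hρ : 0 < ρ) (hρ1 : ρ ≤ 1 / 4) (hb : 0 < b)
    (hb1 : b ≤ 1) (hK : 0 ≤ K) {q : ℕ} (hq : q ≠ 0) {G : ℂ → ℂ}
    (hG : ∀ s : ℂ, 1 - ρ * cond q s ^ (-b) ≤ s.re → s.re ≤ 2 →
      DifferentiableAt ℂ G s ∧ ‖G s‖ ≤ K * cond q s ^ b)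
    {s : ℂ} (hs : 1 ≤ s.re) (hs2 : s.re ≤ 3 / 2) (j : ℕ) :
    AnalyticAt ℂ (fun z => G z / z ^ 2) s ∧
    ‖iteratedDeriv j (fun z => G z / z ^ 2) s‖ ≤
      j.factorial * (4 * K * (4 / ρ) ^ j) * (cond q s ^ (b * (j + 1)) / ‖s‖ ^ 2) := by
  have : NeZero q := ⟨hq⟩
  have hX := two_le_cond (q := q) s
  set X := cond q s with hXd
  have hX0 : 0 < X := by linarith
  set r := ρ / 4 * X ^ (-b) with hr
  have hXb : X ^ (-b) ≤ 1 := Real.rpow_le_one_of_one_le_of_nonpos (by linarith) (by linarith)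
  have hXb0 : 0 < X ^ (-b) := by positivity
  have hr0 : 0 < r := by positivity
  have hr1 : r ≤ 1 / 4 := by nlinarith
  have hs1 : 1 ≤ ‖s‖ := hs.trans ((le_abs_self _).trans (Complex.abs_re_le_norm s))
  have hball : ∀ z, ‖z - s‖ ≤ r →
      (DifferentiableAt ℂ G z ∧ ‖G z‖ ≤ 2 * K * X ^ b) ∧ 3 / 4 * ‖s‖ ≤ ‖z‖ := by
    intro z hz
    have hc : cond q z ≤ 2 * X := cond_le_two_mul (by linarith)
    have hc0 : 0 < cond q z := by have := two_le_cond (q := q) z; linarith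
    have hre : |z.re - s.re| ≤ r := by
      rw [← Complex.sub_re]; exact (Complex.abs_re_le_norm _).trans hz
    obtain ⟨hre1, hre2⟩ := abs_le.1 hre
    have h2b : (2 : ℝ) ^ b ≤ 2 := by
      calc (2 : ℝ) ^ b ≤ 2 ^ (1 : ℝ) := Real.rpow_le_rpow_of_exponent_le (by norm_num) hb1
        _ = 2 := by simp
    have h1 : X ^ (-b) / 2 ≤ cond q z ^ (-b) := by
      calc X ^ (-b) / 2 ≤ X ^ (-b) / 2 ^ b := by gcongr
        _ = (2 * X) ^ (-b) := by
          rw [Real.mul_rpow (by norm_num) hX0.le, Real.rpow_neg (by norm_num : (0 : ℝ) ≤ 2) b]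
          field_simp
        _ ≤ cond q z ^ (-b) := Real.rpow_le_rpow_of_nonpos hc0 hc (by linarith)
    have hρ2 : ρ * (X ^ (-b) / 2) ≤ ρ * cond q z ^ (-b) := by gcongr
    obtain ⟨h3, h4⟩ := hG z (by nlinarith) (by linarith)
    refine ⟨⟨h3, h4.trans ?_⟩, ?_⟩
    · calc K * cond q z ^ b ≤ K * (2 * X) ^ b := by gcongr
        _ = K * (2 ^ b * X ^ b) := by rw [Real.mul_rpow (by norm_num) hX0.le]
        _ ≤ K * (2 * X ^ b) := by gcongr
        _ = _ := by ring
    · have := norm_sub_norm_le s z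
      rw [norm_sub_rev] at this
      linarith
  have hdiff : DifferentiableOn ℂ (fun z => G z / z ^ 2) (Metric.closedBall s r) := by
    intro z hz
    rw [Metric.mem_closedBall, dist_eq_norm] at hz
    obtain ⟨⟨h1, _⟩, h2⟩ := hball z hz
    refine (h1.div (by fun_prop : DifferentiableAt ℂ (fun z : ℂ => z ^ 2) z) (pow_ne_zero _ fun h => ?_)).differentiableWithinAt
    rw [h, norm_zero] at h2
    linarith
  constructor
  · exact hdiff.analyticAt (Metric.closedBall_mem_nhds s hr0)
  have hcauchy := Complex.norm_iteratedDeriv_le_of_forall_mem_sphere_norm_le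
    (f := fun z => G z / z ^ 2) (c := s) (C := 4 * K * X ^ b / ‖s‖ ^ 2) j hr0 (by
      refine DifferentiableOn.diffContOnCl ?_
      rw [closure_ball s hr0.ne']
      exact hdiff) (by
      intro z hz
      rw [mem_sphere_iff_norm] at hz
      obtain ⟨⟨_, h1⟩, h2⟩ := hball z hz.le
      have hs0 : 0 < ‖s‖ := by linarith
      have h3 : (3 / 4 * ‖s‖) ^ 2 ≤ ‖z‖ ^ 2 := by gcongr
      rw [norm_div, norm_pow, div_le_div_iff₀ (by nlinarith) (by positivity)]
      have hKX : 0 ≤ K * X ^ b := by positivity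
      calc ‖G z‖ * ‖s‖ ^ 2 ≤ 2 * K * X ^ b * ‖s‖ ^ 2 := by gcongr
        _ ≤ 4 * K * X ^ b * ‖z‖ ^ 2 := by nlinarith [mul_le_mul_of_nonneg_left h3 hKX, sq_nonneg ‖s‖, mul_nonneg hKX (sq_nonneg ‖s‖)])
  refine hcauchy.trans (le_of_eq ?_)
  have e1 : X ^ (b * (j + 1)) = X ^ b * ((X ^ (-b)) ^ j)⁻¹ := by
    rw [← Real.rpow_natCast, ← Real.rpow_mul hX0.le, ← Real.rpow_neg hX0.le, ← Real.rpow_add hX0]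
    congr 1; ring
  rw [e1, hr, mul_pow, div_pow, div_pow]
  field_simp

end BDH

namespace BDH
open Set Filter Topology MeasureTheory Complex

lemma integrable_one_add_sq_rpow : Integrable (fun t : ℝ => (1 + t ^ 2) ^ (-(3 / 4) : ℝ)) := by
  have := integrable_rpow_neg_one_add_norm_sq (E := ℝ) (μ := volume) (r := 3 / 2) (by simp; norm_num)
  refine this.congr (ae_of_all _ fun t => ?_)
  simp only [Real.norm_eq_abs, sq_abs]
  norm_num

lemma cond_rpow_div_sq_le {q : ℕ} (hq : q ≠ 0) {β c : ℝ} (hβ : β ≤ 1 / 2) (hc : 1 ≤ c) (t : ℝ) :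
    cond q (c + t * I) ^ β / ‖(c : ℂ) + t * I‖ ^ 2 ≤
      2 * Real.sqrt q * (1 + t ^ 2) ^ (-(3 / 4) : ℝ) := by
  have : NeZero q := ⟨hq⟩
  have hX := two_le_cond (q := q) (c + t * I)
  have h1 : ‖(c : ℂ) + t * I‖ ^ 2 = c ^ 2 + t ^ 2 := by
    rw [Complex.sq_norm, Complex.normSq_add_mul_I]
  have h2 : cond q (c + t * I) ^ β ≤ cond q (c + t * I) ^ (1 / 2 : ℝ) :=
    Real.rpow_le_rpow_of_exponent_le (by linarith) hβ
  have h3 : cond q (c + t * I) ^ (1 / 2 : ℝ) = Real.sqrt q * Real.sqrt (|t| + 2) := by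
    rw [← Real.sqrt_eq_rpow, ← Real.sqrt_mul (by positivity)]
    simp [cond]
  have h4 : Real.sqrt (|t| + 2) ≤ 2 * (1 + t ^ 2) ^ (1 / 4 : ℝ) := by
    refine Real.sqrt_le_iff.2 ⟨by positivity, ?_⟩
    have e : ((1 + t ^ 2) ^ (1 / 4 : ℝ)) ^ 2 = Real.sqrt (1 + t ^ 2) := by
      rw [← Real.rpow_natCast, ← Real.rpow_mul (by positivity), Real.sqrt_eq_rpow]
      norm_num
    rw [mul_pow, e]
    have h5 : (|t| + 2) / 4 ≤ Real.sqrt (1 + t ^ 2) := by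
      refine Real.le_sqrt_of_sq_le ?_
      nlinarith [sq_abs t, abs_nonneg t, sq_nonneg (|t| - 2)]
    linarith
  have h0 : (0 : ℝ) < 1 + t ^ 2 := by positivity
  calc cond q (c + t * I) ^ β / ‖(c : ℂ) + t * I‖ ^ 2
      ≤ (Real.sqrt q * (2 * (1 + t ^ 2) ^ (1 / 4 : ℝ))) / (1 + t ^ 2) := by
        rw [h1]
        have : 1 + t ^ 2 ≤ c ^ 2 + t ^ 2 := by nlinarith
        have h6 : cond q (c + t * I) ^ β ≤ Real.sqrt q * (2 * (1 + t ^ 2) ^ (1 / 4 : ℝ)) := by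
          rw [h3] at h2
          refine h2.trans ?_
          gcongr
        gcongr
    _ = _ := by
      have : (1 + t ^ 2) ^ (-(3 / 4) : ℝ) = (1 + t ^ 2) ^ (1 / 4 : ℝ) / (1 + t ^ 2) := by
        rw [← Real.rpow_sub_one h0.ne']
        norm_num
      rw [this]
      ring

lemma hasSum_mul_max_log {a : ℕ → ℂ} {c : ℝ} (hc : 0 < c) (hs : LSeriesSummable a c) (u : ℝ) :
    HasSum (fun n : ℕ => if n = 0 then 0 else
        2 * Real.pi * Real.exp (-c * u) * (a n * (max (u - Real.log n) 0 : ℝ)))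
      (∫ t : ℝ, LSeries a (c + t * I) / (c + t * I) ^ 2 * cexp (I * u * t)) := by
  set F : ℕ → ℝ → ℂ := fun n t =>
    LSeries.term a (c + t * I) n / (c + t * I) ^ 2 * cexp (I * u * t) with hF
  have hn : ∀ t : ℝ, ‖cexp (I * u * t)‖ = 1 := fun t => by
    rw [mul_assoc, mul_comm, ← Complex.ofReal_mul, Complex.norm_exp_ofReal_mul_I]
  have hform : ∀ n t, n ≠ 0 → F n t = LSeries.term a c n *
      (cexp (I * ((u - Real.log n : ℝ) : ℂ) * t) / ((c : ℂ) + t * I) ^ 2) := by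
    intro n t h0
    have hn0 : (n : ℂ) ≠ 0 := Nat.cast_ne_zero.2 h0
    simp only [hF]
    rw [LSeries.term_of_ne_zero h0, LSeries.term_of_ne_zero h0, Complex.cpow_add _ _ hn0]
    have e : (n : ℂ) ^ ((t : ℂ) * I) = cexp (Real.log n * (t * I)) := by
      rw [Complex.cpow_def_of_ne_zero hn0, Complex.natCast_log]
    have e2 : cexp (I * ((u - Real.log n : ℝ) : ℂ) * t) =
        cexp (I * u * t) / cexp (Real.log n * (t * I)) := by
      rw [← Complex.exp_sub]
      congr 1
      push_cast
      ring
    rw [e, e2]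
    ring
  have hI : ∀ (n : ℕ) , Integrable (F n) ∧
      ∫ t, ‖F n t‖ = ‖LSeries.term a c n‖ * ∫ t : ℝ, ‖1 / ((c : ℂ) + t * I) ^ 2‖ := by
    intro n
    by_cases h0 : n = 0
    · have : F n = fun _ => 0 := by
        ext t; simp [hF, h0]
      rw [this]
      simp [h0]
    have hnorm : ∀ t, ‖F n t‖ = ‖LSeries.term a c n‖ * ‖1 / ((c : ℂ) + t * I) ^ 2‖ := by
      intro t
      rw [hform n t h0, norm_mul, norm_div, norm_div, norm_one]
      congr 2
      rw [mul_assoc, mul_comm, ← Complex.ofReal_mul, Complex.norm_exp_ofReal_mul_I]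
    constructor
    · have hb := (integrable_inv_sq_add hc).norm.const_mul ‖LSeries.term a c n‖
      have hfun : F n = fun t : ℝ => LSeries.term a c n *
        (cexp (I * ((u - Real.log n : ℝ) : ℂ) * t) * (1 / ((c : ℂ) + t * I) ^ 2)) := by
        ext t
        rw [hform n t h0, mul_one_div]
      refine hb.mono' ?_ (ae_of_all _ fun t => (hnorm t).le)
      rw [hfun]
      refine (AEStronglyMeasurable.mul (by fun_prop) (integrable_inv_sq_add hc).1).const_mul _
    · simp_rw [hnorm]
      exact integral_const_mul _ _
  have hsum := hasSum_integral_of_summable_integral_norm (fun n => (hI n).1)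
    (by
      simp_rw [(hI _).2]
      exact hs.norm.mul_right _)
  convert! hsum using 1
  · ext n
    by_cases h0 : n = 0
    · simp [h0, hF]
    rw [if_neg h0]
    simp_rw [hform n _ h0]
    rw [integral_const_mul, integral_cexp_div_sq hc, LSeries.term_of_ne_zero h0]
    have hn0 : (0 : ℝ) < n := Nat.cast_pos.2 (Nat.pos_of_ne_zero h0)
    have e : ((n : ℂ) ^ (c : ℂ)) = (Real.exp (c * Real.log n) : ℝ) := by
      rw [Complex.cpow_def_of_ne_zero (Nat.cast_ne_zero.2 h0), ← Complex.natCast_log]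
      push_cast
      ring_nf
    have e2 : Real.exp (-c * (u - Real.log n)) = Real.exp (-c * u) * Real.exp (c * Real.log n) := by
      rw [← Real.exp_add]
      ring_nf
    rw [e, e2]
    have : ((Real.exp (c * Real.log n) : ℝ) : ℂ) ≠ 0 :=
      Complex.ofReal_ne_zero.2 (Real.exp_pos _).ne'
    push_cast at this ⊢
    field_simp
  · congr 1
    ext t
    simp only [hF]
    rw [tsum_mul_right, tsum_div_const]
    rfl

end BDH

namespace BDH
open Set Filter Topology MeasureTheory Complex

lemma HasExtension.mono {b ρ ρ' K : ℝ} {q : ℕ} {a : ℕ → ℂ} (h : HasExtension b ρ K q a)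
    (hρ : ρ' ≤ ρ) : HasExtension b ρ' K q a := by
  obtain ⟨G, h1, h2⟩ := h
  refine ⟨G, fun s hs hs2 => h1 s (le_trans ?_ hs) hs2, h2⟩
  have : 0 ≤ cond q s ^ (-b) := Real.rpow_nonneg (by unfold cond; positivity) _
  nlinarith

lemma sum_log_eq_integral {a : ℕ → ℂ} {c x : ℝ} (hc : 0 < c) (hx : 0 < x)
    (hs : LSeriesSummable a c) :
    2 * Real.pi * Real.exp (-c * Real.log x) *
        ∑ n ∈ Finset.Icc 1 ⌊x⌋₊, a n * (Real.log (x / n) : ℝ) =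
      ∫ t : ℝ, LSeries a (c + t * I) / (c + t * I) ^ 2 * cexp (I * Real.log x * t) := by
  have h := hasSum_mul_max_log hc hs (Real.log x)
  rw [← h.tsum_eq, tsum_eq_sum (s := Finset.Icc 1 ⌊x⌋₊), Finset.mul_sum]
  · refine Finset.sum_congr rfl fun n hn => ?_
    obtain ⟨h1, h2⟩ := Finset.mem_Icc.1 hn
    have hn0 : (0 : ℝ) < n := by exact_mod_cast h1
    have hnx : (n : ℝ) ≤ x := (Nat.le_floor_iff hx.le).1 h2
    rw [if_neg (by lia), Real.log_div hx.ne' hn0.ne', max_eq_left]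
    exact sub_nonneg.2 (Real.log_le_log hn0 hnx)
  · intro n hn
    by_cases h0 : n = 0
    · simp [h0]
    have hnx : x < n := by
      by_contra! h
      exact hn (Finset.mem_Icc.2 ⟨Nat.one_le_iff_ne_zero.2 h0, Nat.le_floor h⟩)
    rw [if_neg h0, max_eq_right (sub_nonpos.2 (Real.log_le_log hx hnx.le))]
    simp

lemma norm_sum_log_le {b ρ K : ℝ} (hb : 0 < b) (hρ : 0 < ρ) (hρ1 : ρ ≤ 1 / 4) (hK : 0 ≤ K) (k : ℕ)
    (hbk : b * (k + 1) ≤ 1 / 2) :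
    ∃ C, 0 ≤ C ∧ ∀ q : ℕ, q ≠ 0 → ∀ a : ℕ → ℂ, HasExtension b ρ K q a →
      (∀ c : ℝ, 1 < c → LSeriesSummable a c) → ∀ x : ℝ, 0 < x → 2 ≤ Real.log x →
      Real.log x ^ k * ‖∑ n ∈ Finset.Icc 1 ⌊x⌋₊, a n * (Real.log (x / n) : ℝ)‖ ≤
        C * Real.sqrt q * x := by
  set J := ∫ t : ℝ, (1 + t ^ 2) ^ (-(3 / 4) : ℝ)
  have hJ : 0 ≤ J := integral_nonneg fun t => by positivity
  refine ⟨Real.exp 1 * (k.factorial * (4 * K * (4 / ρ) ^ k) * 2 * J), by positivity, ?_⟩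
  intro q hq a ⟨G, hG, hGa⟩ hs x hx hlx
  set u := Real.log x with hu
  set c := 1 + 1 / u with hcd
  have hu0 : 0 < u := by linarith
  have hc : 1 < c := by
    have : 0 < 1 / u := by positivity
    linarith
  have hc2 : c ≤ 3 / 2 := by
    have : 1 / u ≤ 1 / 2 := one_div_le_one_div_of_le (by norm_num) hlx
    linarith
  have hre : ∀ t : ℝ, ((c : ℂ) + t * I).re = c := fun t => by simp
  set H : ℂ → ℂ := fun z => G z / z ^ 2 with hH
  set f : ℕ → ℝ → ℂ := fun j t => iteratedDeriv j H (c + t * I) with hf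
  have hb1 : b ≤ 1 := by nlinarith [(Nat.cast_nonneg k : (0 : ℝ) ≤ k)]
  have hbd := fun (t : ℝ) (j : ℕ) => norm_iteratedDeriv_div_sq_le hρ hρ1 hb hb1 hK hq hG
    (s := c + t * I) (by rw [hre]; exact hc.le) (by rw [hre]; exact hc2) j
  have hfder : ∀ j t, HasDerivAt (f j) (I * f (j + 1) t) t := by
    intro j t
    have han : AnalyticAt ℂ (iteratedDeriv j H) (c + t * I) := by
      rw [iteratedDeriv_eq_iterate]
      exact (hbd t 0).1.iterated_deriv j
    have h1 := han.differentiableAt.hasDerivAt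
    rw [← iteratedDeriv_succ] at h1
    have h2 : HasDerivAt (fun t : ℝ => (c : ℂ) + t * I) I t := by
      have h3 : HasDerivAt (fun u : ℝ => (u : ℂ)) 1 t := Complex.ofRealCLM.hasDerivAt
      simpa using (h3.mul_const I).const_add (c : ℂ)
    rw [mul_comm]
    exact HasDerivAt.comp t h1 h2
  have hfb : ∀ j ≤ k, ∀ t, ‖f j t‖ ≤ (j.factorial * (4 * K * (4 / ρ) ^ j) * (2 * Real.sqrt q)) *
      (1 + t ^ 2) ^ (-(3 / 4) : ℝ) := by
    intro j hj t
    refine (hbd t j).2.trans ?_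
    have := cond_rpow_div_sq_le hq (β := b * (j + 1)) (c := c) (by
      have : (j : ℝ) ≤ k := by exact_mod_cast hj
      nlinarith) hc.le t
    rw [mul_assoc _ (2 * Real.sqrt q)]
    gcongr
  have hfi : ∀ j ≤ k, Integrable (f j) := by
    intro j hj
    refine (integrable_one_add_sq_rpow.const_mul _).mono' ?_ (ae_of_all _ (hfb j hj))
    exact (continuous_iff_continuousAt.2 fun t => (hfder j t).continuousAt).aestronglyMeasurable
  have h1 := norm_integral_mul_cexp_mul_pow f k u (fun j _ => hfder j) hfi
  have h2 : ∫ t, ‖f k t‖ ≤ (k.factorial * (4 * K * (4 / ρ) ^ k) * (2 * Real.sqrt q)) * J := by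
    rw [← integral_const_mul]
    exact integral_mono (hfi k le_rfl).norm (integrable_one_add_sq_rpow.const_mul _) (hfb k le_rfl)
  have h3 := sum_log_eq_integral (zero_lt_one.trans hc) hx (hs c hc)
  have h4 : ∫ t : ℝ, LSeries a (c + t * I) / (c + t * I) ^ 2 * cexp (I * Real.log x * t) =
      ∫ t : ℝ, f 0 t * cexp (I * u * t) := by
    congr 1
    ext t
    simp only [hf, iteratedDeriv_zero, hH]
    rw [hGa _ (by rw [hre]; exact hc)]
  rw [← h4, ← h3, norm_mul, norm_mul, norm_mul] at h1
  have hcu : c * u = u + 1 := by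
    rw [hcd]; field_simp
  have hexp : Real.exp (-c * Real.log x) = (Real.exp 1 * x)⁻¹ := by
    rw [← hu, neg_mul, Real.exp_neg, hcu, Real.exp_add, hu, Real.exp_log hx, mul_comm]
  rw [hexp, Complex.norm_real, Complex.norm_real, Real.norm_of_nonneg (by positivity),
    Real.norm_of_nonneg (by positivity), abs_of_pos hu0, norm_ofNat] at h1
  have hpi : 1 ≤ 2 * Real.pi := by have := Real.pi_gt_three; linarith
  set S := ‖∑ n ∈ Finset.Icc 1 ⌊x⌋₊, a n * (Real.log (x / n) : ℝ)‖
  have hS : 0 ≤ S := norm_nonneg _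
  have hx1 : 0 < Real.exp 1 * x := by positivity
  calc u ^ k * S = (Real.exp 1 * x) * (u ^ k * (1 * (Real.exp 1 * x)⁻¹ * S)) := by
        field_simp
    _ ≤ (Real.exp 1 * x) * (u ^ k * (2 * Real.pi * (Real.exp 1 * x)⁻¹ * S)) := by gcongr
    _ ≤ (Real.exp 1 * x) * ((k.factorial * (4 * K * (4 / ρ) ^ k) * (2 * Real.sqrt q)) * J) := by
        exact mul_le_mul_of_nonneg_left (h1.trans h2) hx1.le
    _ = _ := by ring

end BDH

namespace BDH
open Set Filter Topology MeasureTheory Complex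

/-- Removing the logarithmic weight from a smoothed sum. -/
lemma norm_sum_le_of_norm_sum_log_le (B : ℕ) {C M : ℝ} (hM : 1 ≤ M) (hC : 0 ≤ C) {a : ℕ → ℂ}
    (ha : ∀ n : ℕ, 1 ≤ n → ‖a n‖ ≤ 1 + Real.log n)
    (hW : ∀ x : ℝ, 0 < x → 2 ≤ Real.log x → Real.log x ^ (2 * B + 1) *
      ‖∑ n ∈ Finset.Icc 1 ⌊x⌋₊, a n * (Real.log (x / n) : ℝ)‖ ≤ C * M * x)
    {x : ℝ} (hx : 0 < x) (hlx : 2 ≤ Real.log x) :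
    Real.log x ^ B * ‖∑ n ∈ Finset.Icc 1 ⌊x⌋₊, a n‖ ≤
      (4 * C + 4 + 2 * (B + 1).factorial) * M * x := by
  set L := Real.log x with hL
  have hL0 : 0 < L := by linarith
  set h := (L ^ (B + 1))⁻¹ with hh
  have hLB : 1 ≤ L ^ (B + 1) := one_le_pow₀ (by linarith)
  have hh0 : 0 < h := by positivity
  have hh1 : h ≤ 1 := inv_le_one_of_one_le₀ hLB
  set y := x * Real.exp h with hy
  have hy0 : 0 < y := by positivity
  have hey : Real.exp h ≤ 1 + 2 * h := by
    have := Real.abs_exp_sub_one_le (x := h) (by rwa [abs_of_pos hh0])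
    rw [abs_of_pos hh0] at this
    linarith [le_abs_self (Real.exp h - 1)]
  have hyx : y ≤ x + 2 * h * x := by
    calc y ≤ x * (1 + 2 * h) := by rw [hy]; gcongr
      _ = _ := by ring
  have hxy : x ≤ y := by
    rw [hy]
    exact le_mul_of_one_le_right hx.le (Real.one_le_exp hh0.le)
  have hly : Real.log y = L + h := by
    rw [hy, Real.log_mul hx.ne' (Real.exp_pos _).ne', Real.log_exp]
  have hfl : ⌊x⌋₊ ≤ ⌊y⌋₊ := Nat.floor_mono hxy
  set W : ℝ → ℂ := fun x => ∑ n ∈ Finset.Icc 1 ⌊x⌋₊, a n * (Real.log (x / n) : ℝ) with hWd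
  set S := ∑ n ∈ Finset.Icc 1 ⌊x⌋₊, a n with hS
  set R := ∑ n ∈ Finset.Ioc ⌊x⌋₊ ⌊y⌋₊, a n * (Real.log (y / n) : ℝ) with hR
  have hsplit : W y = W x + h * S + R := by
    have e0 : ∀ m : ℕ, Finset.Icc 1 m = Finset.Ioc 0 m := fun m => by
      ext; simp [Nat.lt_iff_add_one_le]
    simp only [hWd, hS, hR, e0]
    rw [← Finset.sum_Ioc_consecutive _ (Nat.zero_le _) hfl, Finset.mul_sum, ← Finset.sum_add_distrib]
    congr 1
    refine Finset.sum_congr rfl fun n hn => ?_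
    have hn0 : (0 : ℝ) < n := by exact_mod_cast (Finset.mem_Ioc.1 hn).1
    rw [Real.log_div hy0.ne' hn0.ne', Real.log_div hx.ne' hn0.ne', hly]
    push_cast
    ring
  have hRb : ‖R‖ ≤ (2 * h * x + 1) * ((2 * L) * h) := by
    have hterm : ∀ n ∈ Finset.Ioc ⌊x⌋₊ ⌊y⌋₊, ‖a n * (Real.log (y / n) : ℝ)‖ ≤ (2 * L) * h := by
      intro n hn
      obtain ⟨h1, h2⟩ := Finset.mem_Ioc.1 hn
      have hxn : x < n := (Nat.floor_lt hx.le).1 h1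
      have hn0 : (0 : ℝ) < n := hx.trans hxn
      have hny : (n : ℝ) ≤ y := (Nat.le_floor_iff hy0.le).1 h2
      have hl0 : 0 ≤ Real.log (y / n) := Real.log_nonneg ((one_le_div hn0).2 hny)
      have hl1 : Real.log (y / n) ≤ h := by
        rw [Real.log_div hy0.ne' hn0.ne', hly]
        have := Real.log_le_log hx hxn.le
        linarith
      have hl2 : Real.log n ≤ L + h := hly ▸ Real.log_le_log hn0 hny
      rw [norm_mul, Complex.norm_real, Real.norm_of_nonneg hl0]
      have := ha n (by lia)
      gcongr
      linarith
    refine (norm_sum_le_of_le _ hterm).trans ?_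
    rw [Finset.sum_const, Nat.card_Ioc, nsmul_eq_mul, Nat.cast_sub hfl]
    have h1 := Nat.floor_le hy0.le
    have h2 := Nat.lt_floor_add_one x
    gcongr
    linarith
  have hWx : ‖W x‖ ≤ C * M * x / L ^ (2 * B + 1) := by
    rw [le_div_iff₀' (by positivity)]
    exact hW x hx hlx
  have hWy : ‖W y‖ ≤ C * M * (3 * x) / L ^ (2 * B + 1) := by
    rw [le_div_iff₀' (by positivity)]
    calc L ^ (2 * B + 1) * ‖W y‖ ≤ Real.log y ^ (2 * B + 1) * ‖W y‖ := by
          gcongr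
          linarith
      _ ≤ C * M * y := hW y hy0 (by linarith)
      _ ≤ _ := by
          gcongr
          nlinarith
  have hS' : h * ‖S‖ ≤ C * M * (4 * x) / L ^ (2 * B + 1) + (2 * h * x + 1) * ((2 * L) * h) := by
    have e : (h : ℂ) * S = W y - W x - R := by rw [hsplit]; ring
    have e2 : h * ‖S‖ = ‖(h : ℂ) * S‖ := by
      rw [norm_mul, Complex.norm_real, Real.norm_of_nonneg hh0.le]
    rw [e2, e]
    calc ‖W y - W x - R‖ ≤ ‖W y‖ + ‖W x‖ + ‖R‖ :=
          (norm_sub_le _ _).trans (by gcongr; exact norm_sub_le _ _)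
      _ ≤ C * M * (3 * x) / L ^ (2 * B + 1) + C * M * x / L ^ (2 * B + 1) +
          (2 * h * x + 1) * ((2 * L) * h) := by gcongr
      _ = _ := by ring
  have hfac : L ^ (B + 1) ≤ (B + 1).factorial * x := by
    have := Real.pow_div_factorial_le_exp L hL0.le (B + 1)
    rw [hL, Real.exp_log hx, ← hL, div_le_iff₀' (by positivity)] at this
    exact this
  calc L ^ B * ‖S‖ = L ^ (2 * B + 1) * (h * ‖S‖) := by
        rw [hh]
        field_simp
        ring
    _ ≤ L ^ (2 * B + 1) * (C * M * (4 * x) / L ^ (2 * B + 1) + (2 * h * x + 1) * ((2 * L) * h)) := by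
        gcongr
    _ = 4 * C * M * x + 4 * x + 2 * L ^ (B + 1) := by
        rw [hh]
        field_simp
        ring
    _ ≤ 4 * C * M * x + 4 * x + 2 * ((B + 1).factorial * x) := by gcongr
    _ = 4 * C * M * x + (4 + 2 * (B + 1).factorial) * x * 1 := by ring
    _ ≤ 4 * C * M * x + (4 + 2 * (B + 1).factorial) * x * M := by gcongr
    _ = _ := by ring

/-- Trivial bound used for small `x`. -/
lemma norm_sum_le_of_log_lt (B : ℕ) {M : ℝ} (hM : 1 ≤ M) {a : ℕ → ℂ}
    (ha : ∀ n : ℕ, 1 ≤ n → ‖a n‖ ≤ 1 + Real.log n) {x : ℝ} (hx : 1 ≤ x) (hlx : Real.log x < 2) :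
    Real.log x ^ B * ‖∑ n ∈ Finset.Icc 1 ⌊x⌋₊, a n‖ ≤ 3 * 2 ^ B * M * x := by
  have h0 : 0 ≤ Real.log x := Real.log_nonneg hx
  have h1 : ‖∑ n ∈ Finset.Icc 1 ⌊x⌋₊, a n‖ ≤ x * 3 := by
    refine (norm_sum_le_of_le (f := a) (n := fun _ => 3) _ fun n hn => ?_).trans ?_
    · obtain ⟨h1, h2⟩ := Finset.mem_Icc.1 hn
      have : Real.log n ≤ Real.log x := Real.log_le_log (by exact_mod_cast h1)
        ((Nat.le_floor_iff (by linarith)).1 h2)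
      linarith [ha n h1]
    · rw [Finset.sum_const, Nat.card_Icc, nsmul_eq_mul]
      gcongr
      simpa using Nat.floor_le (by linarith : 0 ≤ x)
  calc Real.log x ^ B * ‖∑ n ∈ Finset.Icc 1 ⌊x⌋₊, a n‖ ≤ 2 ^ B * (x * 3) := by gcongr
    _ = 3 * 2 ^ B * 1 * x := by ring
    _ ≤ _ := by gcongr

lemma norm_sum_le_of_hasExtension {b ρ K : ℝ} (hb : 0 < b) (hρ : 0 < ρ) (hK : 0 ≤ K)
    (B : ℕ) (hbB : b * (2 * B + 2) ≤ 1 / 2) :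
    ∃ C, 0 < C ∧ ∀ q : ℕ, q ≠ 0 → ∀ a : ℕ → ℂ, HasExtension b ρ K q a →
      (∀ c : ℝ, 1 < c → LSeriesSummable a c) → (∀ n : ℕ, 1 ≤ n → ‖a n‖ ≤ 1 + Real.log n) →
      ∀ x : ℝ, 1 ≤ x →
      Real.log x ^ B * ‖∑ n ∈ Finset.Icc 1 ⌊x⌋₊, a n‖ ≤ C * Real.sqrt q * x := by
  obtain ⟨C, hC, h⟩ := norm_sum_log_le hb (lt_min hρ (by norm_num : (0 : ℝ) < 1 / 4))
    (min_le_right _ _) hK (2 * B + 1) (by push_cast; linarith)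
  refine ⟨(4 * C + 4 + 2 * (B + 1).factorial) + 3 * 2 ^ B, by positivity, ?_⟩
  intro q hq a hext hs ha x hx
  have hx0 : 0 < x := by linarith
  have hM : 1 ≤ Real.sqrt q := by
    rw [Real.one_le_sqrt]
    exact_mod_cast Nat.one_le_iff_ne_zero.2 hq
  rcases lt_or_ge (Real.log x) 2 with hl | hl
  · refine (norm_sum_le_of_log_lt B hM ha hx hl).trans ?_
    gcongr
    have : (0 : ℝ) ≤ 4 * C + 4 + 2 * (B + 1).factorial := by positivity
    linarith
  · refine (norm_sum_le_of_norm_sum_log_le B hM hC ha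
      (h q hq a (hext.mono (min_le_left _ _)) hs) hx0 hl).trans ?_
    have h3 : (4 * C + 4 + 2 * ((B + 1).factorial : ℝ)) ≤
        4 * C + 4 + 2 * (B + 1).factorial + 3 * 2 ^ B := by
      have : (0 : ℝ) ≤ 3 * 2 ^ B := by positivity
      linarith
    exact mul_le_mul_of_nonneg_right (mul_le_mul_of_nonneg_right h3 (by positivity)) hx0.le

/-- Siegel–Walfisz bound. -/
lemma norm_sum_char_vonMangoldt_le (B : ℕ) :
    ∃ C, 0 < C ∧ ∀ (q : ℕ) [NeZero q] (χ : DirichletCharacter ℂ q), χ ≠ 1 → ∀ x : ℝ, 1 ≤ x →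
      Real.log x ^ B * ‖∑ n ∈ Finset.Icc 1 ⌊x⌋₊, χ n * (ArithmeticFunction.vonMangoldt n : ℂ)‖ ≤
        C * Real.sqrt q * x := by
  have hb : (0 : ℝ) < 1 / (2 * (2 * B + 2)) := by positivity
  have hb1 : (1 : ℝ) / (2 * (2 * B + 2)) ≤ 1 := by
    rw [div_le_one (by positivity)]
    have : (0 : ℝ) ≤ B := by positivity
    linarith
  obtain ⟨ρ, K, hρ, hK, h⟩ := hasExtension_char hb hb1
  obtain ⟨C, hC, hC'⟩ := norm_sum_le_of_hasExtension hb hρ (by linarith : 0 ≤ K) B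
    (by apply le_of_eq; field_simp)
  refine ⟨C, hC, fun q _ χ hχ x hx => hC' q (NeZero.ne q) _ (h q χ hχ) ?_ ?_ x hx⟩
  · intro c hc
    exact DirichletCharacter.LSeriesSummable_twist_vonMangoldt χ (by simpa using hc)
  · intro n hn
    have h1 : ‖χ n‖ ≤ 1 := χ.norm_le_one _
    have h2 : ArithmeticFunction.vonMangoldt n ≤ Real.log n := ArithmeticFunction.vonMangoldt_le_log
    have h3 : (0 : ℝ) ≤ ArithmeticFunction.vonMangoldt n := ArithmeticFunction.vonMangoldt_nonneg
    rw [norm_mul, Complex.norm_real, Real.norm_of_nonneg h3]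
    nlinarith [norm_nonneg (χ n)]

/-- The prime number theorem with a logarithmic-power saving. -/
lemma norm_sum_vonMangoldt_sub_one_le (B : ℕ) :
    ∃ C, 0 < C ∧ ∀ x : ℝ, 1 ≤ x →
      Real.log x ^ B * ‖∑ n ∈ Finset.Icc 1 ⌊x⌋₊, ((ArithmeticFunction.vonMangoldt n : ℂ) - 1)‖ ≤
        C * x := by
  have hb : (0 : ℝ) < 1 / (2 * (2 * B + 2)) := by positivity
  have hb1 : (1 : ℝ) / (2 * (2 * B + 2)) ≤ 1 := by
    rw [div_le_one (by positivity)]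
    have : (0 : ℝ) ≤ B := by positivity
    linarith
  obtain ⟨ρ, K, hρ, hK, h⟩ := hasExtension_vonMangoldt_sub_one hb hb1
  obtain ⟨C, hC, hC'⟩ := norm_sum_le_of_hasExtension hb hρ (by linarith : 0 ≤ K) B
    (by apply le_of_eq; field_simp)
  refine ⟨C, hC, fun x hx => ?_⟩
  have := hC' 1 one_ne_zero _ h ?_ ?_ x hx
  · simpa using this
  · intro c hc
    have h1 := ArithmeticFunction.LSeriesSummable_vonMangoldt (s := c) (by simpa using hc)
    have h2 : LSeriesSummable 1 (c : ℂ) := LSeriesSummable_one_iff.2 (by simpa using hc)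
    exact h1.sub h2
  · intro n hn
    have h2 : ArithmeticFunction.vonMangoldt n ≤ Real.log n := ArithmeticFunction.vonMangoldt_le_log
    have h3 : (0 : ℝ) ≤ ArithmeticFunction.vonMangoldt n := ArithmeticFunction.vonMangoldt_nonneg
    refine (norm_sub_le _ _).trans ?_
    rw [Complex.norm_real, Real.norm_of_nonneg h3, norm_one]
    linarith

end BDH

namespace BDH
open Set Filter Topology MeasureTheory Complex

/-- The exponential sum with coefficients `a n`, `1 ≤ n ≤ N`. -/
noncomputable def expSum (a : ℕ → ℂ) (N : ℕ) (t : ℝ) : ℂ :=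
  ∑ n ∈ Finset.Icc 1 N, a n * cexp (2 * Real.pi * I * n * t)

lemma hasDerivAt_expSum (a : ℕ → ℂ) (N : ℕ) (t : ℝ) :
    HasDerivAt (expSum a N) (expSum (fun n => 2 * Real.pi * I * n * a n) N t) t := by
  unfold expSum
  refine HasDerivAt.fun_sum fun n _ => ?_
  have h1 : HasDerivAt (fun t : ℝ => (t : ℂ)) 1 t := Complex.ofRealCLM.hasDerivAt
  refine (((h1.const_mul (2 * Real.pi * I * n)).cexp).const_mul (a n)).congr_deriv ?_
  ring

lemma continuous_expSum (a : ℕ → ℂ) (N : ℕ) : Continuous (expSum a N) :=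
  continuous_iff_continuousAt.2 fun t => (hasDerivAt_expSum a N t).continuousAt

lemma integral_cexp_int (k : ℤ) :
    ∫ t in (-1 : ℝ)..2, cexp (2 * Real.pi * I * k * t) = if k = 0 then 3 else 0 := by
  split_ifs with hk
  · simp [hk]
    norm_num
  · have hc : (2 * Real.pi * I * k : ℂ) ≠ 0 := by
      simp [hk, Real.pi_ne_zero]
    rw [integral_exp_mul_complex hc]
    have e1 : cexp (2 * Real.pi * I * k * ((2 : ℝ) : ℂ)) = 1 := by
      rw [Complex.exp_eq_one_iff]
      exact ⟨k * 2, by push_cast; ring⟩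
    have e2 : cexp (2 * Real.pi * I * k * ((-1 : ℝ) : ℂ)) = 1 := by
      rw [Complex.exp_eq_one_iff]
      exact ⟨k * (-1), by push_cast; ring⟩
    rw [e1, e2, sub_self, zero_div]

/-- Parseval's identity over three periods. -/
lemma integral_norm_expSum_sq (a : ℕ → ℂ) (N : ℕ) :
    ∫ t in (-1 : ℝ)..2, ‖expSum a N t‖ ^ 2 = 3 * ∑ n ∈ Finset.Icc 1 N, ‖a n‖ ^ 2 := by
  have h1 : ∀ t : ℝ, ((‖expSum a N t‖ ^ 2 : ℝ) : ℂ) =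
      ∑ m ∈ Finset.Icc 1 N, ∑ n ∈ Finset.Icc 1 N, a m * starRingEnd ℂ (a n) *
        cexp (2 * Real.pi * I * ((m - n : ℤ) : ℂ) * t) := by
    intro t
    rw [Complex.ofReal_pow, ← Complex.mul_conj', expSum, map_sum, Finset.sum_mul_sum]
    refine Finset.sum_congr rfl fun m _ => Finset.sum_congr rfl fun n _ => ?_
    rw [map_mul, ← Complex.exp_conj]
    have : cexp (2 * Real.pi * I * ((m - n : ℤ) : ℂ) * t) = cexp (2 * Real.pi * I * m * t) *
        cexp (starRingEnd ℂ (2 * Real.pi * I * n * t)) := by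
      rw [← Complex.exp_add]
      congr 1
      simp only [map_mul, Complex.conj_I, Complex.conj_ofReal, map_natCast, map_ofNat]
      push_cast
      ring
    rw [this]
    ring
  have h2 : ((∫ t in (-1 : ℝ)..2, ‖expSum a N t‖ ^ 2 : ℝ) : ℂ) =
      ((3 * ∑ n ∈ Finset.Icc 1 N, ‖a n‖ ^ 2 : ℝ) : ℂ) := by
    rw [← intervalIntegral.integral_ofReal]
    simp_rw [h1]
    rw [intervalIntegral.integral_finsetSum (fun m _ => (by fun_prop : Continuous _).intervalIntegrable _ _)]
    rw [Complex.ofReal_mul, Complex.ofReal_sum, Finset.mul_sum]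
    refine Finset.sum_congr rfl fun m hm => ?_
    rw [intervalIntegral.integral_finsetSum (fun m _ => (by fun_prop : Continuous _).intervalIntegrable _ _)]
    simp_rw [intervalIntegral.integral_const_mul, integral_cexp_int]
    rw [Finset.sum_eq_single m]
    · simp [← Complex.mul_conj']
      ring
    · intro n _ hn
      rw [if_neg, mul_zero]
      intro h
      apply hn
      have : (m : ℤ) = n := sub_eq_zero.1 h
      exact_mod_cast this.symm
    · exact fun h => absurd hm h
  exact_mod_cast h2

/-- Gallagher's inequality at a point. -/
lemma gallagher {g g' : ℝ → ℝ} (hg : ∀ t, HasDerivAt g (g' t) t) (hg' : Continuous g')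
    {δ : ℝ} (hδ : 0 < δ) (α : ℝ) :
    δ * g α ≤ ∫ t in Ioc (α - δ / 2) (α + δ / 2), (g t + δ * |g' t|) := by
  have hle : α - δ / 2 ≤ α + δ / 2 := by linarith
  have hgc : Continuous g := continuous_iff_continuousAt.2 fun t => (hg t).continuousAt
  have h_int : IntervalIntegrable (fun t => |g' t|) volume (α - δ / 2) (α + δ / 2) :=
    hg'.abs.intervalIntegrable _ _
  set D := ∫ t in (α - δ / 2)..(α + δ / 2), |g' t| with hD
  have hpt : ∀ t ∈ Set.Icc (α - δ / 2) (α + δ / 2), g α ≤ g t + D := by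
    intro t ht
    have h1 := intervalIntegral.integral_eq_sub_of_hasDerivAt (fun s _ => hg s)
      (hg'.intervalIntegrable t α)
    have h2 : |(∫ s in t..α, g' s)| ≤ |(∫ s in t..α, |g' s|)| := by
      simpa only [Real.norm_eq_abs] using intervalIntegral.norm_integral_le_abs_integral_norm
        (f := g') (a := t) (b := α) (μ := volume)
    have h3 : |(∫ s in t..α, |g' s|)| ≤ |(∫ t in (α - δ / 2)..(α + δ / 2), |g' t|)| := by
      refine intervalIntegral.abs_integral_mono_interval ?_ (ae_of_all _ fun s => abs_nonneg _) h_int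
      rw [uIoc_of_le hle]
      intro s hs
      rw [Set.mem_uIoc] at hs
      obtain ⟨ht1, ht2⟩ := ht
      rcases hs with hs | hs
      · exact ⟨by linarith [hs.1], by linarith [hs.2]⟩
      · exact ⟨by linarith [hs.1], by linarith [hs.2]⟩
    have h4 : 0 ≤ D := intervalIntegral.integral_nonneg hle fun s _ => abs_nonneg _
    rw [← hD, abs_of_nonneg h4] at h3
    linarith [le_abs_self (∫ s in t..α, g' s)]
  rw [← intervalIntegral.integral_of_le hle, intervalIntegral.integral_add
    (hgc.intervalIntegrable _ _) (h_int.const_mul _), intervalIntegral.integral_const_mul, ← hD]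
  have h5 := intervalIntegral.integral_mono_on hle
    (continuous_const.intervalIntegrable (μ := volume) _ _)
    ((by fun_prop : Continuous fun t => g t + D).intervalIntegrable _ _) hpt
  rw [intervalIntegral.integral_const, intervalIntegral.integral_add
    (hgc.intervalIntegrable _ _) (continuous_const.intervalIntegrable _ _),
    intervalIntegral.integral_const] at h5
  simp only [smul_eq_mul] at h5
  have e : α + δ / 2 - (α - δ / 2) = δ := by ring
  rw [e] at h5
  exact h5

/-- The large sieve inequality for well-spaced points. -/
lemma sum_norm_expSum_sq_le {ι : Type*} (P : Finset ι) (α : ι → ℝ) {δ : ℝ} (hδ : 0 < δ)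
    (hδ1 : δ ≤ 1) (h01 : ∀ i ∈ P, 0 ≤ α i ∧ α i ≤ 1)
    (hsep : ∀ i ∈ P, ∀ j ∈ P, i ≠ j → δ ≤ |α i - α j|) (a : ℕ → ℂ) {N : ℕ} (hN : 1 ≤ N) :
    δ * ∑ i ∈ P, ‖expSum a N (α i)‖ ^ 2 ≤ 150 * (1 + δ * N) * ∑ n ∈ Finset.Icc 1 N, ‖a n‖ ^ 2 := by
  set S := expSum a N with hS
  set T := expSum (fun n => 2 * Real.pi * I * n * a n) N with hT
  have hSc : Continuous S := continuous_expSum _ _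
  have hTc : Continuous T := continuous_expSum _ _
  have hN0 : (0 : ℝ) < N := by exact_mod_cast hN
  set g' : ℝ → ℝ := fun t => 2 * inner ℝ (S t) (T t) with hg'
  have hg : ∀ t, HasDerivAt (fun t => ‖S t‖ ^ 2) (g' t) t := fun t =>
    (hasDerivAt_expSum a N t).norm_sq
  have hg'c : Continuous g' := by simp only [hg']; fun_prop
  set F : ℝ → ℝ := fun t => (1 + δ * N) * ‖S t‖ ^ 2 + δ / N * ‖T t‖ ^ 2 with hF
  have hFc : Continuous F := by simp only [hF]; fun_prop
  have hF0 : ∀ t, 0 ≤ F t := fun t => by simp only [hF]; positivity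
  have hgF : ∀ t, ‖S t‖ ^ 2 + δ * |g' t| ≤ F t := by
    intro t
    have h1 : |g' t| ≤ 2 * (‖S t‖ * ‖T t‖) := by
      simp only [hg']
      rw [abs_mul, abs_two]
      gcongr
      exact abs_real_inner_le_norm _ _
    have h2 : 2 * (‖S t‖ * ‖T t‖) ≤ N * ‖S t‖ ^ 2 + 1 / N * ‖T t‖ ^ 2 := by
      have h3 : 0 ≤ (N * ‖S t‖ - ‖T t‖) ^ 2 / N := by positivity
      have h4 : (N * ‖S t‖ - ‖T t‖) ^ 2 / N =
        N * ‖S t‖ ^ 2 + 1 / N * ‖T t‖ ^ 2 - 2 * (‖S t‖ * ‖T t‖) := by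
        field_simp
        ring
      linarith
    calc ‖S t‖ ^ 2 + δ * |g' t| ≤ ‖S t‖ ^ 2 + δ * (N * ‖S t‖ ^ 2 + 1 / N * ‖T t‖ ^ 2) := by
          gcongr
          exact h1.trans h2
      _ = F t := by simp only [hF]; ring
  set J : ι → Set ℝ := fun i => Ioc (α i - δ / 2) (α i + δ / 2) with hJ
  have hFi : ∀ u v, IntegrableOn F (Ioc u v) := fun u v =>
    (hFc.integrableOn_Icc).mono_set Ioc_subset_Icc_self
  have hstep : ∀ i ∈ P, δ * ‖S (α i)‖ ^ 2 ≤ ∫ t in J i, F t := by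
    intro i _
    refine (gallagher hg hg'c hδ (α i)).trans (setIntegral_mono ?_ (hFi _ _) hgF)
    exact ((by fun_prop : Continuous fun t => ‖S t‖ ^ 2 + δ * |g' t|).integrableOn_Icc).mono_set
      Ioc_subset_Icc_self
  have hdisj : (P : Set ι).Pairwise (Function.onFun Disjoint J) := by
    intro i hi j hj hij
    refine Set.disjoint_left.2 fun t hti htj => ?_
    have := hsep i hi j hj hij
    have h1 : |α i - α j| < δ := by
      rw [abs_lt]
      exact ⟨by linarith [hti.1, hti.2, htj.1, htj.2], by linarith [hti.1, hti.2, htj.1, htj.2]⟩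
    linarith
  have h_int : ∫ t in Ioc (-1 : ℝ) 2, F t ≤ 150 * (1 + δ * N) * ∑ n ∈ Finset.Icc 1 N, ‖a n‖ ^ 2 := by
    rw [← intervalIntegral.integral_of_le (by norm_num)]
    simp only [hF]
    rw [intervalIntegral.integral_add ((by fun_prop : Continuous _).intervalIntegrable _ _)
      ((by fun_prop : Continuous _).intervalIntegrable _ _), intervalIntegral.integral_const_mul,
      intervalIntegral.integral_const_mul, integral_norm_expSum_sq, integral_norm_expSum_sq]
    have h1 : ∑ n ∈ Finset.Icc 1 N, ‖2 * Real.pi * I * n * a n‖ ^ 2 ≤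
        40 * N ^ 2 * ∑ n ∈ Finset.Icc 1 N, ‖a n‖ ^ 2 := by
      rw [Finset.mul_sum]
      refine Finset.sum_le_sum fun n hn => ?_
      have hn2 : (n : ℝ) ≤ N := by exact_mod_cast (Finset.mem_Icc.1 hn).2
      simp only [norm_mul, norm_I, Complex.norm_natCast, Complex.norm_real, norm_ofNat,
        Real.norm_of_nonneg Real.pi_pos.le, mul_one]
      have hp : Real.pi < 3.15 := Real.pi_lt_d2
      have hp0 := Real.pi_pos
      have hp2 : (2 * Real.pi) ^ 2 ≤ 40 := by nlinarith
      calc (2 * Real.pi * n * ‖a n‖) ^ 2 = (2 * Real.pi) ^ 2 * n ^ 2 * ‖a n‖ ^ 2 := by ring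
        _ ≤ _ := by gcongr
    set A := ∑ n ∈ Finset.Icc 1 N, ‖a n‖ ^ 2
    have hA : 0 ≤ A := Finset.sum_nonneg fun n _ => by positivity
    calc _ ≤ (1 + δ * N) * (3 * A) + δ / N * (3 * (40 * N ^ 2 * A)) := by gcongr
      _ = (3 + 123 * (δ * N)) * A := by field_simp; ring
      _ ≤ _ := by
        have : 0 ≤ δ * N := by positivity
        gcongr
        linarith
  calc δ * ∑ i ∈ P, ‖S (α i)‖ ^ 2 = ∑ i ∈ P, δ * ‖S (α i)‖ ^ 2 := Finset.mul_sum _ _ _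
    _ ≤ ∑ i ∈ P, ∫ t in J i, F t := Finset.sum_le_sum hstep
    _ = ∫ t in ⋃ i ∈ P, J i, F t := by
      rw [integral_biUnion_finset P (fun _ _ => measurableSet_Ioc) hdisj (fun _ _ => hFi _ _)]
    _ ≤ ∫ t in Ioc (-1 : ℝ) 2, F t := by
      refine setIntegral_mono_set (hFi _ _) (ae_of_all _ hF0) ?_
      refine (Set.iUnion₂_subset fun i hi t ht => ?_).eventuallyLE
      obtain ⟨h0, h1⟩ := h01 i hi
      exact ⟨by linarith [ht.1], by linarith [ht.2]⟩
    _ ≤ _ := h_int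

end BDH

namespace BDH
open Set Filter Topology MeasureTheory Complex

/-- The reduced residues modulo `q`, as natural numbers in `[1, q]`. -/
def residues (q : ℕ) : Finset ℕ := (Finset.Icc 1 q).filter (fun a => Nat.gcd a q = 1)

lemma mem_residues {q a : ℕ} : a ∈ residues q ↔ (1 ≤ a ∧ a ≤ q) ∧ Nat.gcd a q = 1 := by
  simp [residues]

lemma natCast_injOn_Icc (q : ℕ) :
    Set.InjOn (fun a : ℕ => (a : ZMod q)) (Finset.Icc 1 q : Finset ℕ) := by
  intro a ha b hb hab
  simp only [Finset.coe_Icc, Set.mem_Icc] at ha hb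
  have h : a ≡ b [MOD q] := (ZMod.natCast_eq_natCast_iff a b q).1 hab
  rcases eq_or_ne a q with rfl | haq
  · have : a ∣ b := (Nat.modEq_zero_iff_dvd.1 (h.symm.trans (by simp [Nat.ModEq])))
    exact le_antisymm (Nat.le_of_dvd (by lia) this) hb.2
  rcases eq_or_ne b q with rfl | hbq
  · have : b ∣ a := (Nat.modEq_zero_iff_dvd.1 (h.trans (by simp [Nat.ModEq])))
    exact le_antisymm ha.2 (Nat.le_of_dvd (by lia) this)
  exact h.eq_of_lt_of_lt (by lia) (by lia)

lemma natCast_injOn_residues (q : ℕ) :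
    Set.InjOn (fun a : ℕ => (a : ZMod q)) (residues q : Finset ℕ) :=
  (natCast_injOn_Icc q).mono (by intro a; simp [residues]; tauto)

lemma exists_mem_Icc_natCast_eq {q : ℕ} [NeZero q] (b : ZMod q) :
    ∃ a ∈ Finset.Icc 1 q, (a : ZMod q) = b := by
  by_cases h : b = 0
  · exact ⟨q, Finset.mem_Icc.2 ⟨NeZero.one_le, le_rfl⟩, by simp [h]⟩
  · refine ⟨b.val, Finset.mem_Icc.2 ⟨?_, (ZMod.val_lt b).le⟩, ZMod.natCast_zmod_val b⟩
    exact Nat.one_le_iff_ne_zero.2 fun h0 => h ((ZMod.val_eq_zero b).1 h0)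

lemma isUnit_of_mem_residues {q a : ℕ} (ha : a ∈ residues q) : IsUnit (a : ZMod q) :=
  (ZMod.isUnit_iff_coprime a q).2 (mem_residues.1 ha).2

lemma sum_char_mul_eq_sum_residues {q : ℕ} [NeZero q] (χ : DirichletCharacter ℂ q)
    (g : ZMod q → ℂ) : ∑ b : ZMod q, χ b * g b = ∑ a ∈ residues q, χ a * g a := by
  symm
  refine Finset.sum_of_injOn (fun a : ℕ => (a : ZMod q)) (natCast_injOn_residues q)
    (fun _ _ => Finset.mem_coe.2 (Finset.mem_univ _)) ?_ (fun _ _ => rfl)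
  intro b _ hb
  by_cases hu : IsUnit b
  · exfalso
    obtain ⟨a, ha, rfl⟩ := exists_mem_Icc_natCast_eq b
    exact hb ⟨a, by simpa [residues, (ZMod.isUnit_iff_coprime a q).1 hu] using ha, rfl⟩
  · rw [χ.map_nonunit hu, zero_mul]

/-- Orthogonality of characters in mean-square form. -/
lemma sum_norm_sum_char_sq {q : ℕ} [NeZero q] (f : ℕ → ℂ) :
    ∑ χ : DirichletCharacter ℂ q, ‖∑ a ∈ residues q, χ a * f a‖ ^ 2 =
      q.totient * ∑ a ∈ residues q, ‖f a‖ ^ 2 := by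
  have h : ((∑ χ : DirichletCharacter ℂ q, ‖∑ a ∈ residues q, χ a * f a‖ ^ 2 : ℝ) : ℂ) =
      ((q.totient * ∑ a ∈ residues q, ‖f a‖ ^ 2 : ℝ) : ℂ) := by
    have h1 : ∀ χ : DirichletCharacter ℂ q, ((‖∑ a ∈ residues q, χ a * f a‖ ^ 2 : ℝ) : ℂ) =
        ∑ a ∈ residues q, ∑ b ∈ residues q, (χ (b : ZMod q)⁻¹ * χ a) *
          (f a * starRingEnd ℂ (f b)) := by
      intro χ
      rw [Complex.ofReal_pow, ← Complex.mul_conj', map_sum, Finset.sum_mul_sum]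
      refine Finset.sum_congr rfl fun a _ => Finset.sum_congr rfl fun b hb => ?_
      have h2 : starRingEnd ℂ (χ b) = χ (b : ZMod q)⁻¹ := by
        rw [starRingEnd_apply, MulChar.star_apply', MulChar.inv_apply_eq_inv']
        refine (eq_inv_of_mul_eq_one_left ?_).symm
        rw [← map_mul, ZMod.inv_mul_of_unit _ (isUnit_of_mem_residues hb), map_one]
      rw [map_mul, h2]
      ring
    rw [Complex.ofReal_sum]
    simp_rw [h1]
    rw [Finset.sum_comm, Complex.ofReal_mul, Complex.ofReal_sum, Finset.mul_sum]
    refine Finset.sum_congr rfl fun a ha => ?_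
    rw [Finset.sum_comm]
    simp_rw [← Finset.sum_mul]
    rw [Finset.sum_eq_single a]
    · rw [DirichletCharacter.sum_char_inv_mul_char_eq ℂ (isUnit_of_mem_residues ha), if_pos rfl,
        Complex.mul_conj']
      push_cast
      rfl
    · intro b hb hba
      rw [DirichletCharacter.sum_char_inv_mul_char_eq ℂ (isUnit_of_mem_residues hb), if_neg, zero_mul]
      exact fun h => hba (natCast_injOn_residues q hb ha h)
    · exact fun h => absurd ha h
  exact_mod_cast h

lemma norm_gaussSum_sq {q : ℕ} [NeZero q] {χ : DirichletCharacter ℂ q} (hχ : χ.IsPrimitive) :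
    ‖gaussSum χ ZMod.stdAddChar‖ ^ 2 = q := by
  classical
  have he : (ZMod.stdAddChar (N := q)).IsPrimitive := ZMod.isPrimitive_stdAddChar q
  generalize (ZMod.stdAddChar : AddChar (ZMod q) ℂ) = e at he ⊢
  have hconj : ∀ x, starRingEnd ℂ (e x) = e (-x) := fun x => (AddChar.map_neg_eq_conj e x).symm
  have h1 : ∑ a : ZMod q, ‖gaussSum χ (e.mulShift a)‖ ^ 2 =
      (∑ a : ZMod q, ‖χ a‖ ^ 2) * ‖gaussSum χ e‖ ^ 2 := by
    rw [Finset.sum_mul]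
    refine Finset.sum_congr rfl fun a _ => ?_
    rw [gaussSum_mulShift_of_isPrimitive e hχ, norm_mul, mul_pow, ← MulChar.star_apply', norm_star]
  have h2 : ((∑ a : ZMod q, ‖gaussSum χ (e.mulShift a)‖ ^ 2 : ℝ) : ℂ) =
      ((q * ∑ a : ZMod q, ‖χ a‖ ^ 2 : ℝ) : ℂ) := by
    have h3 : ∀ a : ZMod q, ((‖gaussSum χ (e.mulShift a)‖ ^ 2 : ℝ) : ℂ) =
        ∑ x : ZMod q, ∑ y : ZMod q, (χ x * starRingEnd ℂ (χ y)) * e (a * (x - y)) := by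
      intro a
      rw [Complex.ofReal_pow, ← Complex.mul_conj', gaussSum, map_sum, Finset.sum_mul_sum]
      refine Finset.sum_congr rfl fun x _ => Finset.sum_congr rfl fun y _ => ?_
      rw [map_mul, AddChar.mulShift_apply, AddChar.mulShift_apply, hconj, mul_sub,
        sub_eq_add_neg, AddChar.map_add_eq_mul]
      ring
    rw [Complex.ofReal_sum]
    simp_rw [h3]
    rw [Finset.sum_comm, Complex.ofReal_mul, Complex.ofReal_sum, Finset.mul_sum]
    refine Finset.sum_congr rfl fun x _ => ?_
    rw [Finset.sum_comm]
    simp_rw [← Finset.mul_sum, AddChar.sum_mulShift (R' := ℂ) _ he]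
    rw [Finset.sum_eq_single x]
    · rw [sub_self, if_pos rfl, Complex.mul_conj', ZMod.card]
      push_cast
      ring
    · intro y _ hy
      rw [if_neg (sub_ne_zero.2 hy.symm), Nat.cast_zero, mul_zero]
    · exact fun h => absurd (Finset.mem_univ _) h
  have h4 : ∑ a : ZMod q, ‖gaussSum χ (e.mulShift a)‖ ^ 2 = q * ∑ a : ZMod q, ‖χ a‖ ^ 2 := by
    exact_mod_cast h2
  have h5 : 0 < ∑ a : ZMod q, ‖χ a‖ ^ 2 :=
    Finset.sum_pos' (fun _ _ => by positivity) ⟨1, Finset.mem_univ _, by simp⟩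
  rw [h1, mul_comm (q : ℝ)] at h4
  exact mul_left_cancel₀ h5.ne' h4

lemma stdAddChar_natCast_mul {q : ℕ} [NeZero q] (n a : ℕ) :
    ZMod.stdAddChar ((n : ZMod q) * (a : ZMod q)) = cexp (2 * Real.pi * I * n * ((a / q : ℝ) : ℂ)) := by
  have := ZMod.stdAddChar_coe (N := q) (n * a : ℤ)
  push_cast at this
  rw [this]
  congr 1
  push_cast
  ring

/-- For primitive characters, twisted sums are averages of exponential sums. -/
lemma norm_sum_char_sq_mul {q : ℕ} [NeZero q] {χ : DirichletCharacter ℂ q} (hχ : χ.IsPrimitive)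
    (c : ℕ → ℂ) (N : ℕ) :
    q * ‖∑ n ∈ Finset.Icc 1 N, c n * χ n‖ ^ 2 =
      ‖∑ a ∈ residues q, χ⁻¹ a * expSum c N (a / q)‖ ^ 2 := by
  have hχ' : χ⁻¹.IsPrimitive := by
    rw [DirichletCharacter.isPrimitive_def, DirichletCharacter.conductor_inv]
    exact hχ
  rw [show (q : ℝ) * ‖∑ n ∈ Finset.Icc 1 N, c n * χ n‖ ^ 2 =
    ‖gaussSum χ⁻¹ ZMod.stdAddChar * ∑ n ∈ Finset.Icc 1 N, c n * χ n‖ ^ 2 by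
      rw [norm_mul, mul_pow, norm_gaussSum_sq hχ']]
  congr 2
  rw [Finset.mul_sum]
  have h1 : ∀ n : ℕ, gaussSum χ⁻¹ ZMod.stdAddChar * (c n * χ n) =
      ∑ a ∈ residues q, χ⁻¹ a * (c n * cexp (2 * Real.pi * I * n * ((a / q : ℝ) : ℂ))) := by
    intro n
    have h2 := gaussSum_mulShift_of_isPrimitive ZMod.stdAddChar hχ' (n : ZMod q)
    rw [inv_inv] at h2
    have h3 : gaussSum χ⁻¹ ZMod.stdAddChar * (c n * χ n) =
        c n * gaussSum χ⁻¹ (ZMod.stdAddChar.mulShift (n : ZMod q)) := by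
      rw [h2]; ring
    rw [h3, gaussSum, sum_char_mul_eq_sum_residues, Finset.mul_sum]
    refine Finset.sum_congr rfl fun a _ => ?_
    rw [AddChar.mulShift_apply, stdAddChar_natCast_mul]
    ring
  simp_rw [h1]
  rw [Finset.sum_comm]
  refine Finset.sum_congr rfl fun a _ => ?_
  rw [expSum, Finset.mul_sum]

/-- The sum of `F` over the primitive Dirichlet characters modulo `q`. -/
noncomputable def primSum (q : ℕ) (F : DirichletCharacter ℂ q → ℝ) : ℝ :=
  ∑ᶠ χ : DirichletCharacter ℂ q, open Classical in if χ.IsPrimitive then F χ else 0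

open Classical in
lemma primSum_eq (q : ℕ) [NeZero q] (F : DirichletCharacter ℂ q → ℝ) :
    primSum q F = ∑ χ : DirichletCharacter ℂ q, if χ.IsPrimitive then F χ else 0 :=
  finsum_eq_sum_of_fintype _

lemma primSum_mul_le {q : ℕ} [NeZero q] (c : ℕ → ℂ) (N : ℕ) :
    (q : ℝ) / q.totient * primSum q (fun χ => ‖∑ n ∈ Finset.Icc 1 N, c n * χ n‖ ^ 2) ≤
      ∑ a ∈ residues q, ‖expSum c N (a / q)‖ ^ 2 := by
  classical
  have hφ : (0 : ℝ) < q.totient := by exact_mod_cast Nat.totient_pos.2 (NeZero.pos q)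
  rw [div_mul_eq_mul_div, div_le_iff₀' hφ, ← sum_norm_sum_char_sq, primSum_eq, Finset.mul_sum,
    ← Equiv.sum_comp (Equiv.inv _)]
  refine Finset.sum_le_sum fun χ _ => ?_
  split_ifs with h
  · have h' : χ.IsPrimitive := by
      have e := DirichletCharacter.conductor_inv χ
      exact e.symm.trans h
    simp only [Equiv.inv_apply] at h ⊢
    rw [norm_sum_char_sq_mul h, inv_inv]
  · simp only [mul_zero]
    positivity

/-- The multiplicative large sieve inequality. -/
lemma large_sieve (c : ℕ → ℂ) {N : ℕ} (hN : 1 ≤ N) {Q : ℕ} (hQ : 1 ≤ Q) :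
    ∑ q ∈ Finset.Icc 1 Q, (q : ℝ) / q.totient *
        primSum q (fun χ => ‖∑ n ∈ Finset.Icc 1 N, c n * χ n‖ ^ 2) ≤
      150 * (N + Q ^ 2) * ∑ n ∈ Finset.Icc 1 N, ‖c n‖ ^ 2 := by
  have hQ0 : (0 : ℝ) < Q := by exact_mod_cast hQ
  have hQ1 : (1 : ℝ) ≤ Q := by exact_mod_cast hQ
  have h1 := sum_norm_expSum_sq_le ((Finset.Icc 1 Q).sigma residues)
    (fun p => (p.2 : ℝ) / p.1) (δ := 1 / Q ^ 2) (by positivity)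
    (by rw [div_le_one (by positivity)]; exact one_le_pow₀ hQ1)
    (by
      rintro ⟨q, a⟩ hp
      rw [Finset.mem_sigma, mem_residues] at hp
      have hq : (0 : ℝ) < q := by exact_mod_cast (show 0 < q by lia)
      refine ⟨by positivity, ?_⟩
      rw [div_le_one hq]
      exact_mod_cast hp.2.1.2)
    (by
      rintro ⟨q, a⟩ hp ⟨r, b⟩ hp' hne
      rw [Finset.mem_sigma, mem_residues, Finset.mem_Icc] at hp hp'
      dsimp only at hp hp' ⊢
      have hq : (0 : ℝ) < q := by exact_mod_cast (show 0 < q by lia)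
      have hr : (0 : ℝ) < r := by exact_mod_cast (show 0 < r by lia)
      have hqQ : (q : ℝ) ≤ Q := by exact_mod_cast hp.1.2
      have hrQ : (r : ℝ) ≤ Q := by exact_mod_cast hp'.1.2
      have hne' : (a * r : ℤ) - b * q ≠ 0 := by
        intro h
        have h2 : a * r = b * q := by exact_mod_cast sub_eq_zero.1 h
        have hqr : q ∣ r := by
          have : q ∣ a * r := h2 ▸ Dvd.intro_left b rfl
          exact (Nat.Coprime.dvd_of_dvd_mul_left (Nat.Coprime.symm hp.2.2) this)
        have hrq : r ∣ q := by
          have : r ∣ b * q := h2 ▸ Dvd.intro_left a rfl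
          exact (Nat.Coprime.dvd_of_dvd_mul_left (Nat.Coprime.symm hp'.2.2) this)
        have e : q = r := Nat.dvd_antisymm hqr hrq
        subst e
        have : a = b := Nat.eq_of_mul_eq_mul_right (by lia) h2
        exact hne (by rw [this])
      have habs : (1 : ℝ) ≤ |(a * r : ℝ) - b * q| := by exact_mod_cast Int.one_le_abs hne'
      have e : (a : ℝ) / q - b / r = (a * r - b * q) / (q * r) := by field_simp
      rw [e, abs_div, abs_of_pos (by positivity : (0 : ℝ) < q * r)]
      have : (q : ℝ) * r ≤ Q ^ 2 := by
        rw [sq]; gcongr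
      gcongr) c hN
  rw [Finset.sum_sigma] at h1
  have h2 : ∑ q ∈ Finset.Icc 1 Q, (q : ℝ) / q.totient *
        primSum q (fun χ => ‖∑ n ∈ Finset.Icc 1 N, c n * χ n‖ ^ 2) ≤
      ∑ q ∈ Finset.Icc 1 Q, ∑ a ∈ residues q, ‖expSum c N (a / q)‖ ^ 2 := by
    refine Finset.sum_le_sum fun q hq => ?_
    have : NeZero q := ⟨by have := (Finset.mem_Icc.1 hq).1; lia⟩
    exact primSum_mul_le c N
  refine h2.trans ?_
  rw [one_div_mul_eq_div, div_le_iff₀ (by positivity)] at h1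
  refine h1.trans (le_of_eq ?_)
  field_simp
  ring

end BDH

namespace BDH
open Set Filter Topology MeasureTheory Complex

open Classical in
/-- The error term `ψ(x, χ) - [χ = 1] x`. -/
noncomputable def charErr (x : ℝ) {q : ℕ} (χ : DirichletCharacter ℂ q) : ℂ :=
  ∑ n ∈ Finset.Icc 1 ⌊x⌋₊, (ArithmeticFunction.vonMangoldt n : ℂ) * χ n -
    if χ = 1 then (x : ℂ) else 0

lemma sum_char_mul_psi (x : ℝ) {q : ℕ} [NeZero q] (χ : DirichletCharacter ℂ q) :
    ∑ a ∈ residues q, χ a * (psi x q a : ℂ) =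
      ∑ n ∈ Finset.Icc 1 ⌊x⌋₊, (ArithmeticFunction.vonMangoldt n : ℂ) * χ n := by
  classical
  set g : ZMod q → ℂ := fun b => ∑ n ∈ (Finset.Icc 1 ⌊x⌋₊).filter (fun n : ℕ => (n : ZMod q) = b),
    (ArithmeticFunction.vonMangoldt n : ℂ) with hg
  have h1 : ∀ a : ℕ, (psi x q a : ℂ) = g a := by
    intro a
    rw [psi, hg, Complex.ofReal_sum]
    refine Finset.sum_congr (Finset.filter_congr fun n _ => ?_) fun _ _ => rfl
    exact (ZMod.natCast_eq_natCast_iff n a q).symm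
  simp_rw [h1]
  rw [← sum_char_mul_eq_sum_residues, ← Finset.sum_fiberwise _ (fun n : ℕ => (n : ZMod q))]
  refine Finset.sum_congr rfl fun b _ => ?_
  rw [hg, Finset.mul_sum]
  refine Finset.sum_congr rfl fun n hn => ?_
  rw [(Finset.mem_filter.1 hn).2, mul_comm]

lemma sum_residues_char {q : ℕ} [NeZero q] (χ : DirichletCharacter ℂ q) [Decidable (χ = 1)] :
    ∑ a ∈ residues q, χ a = if χ = 1 then (q.totient : ℂ) else 0 := by
  classical
  have h := sum_char_mul_eq_sum_residues χ 1
  simp only [Pi.one_apply, mul_one] at h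
  rw [← h]
  split_ifs with h1
  · rw [h1, MulChar.sum_one_eq_card_units, ZMod.card_units_eq_totient]
  · exact MulChar.sum_eq_zero_of_ne_one h1

lemma totient_mul_sum_sq_eq (x : ℝ) (q : ℕ) [NeZero q] :
    q.totient * ∑ a ∈ (Finset.Icc 1 q).filter (fun a => Nat.gcd a q = 1),
        (psi x q a - x / (q.totient : ℝ)) ^ 2 =
      ∑ χ : DirichletCharacter ℂ q, ‖charErr x χ‖ ^ 2 := by
  classical
  have hφ : (q.totient : ℂ) ≠ 0 := by exact_mod_cast (Nat.totient_pos.2 (NeZero.pos q)).ne'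
  have h := sum_norm_sum_char_sq (q := q) (fun a => ((psi x q a - x / (q.totient : ℝ) : ℝ) : ℂ))
  have e : ∀ a : ℕ, ‖((psi x q a - x / (q.totient : ℝ) : ℝ) : ℂ)‖ ^ 2 =
      (psi x q a - x / (q.totient : ℝ)) ^ 2 := fun a => by
    rw [Complex.norm_real, Real.norm_eq_abs, sq_abs]
  simp_rw [e] at h
  refine h.symm.trans (Finset.sum_congr rfl fun χ _ => ?_)
  congr 2
  simp_rw [Complex.ofReal_sub, mul_sub]
  rw [Finset.sum_sub_distrib, sum_char_mul_psi, ← Finset.sum_mul, sum_residues_char, charErr]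
  congr 1
  split_ifs with h1
  · push_cast
    field_simp
  · simp

lemma sum_vonMangoldt_not_coprime_le {N q : ℕ} (hq : q ≠ 0) :
    ∑ n ∈ (Finset.Icc 1 N).filter (fun n => ¬ n.Coprime q), ArithmeticFunction.vonMangoldt n ≤
      q.primeFactors.card * Nat.log 2 N * Real.log N := by
  classical
  set S := (q.primeFactors ×ˢ Finset.Icc 1 (Nat.log 2 N)).image (fun p => p.1 ^ p.2)
  set s := ((Finset.Icc 1 N).filter (fun n => ¬ n.Coprime q)).filter IsPrimePow with hs
  have hsS : s ⊆ S := by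
    intro n hn
    simp only [hs, Finset.mem_filter, Finset.mem_Icc] at hn
    obtain ⟨⟨⟨h1, h2⟩, h3⟩, h4⟩ := hn
    obtain ⟨p, k, hp, hk, rfl⟩ := h4
    have hp' := hp.nat_prime
    have hpq : p ∣ q := by
      by_contra hpq
      exact h3 (Nat.Coprime.pow_left k ((Nat.Prime.coprime_iff_not_dvd hp').2 hpq))
    refine Finset.mem_image.2 ⟨(p, k), Finset.mem_product.2 ⟨Nat.mem_primeFactors.2 ⟨hp', hpq, hq⟩,
      Finset.mem_Icc.2 ⟨hk, ?_⟩⟩, rfl⟩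
    exact Nat.le_log_of_pow_le (by norm_num) ((Nat.pow_le_pow_left hp'.two_le k).trans h2)
  have hcard : s.card ≤ q.primeFactors.card * Nat.log 2 N := by
    refine (Finset.card_le_card hsS).trans (Finset.card_image_le.trans ?_)
    rw [Finset.card_product, Nat.card_Icc, Nat.add_sub_cancel]
  have h0 : ∑ n ∈ (Finset.Icc 1 N).filter (fun n => ¬ n.Coprime q),
      ArithmeticFunction.vonMangoldt n = ∑ n ∈ s, ArithmeticFunction.vonMangoldt n := by
    exact (Finset.sum_filter_of_ne fun n _ h =>
      ArithmeticFunction.vonMangoldt_ne_zero_iff.1 h).symm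
  rw [h0]
  have h1 : ∀ n ∈ s, ArithmeticFunction.vonMangoldt n ≤ Real.log N := by
    intro n hn
    simp only [hs, Finset.mem_filter, Finset.mem_Icc] at hn
    exact ArithmeticFunction.vonMangoldt_le_log.trans
      (Real.log_le_log (by exact_mod_cast hn.1.1.1) (by exact_mod_cast hn.1.1.2))
  refine (Finset.sum_le_card_nsmul _ _ _ h1).trans ?_
  rw [nsmul_eq_mul]
  have : (s.card : ℝ) ≤ q.primeFactors.card * Nat.log 2 N := by exact_mod_cast hcard
  exact mul_le_mul_of_nonneg_right this (Real.log_natCast_nonneg N)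

lemma primitiveCharacter_eq_one_iff {q : ℕ} [NeZero q] (χ : DirichletCharacter ℂ q) :
    χ.primitiveCharacter = 1 ↔ χ = 1 := by
  constructor
  · intro h
    rw [← χ.changeLevel_primitiveCharacter, h, DirichletCharacter.changeLevel_one]
  · rintro rfl
    exact DirichletCharacter.primitiveCharacter_one

lemma norm_charErr_sub_le (x : ℝ) {q : ℕ} [NeZero q] (χ : DirichletCharacter ℂ q) :
    ‖charErr x χ - charErr x χ.primitiveCharacter‖ ≤
      q.primeFactors.card * Nat.log 2 ⌊x⌋₊ * Real.log ⌊x⌋₊ := by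
  classical
  refine le_trans ?_ (sum_vonMangoldt_not_coprime_le (NeZero.ne q))
  have e : charErr x χ - charErr x χ.primitiveCharacter =
      ∑ n ∈ Finset.Icc 1 ⌊x⌋₊, (ArithmeticFunction.vonMangoldt n : ℂ) * χ n -
        ∑ n ∈ Finset.Icc 1 ⌊x⌋₊, (ArithmeticFunction.vonMangoldt n : ℂ) *
          χ.primitiveCharacter n := by
    rw [charErr, charErr]
    simp only [primitiveCharacter_eq_one_iff]
    split_ifs <;> ring
  rw [e, ← Finset.sum_sub_distrib, Finset.sum_filter]
  refine (norm_sum_le _ _).trans (Finset.sum_le_sum fun n _ => ?_)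
  by_cases h : n.Coprime q
  · rw [if_neg (not_not.2 h)]
    have h1 := χ.primitiveCharacter_apply_of_isCoprime (Nat.isCoprime_iff_coprime.2 h)
    simp only [Int.cast_natCast] at h1
    rw [h1, sub_self, norm_zero]
  · rw [if_pos h, χ.map_nonunit fun hu => h ((ZMod.isUnit_iff_coprime n q).1 hu), mul_zero,
      zero_sub, norm_neg, norm_mul, Complex.norm_real, Real.norm_eq_abs,
      abs_of_nonneg ArithmeticFunction.vonMangoldt_nonneg]
    exact mul_le_of_le_one_right ArithmeticFunction.vonMangoldt_nonneg
      (DirichletCharacter.norm_le_one _ _)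

lemma exists_primitive_of_conductor_eq {q : ℕ}
    (F : ∀ d : ℕ, DirichletCharacter ℂ d → ℝ) (χ : DirichletCharacter ℂ q) {d : ℕ}
    (hd : χ.conductor = d) (hdq : d ∣ q) :
    ∃ ψ : DirichletCharacter ℂ d, ψ.IsPrimitive ∧ DirichletCharacter.changeLevel hdq ψ = χ ∧
      F _ χ.primitiveCharacter = F d ψ := by
  subst hd
  exact ⟨χ.primitiveCharacter, χ.primitiveCharacter_isPrimitive, χ.changeLevel_primitiveCharacter,
    rfl⟩

lemma sum_primitiveCharacter_le {q : ℕ} [NeZero q] (F : ∀ d : ℕ, DirichletCharacter ℂ d → ℝ)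
    (hF : ∀ d χ, 0 ≤ F d χ) :
    ∑ χ : DirichletCharacter ℂ q, F _ χ.primitiveCharacter ≤
      ∑ d ∈ q.divisors, primSum d (F d) := by
  classical
  rw [← Finset.sum_fiberwise_of_maps_to (s := Finset.univ) (t := q.divisors)
    (g := fun χ : DirichletCharacter ℂ q => χ.conductor)
    (fun χ _ => Nat.mem_divisors.2 ⟨χ.conductor_dvd_level, NeZero.ne q⟩)]
  refine Finset.sum_le_sum fun d hd => ?_
  have hdq := Nat.dvd_of_mem_divisors hd
  have : NeZero d := ⟨(Nat.pos_of_mem_divisors hd).ne'⟩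
  rw [primSum_eq, ← Finset.sum_filter]
  set s := (Finset.univ : Finset (DirichletCharacter ℂ q)).filter (fun χ => χ.conductor = d) with hs
  have h : ∀ χ : DirichletCharacter ℂ q, ∃ ψ : DirichletCharacter ℂ d, χ.conductor = d →
      (ψ.IsPrimitive ∧ DirichletCharacter.changeLevel hdq ψ = χ ∧
      F _ χ.primitiveCharacter = F d ψ) := by
    intro χ
    by_cases hχ : χ.conductor = d
    · obtain ⟨ψ, hψ⟩ := exists_primitive_of_conductor_eq F χ hχ hdq
      exact ⟨ψ, fun _ => hψ⟩
    · exact ⟨1, fun h => absurd h hχ⟩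
  choose i hi using h
  have hinj : Set.InjOn i s := by
    intro χ₁ h₁ χ₂ h₂ h12
    rw [← (hi χ₁ (by simpa [hs] using h₁)).2.1, ← (hi χ₂ (by simpa [hs] using h₂)).2.1, h12]
  have e : ∑ χ ∈ s, F _ χ.primitiveCharacter = ∑ ψ ∈ s.image i, F d ψ := by
    rw [Finset.sum_image hinj]
    exact Finset.sum_congr rfl fun χ hχ => (hi χ (by simpa [hs] using hχ)).2.2
  rw [e]
  refine Finset.sum_le_sum_of_subset_of_nonneg ?_ fun _ _ _ => hF _ _
  intro ψ hψ
  obtain ⟨χ, hχ, rfl⟩ := Finset.mem_image.1 hψ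
  simpa using (hi χ (by simpa [hs] using hχ)).1

/-- The primitive mean square `∑* |ψ(x, χ) - [χ = 1] x|²` modulo `d`. -/
noncomputable def primErr (x : ℝ) (d : ℕ) : ℝ :=
  primSum d (fun χ => ‖charErr x χ‖ ^ 2)

lemma primErr_nonneg (x : ℝ) (d : ℕ) : 0 ≤ primErr x d := by
  classical
  exact finsum_nonneg fun χ => by split_ifs <;> positivity

lemma sum_sq_le_of_modulus (x : ℝ) (q : ℕ) [NeZero q] {E : ℝ}
    (hE : q.primeFactors.card * Nat.log 2 ⌊x⌋₊ * Real.log ⌊x⌋₊ ≤ E) :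
    ∑ a ∈ (Finset.Icc 1 q).filter (fun a => Nat.gcd a q = 1),
        (psi x q a - x / (q.totient : ℝ)) ^ 2 ≤
      2 * E ^ 2 + 2 * ∑ d ∈ q.divisors, primErr x d / q.totient := by
  have hφ : (0 : ℝ) < q.totient := by exact_mod_cast Nat.totient_pos.2 (NeZero.pos q)
  rw [← Finset.sum_div]
  refine le_of_mul_le_mul_left ?_ hφ
  rw [totient_mul_sum_sq_eq]
  have h1 : ∀ χ : DirichletCharacter ℂ q, ‖charErr x χ‖ ^ 2 ≤
      2 * E ^ 2 + 2 * ‖charErr x χ.primitiveCharacter‖ ^ 2 := by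
    intro χ
    have h2 := (norm_charErr_sub_le x χ).trans hE
    have h3 : ‖charErr x χ‖ ≤ E + ‖charErr x χ.primitiveCharacter‖ := by
      linarith [norm_sub_norm_le (charErr x χ) (charErr x χ.primitiveCharacter)]
    calc ‖charErr x χ‖ ^ 2 ≤ (E + ‖charErr x χ.primitiveCharacter‖) ^ 2 := by gcongr
      _ ≤ _ := by nlinarith [sq_nonneg (E - ‖charErr x χ.primitiveCharacter‖)]
  have h4 := sum_primitiveCharacter_le (q := q) (fun d χ => ‖charErr x χ‖ ^ 2)
    fun _ _ => by positivity
  have hcard : (Fintype.card (DirichletCharacter ℂ q) : ℝ) = q.totient := by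
    rw [← Nat.card_eq_fintype_card, DirichletCharacter.card_eq_totient_of_hasEnoughRootsOfUnity]
  calc _ ≤ ∑ χ : DirichletCharacter ℂ q,
        (2 * E ^ 2 + 2 * ‖charErr x χ.primitiveCharacter‖ ^ 2) := Finset.sum_le_sum fun χ _ => h1 χ
    _ = q.totient * (2 * E ^ 2) + 2 * ∑ χ : DirichletCharacter ℂ q,
        ‖charErr x χ.primitiveCharacter‖ ^ 2 := by
      rw [Finset.sum_add_distrib, Finset.sum_const, Finset.card_univ, nsmul_eq_mul, hcard,
        Finset.mul_sum]
    _ ≤ q.totient * (2 * E ^ 2) + 2 * ∑ d ∈ q.divisors, primErr x d := by gcongr; exact h4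
    _ = _ := by field_simp

lemma sum_divisors_primErr_le (x : ℝ) (M : ℕ) :
    ∑ q ∈ Finset.Icc 1 M, ∑ d ∈ q.divisors, primErr x d / q.totient ≤
      ∑ m ∈ Finset.Icc 1 M, 1 / (m.totient : ℝ) *
        ∑ d ∈ Finset.Icc 1 (M / m), primErr x d / d.totient := by
  have h : ∑ q ∈ Finset.Icc 1 M, ∑ d ∈ q.divisors, primErr x d / q.totient ≤
      ∑ q ∈ Finset.Icc 1 M, ∑ p ∈ q.divisorsAntidiagonal,
        1 / (p.1.totient : ℝ) * (primErr x p.2 / p.2.totient) := by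
    refine Finset.sum_le_sum fun q hq => ?_
    rw [Nat.sum_divisorsAntidiagonal'
      (f := fun a b => 1 / (a.totient : ℝ) * (primErr x b / b.totient))]
    refine Finset.sum_le_sum fun d hd => ?_
    have hdq := Nat.dvd_of_mem_divisors hd
    have hd0 := Nat.pos_of_mem_divisors hd
    have hq0 : 0 < q := (Finset.mem_Icc.1 hq).1
    have h1 : (0 : ℝ) < d.totient := by exact_mod_cast Nat.totient_pos.2 hd0
    have h2 : (0 : ℝ) < (q / d).totient := by
      exact_mod_cast Nat.totient_pos.2 (Nat.div_pos (Nat.le_of_dvd hq0 hdq) hd0)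
    have h3 : ((q / d).totient * d.totient : ℝ) ≤ q.totient := by
      have := Nat.totient_super_multiplicative (q / d) d
      rw [Nat.div_mul_cancel hdq] at this
      exact_mod_cast this
    rw [div_mul_div_comm, one_mul]
    exact div_le_div_of_nonneg_left (primErr_nonneg x d) (by positivity) h3
  refine h.trans (le_of_eq ?_)
  simp_rw [Finset.mul_sum]
  rw [Finset.sum_sigma', Finset.sum_sigma']
  refine Finset.sum_bij' (fun p _ => ⟨p.2.1, p.2.2⟩) (fun p _ => ⟨p.1 * p.2, (p.1, p.2)⟩) ?_ ?_ ?_ ?_ ?_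
  · rintro ⟨q, m, d⟩ h
    simp only [Finset.mem_sigma, Finset.mem_Icc, Nat.mem_divisorsAntidiagonal] at h ⊢
    obtain ⟨⟨h1, h2⟩, rfl, h3⟩ := h
    have hm : 0 < m := Nat.pos_of_ne_zero fun h => h3 (by simp [h])
    have hd : 0 < d := Nat.pos_of_ne_zero fun h => h3 (by simp [h])
    exact ⟨⟨hm, (Nat.le_mul_of_pos_right m hd).trans h2⟩, hd,
      (Nat.le_div_iff_mul_le hm).2 (by rwa [mul_comm])⟩
  · rintro ⟨m, d⟩ h
    simp only [Finset.mem_sigma, Finset.mem_Icc, Nat.mem_divisorsAntidiagonal] at h ⊢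
    obtain ⟨⟨h1, h2⟩, h3, h4⟩ := h
    have := (Nat.le_div_iff_mul_le h1).1 h4
    have : 0 < m * d := Nat.mul_pos h1 h3
    refine ⟨⟨this, by rwa [mul_comm]⟩, trivial, this.ne'⟩
  · rintro ⟨q, m, d⟩ h
    simp only [Finset.mem_sigma, Finset.mem_Icc, Nat.mem_divisorsAntidiagonal] at h
    obtain ⟨_, rfl, _⟩ := h
    rfl
  · rintro ⟨m, d⟩ _
    rfl
  · rintro ⟨q, m, d⟩ _
    rfl

end BDH

namespace BDH
open Set Filter Topology MeasureTheory Complex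

lemma inv_totient_le {m : ℕ} (hm : 1 ≤ m) :
    1 / (m.totient : ℝ) ≤ (m.primeFactors.card + 1) / m := by
  have hm0 : (0 : ℝ) < m := by exact_mod_cast hm
  rw [le_div_iff₀ hm0, one_div_mul_eq_div]
  exact div_totient_le m

lemma sum_inv_totient_le {M : ℕ} {L : ℝ} (hL : 1 ≤ L) (hM : Real.log M ≤ L) :
    ∑ m ∈ Finset.Icc 1 M, 1 / (m.totient : ℝ) ≤ 6 * L ^ 2 := by
  have h1 : ∀ m ∈ Finset.Icc 1 M, 1 / (m.totient : ℝ) ≤ 3 * L * (m : ℝ)⁻¹ := by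
    intro m hm
    rw [Finset.mem_Icc] at hm
    have hm0 : (0 : ℝ) < m := by exact_mod_cast hm.1
    refine (inv_totient_le hm.1).trans ?_
    rw [div_eq_mul_inv]
    have h2 := card_primeFactors_le_log (q := m) (by lia)
    have h3 : Real.log m ≤ Real.log M := Real.log_le_log hm0 (by exact_mod_cast hm.2)
    gcongr
    linarith
  have h2 := harmonic_le_one_add_log M
  rw [harmonic_eq_sum_Icc] at h2
  push_cast at h2
  refine (Finset.sum_le_sum h1).trans ?_
  rw [← Finset.mul_sum]
  calc 3 * L * ∑ m ∈ Finset.Icc 1 M, (m : ℝ)⁻¹ ≤ 3 * L * (1 + L) := by gcongr; linarith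
    _ ≤ _ := by nlinarith

lemma exists_sum_inv_mul_totient_le :
    ∃ C : ℝ, 0 < C ∧ ∀ M : ℕ, ∑ m ∈ Finset.Icc 1 M, 1 / (m.totient : ℝ) * (1 / m) ≤ C := by
  have hs : Summable fun m : ℕ => 5 * (m : ℝ) ^ (-(3 / 2) : ℝ) :=
    (Real.summable_nat_rpow.2 (by norm_num)).mul_left 5
  refine ⟨∑' m : ℕ, 5 * (m : ℝ) ^ (-(3 / 2) : ℝ) + 1, ?_, fun M => ?_⟩
  · have : 0 ≤ ∑' m : ℕ, 5 * (m : ℝ) ^ (-(3 / 2) : ℝ) := tsum_nonneg fun m => by positivity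
    linarith
  · have h1 : ∀ m ∈ Finset.Icc 1 M,
        1 / (m.totient : ℝ) * (1 / m) ≤ 5 * (m : ℝ) ^ (-(3 / 2) : ℝ) := by
      intro m hm
      rw [Finset.mem_Icc] at hm
      have hm0 : (0 : ℝ) < m := by exact_mod_cast hm.1
      have h2 := card_primeFactors_le_rpow (δ := 1 / 2) (by norm_num) (q := m) (by lia)
      have h3 := inv_totient_le hm.1
      have e : (m : ℝ) ^ (-(3 / 2) : ℝ) = (m : ℝ) ^ (1 / 2 : ℝ) / m * (1 / m) := by
        rw [div_mul_div_comm, mul_one, ← sq, ← Real.rpow_natCast, ← Real.rpow_sub hm0]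
        norm_num
      rw [e, ← mul_assoc]
      norm_num at h2
      refine mul_le_mul_of_nonneg_right (h3.trans ?_) (by positivity)
      rw [← mul_div_assoc]
      gcongr
    have h2 := hs.sum_le_tsum (Finset.Icc 1 M) fun m _ => by positivity
    linarith [Finset.sum_le_sum h1]

lemma ne_one_of_isPrimitive {d : ℕ} (hd : 2 ≤ d) {χ : DirichletCharacter ℂ d}
    (hχ : χ.IsPrimitive) : χ ≠ 1 := by
  have : NeZero d := ⟨by lia⟩
  intro h
  have h1 := χ.eq_one_iff_conductor_eq_one.1 h
  have h2 : χ.conductor = d := hχ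
  lia

lemma charErr_of_ne_one (x : ℝ) {d : ℕ} {χ : DirichletCharacter ℂ d} (hχ : χ ≠ 1) :
    charErr x χ = ∑ n ∈ Finset.Icc 1 ⌊x⌋₊, (ArithmeticFunction.vonMangoldt n : ℂ) * χ n := by
  rw [charErr, if_neg hχ, sub_zero]

lemma log_pow_le_factorial_mul {x : ℝ} (hx : 1 ≤ x) (n : ℕ) :
    Real.log x ^ n ≤ n.factorial * x := by
  have h := Real.pow_div_factorial_le_exp (Real.log x) (Real.log_nonneg hx) n
  rwa [Real.exp_log (by linarith), div_le_iff₀' (by positivity)] at h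

/-- Siegel–Walfisz for the primitive characters, the trivial one included. -/
lemma norm_charErr_le (B : ℕ) : ∃ C : ℝ, 0 < C ∧ ∀ (d : ℕ) [NeZero d]
    (χ : DirichletCharacter ℂ d), χ.IsPrimitive → ∀ x : ℝ, 1 ≤ x →
      Real.log x ^ B * ‖charErr x χ‖ ≤ C * Real.sqrt d * x := by
  obtain ⟨C₁, hC₁, h₁⟩ := norm_sum_char_vonMangoldt_le B
  obtain ⟨C₂, hC₂, h₂⟩ := norm_sum_vonMangoldt_sub_one_le B
  refine ⟨C₁ + C₂ + B.factorial, by positivity, fun d _ χ hχ x hx => ?_⟩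
  have hL := Real.log_nonneg hx
  by_cases hχ1 : χ = 1
  · have hd : d = 1 := by
      have h1 := χ.eq_one_iff_conductor_eq_one.1 hχ1
      have h2 : χ.conductor = d := hχ
      lia
    subst hd
    have e : charErr x χ = ∑ n ∈ Finset.Icc 1 ⌊x⌋₊, ((ArithmeticFunction.vonMangoldt n : ℂ) - 1) +
        (((⌊x⌋₊ : ℝ) - x : ℝ) : ℂ) := by
      rw [charErr, if_pos hχ1, Finset.sum_sub_distrib]
      have : ∀ n : ℕ, χ n = 1 := fun n => by
        rw [Subsingleton.elim (n : ZMod 1) 1, map_one]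
      simp only [this, mul_one, Finset.sum_const, Nat.card_Icc, nsmul_eq_mul,
        Nat.add_sub_cancel, Complex.ofReal_sub, Complex.ofReal_natCast]
      ring
    have h3 : ‖(((⌊x⌋₊ : ℝ) - x : ℝ) : ℂ)‖ ≤ 1 := by
      rw [Complex.norm_real, Real.norm_eq_abs, abs_le]
      have := Nat.floor_le (by linarith : 0 ≤ x)
      have := Nat.lt_floor_add_one x
      constructor <;> linarith
    have h4 := log_pow_le_factorial_mul hx B
    have h5 := h₂ x hx
    calc Real.log x ^ B * ‖charErr x χ‖
        ≤ Real.log x ^ B *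
          (‖∑ n ∈ Finset.Icc 1 ⌊x⌋₊, ((ArithmeticFunction.vonMangoldt n : ℂ) - 1)‖ + 1) := by
          rw [e]
          gcongr
          exact (norm_add_le _ _).trans (by gcongr)
      _ ≤ C₂ * x + B.factorial * x := by linarith
      _ ≤ _ := by
          rw [Nat.cast_one, Real.sqrt_one]
          nlinarith
  · have h3 := h₁ d χ hχ1 x hx
    rw [charErr_of_ne_one x hχ1]
    simp_rw [mul_comm _ (χ _)]
    refine h3.trans ?_
    gcongr
    have : (0 : ℝ) ≤ B.factorial := by positivity
    linarith

lemma primErr_div_totient_le (B : ℕ) : ∃ C : ℝ, 0 < C ∧ ∀ d : ℕ, 1 ≤ d → ∀ x : ℝ, 1 ≤ x →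
    (Real.log x ^ B) ^ 2 * (primErr x d / d.totient) ≤ C * d * x ^ 2 := by
  classical
  obtain ⟨C, hC, h⟩ := norm_charErr_le B
  refine ⟨C ^ 2, by positivity, fun d hd x hx => ?_⟩
  have : NeZero d := ⟨by lia⟩
  have hφ : (0 : ℝ) < d.totient := by exact_mod_cast Nat.totient_pos.2 hd
  have hcard : (Fintype.card (DirichletCharacter ℂ d) : ℝ) = d.totient := by
    rw [← Nat.card_eq_fintype_card, DirichletCharacter.card_eq_totient_of_hasEnoughRootsOfUnity]
  rw [mul_div_assoc', div_le_iff₀ hφ, primErr, primSum_eq, Finset.mul_sum]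
  have h1 : ∀ χ : DirichletCharacter ℂ d,
      (Real.log x ^ B) ^ 2 * (if χ.IsPrimitive then ‖charErr x χ‖ ^ 2 else 0) ≤
        C ^ 2 * d * x ^ 2 := by
    intro χ
    split_ifs with hχ
    · have h2 := pow_le_pow_left₀ (by have := Real.log_nonneg hx; positivity) (h d χ hχ x hx) 2
      rw [mul_pow, mul_pow, mul_pow, Real.sq_sqrt (by positivity)] at h2
      exact h2
    · rw [mul_zero]; positivity
  refine (Finset.sum_le_sum fun χ _ => h1 χ).trans (le_of_eq ?_)
  rw [Finset.sum_const, Finset.card_univ, nsmul_eq_mul, hcard, mul_comm]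

lemma sum_vonMangoldt_sq_le {x : ℝ} (hx : 1 ≤ x) :
    ∑ n ∈ Finset.Icc 1 ⌊x⌋₊, ‖(ArithmeticFunction.vonMangoldt n : ℂ)‖ ^ 2 ≤
      6 * x * Real.log x := by
  have h1 : ∀ n ∈ Finset.Icc 1 ⌊x⌋₊, ‖(ArithmeticFunction.vonMangoldt n : ℂ)‖ ^ 2 ≤
      Real.log x * ArithmeticFunction.vonMangoldt n := by
    intro n hn
    rw [Finset.mem_Icc] at hn
    have hn0 : (0 : ℝ) < n := by exact_mod_cast hn.1
    have hnx : (n : ℝ) ≤ x := (Nat.le_floor_iff (by linarith)).1 hn.2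
    rw [Complex.norm_real, Real.norm_eq_abs, sq_abs, sq]
    exact mul_le_mul_of_nonneg_right
      (ArithmeticFunction.vonMangoldt_le_log.trans (Real.log_le_log hn0 hnx))
      ArithmeticFunction.vonMangoldt_nonneg
  refine (Finset.sum_le_sum h1).trans ?_
  rw [← Finset.mul_sum]
  have h2 := Chebyshev.psi_le_const_mul_self (by linarith : 0 ≤ x)
  rw [Chebyshev.psi] at h2
  have e : Finset.Icc 1 ⌊x⌋₊ = Finset.Ioc 0 ⌊x⌋₊ := by ext; simp; lia
  rw [e]
  have h3 : Real.log 4 ≤ 2 := by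
    rw [show (4 : ℝ) = 2 ^ 2 by norm_num, Real.log_pow]
    have := Real.log_two_lt_d9
    push_cast
    linarith
  have hL := Real.log_nonneg hx
  calc _ ≤ Real.log x * ((Real.log 4 + 4) * x) := by gcongr
    _ ≤ Real.log x * ((2 + 4) * x) := by gcongr
    _ = _ := by ring

lemma sum_primErr_le {x : ℝ} (hx : 1 ≤ x) (U : ℕ) :
    ∑ d ∈ Finset.Icc 2 U, (d : ℝ) / d.totient * primErr x d ≤
      900 * x * Real.log x * (x + U ^ 2) := by
  have hL := Real.log_nonneg hx
  rcases Nat.eq_zero_or_pos U with rfl | hU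
  · simp only [Nat.cast_zero, Finset.Icc_eq_empty_of_lt (by norm_num : 0 < 2), Finset.sum_empty]
    positivity
  have h1 : ∀ d ∈ Finset.Icc 2 U, (d : ℝ) / d.totient * primErr x d =
      (d : ℝ) / d.totient * primSum d
        (fun χ => ‖∑ n ∈ Finset.Icc 1 ⌊x⌋₊, (ArithmeticFunction.vonMangoldt n : ℂ) * χ n‖ ^ 2) := by
    intro d hd
    rw [primErr, primSum, primSum]
    congr 1
    refine finsum_congr fun χ => ?_
    split_ifs with h
    · rw [charErr_of_ne_one x (ne_one_of_isPrimitive (Finset.mem_Icc.1 hd).1 h)]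
    · rfl
  rw [Finset.sum_congr rfl h1]
  have hN : 1 ≤ ⌊x⌋₊ := Nat.one_le_floor_iff x |>.2 hx
  have h2 := large_sieve (fun n => (ArithmeticFunction.vonMangoldt n : ℂ)) hN hU
  have h3 : ∑ d ∈ Finset.Icc 2 U, (d : ℝ) / d.totient * primSum d
        (fun χ => ‖∑ n ∈ Finset.Icc 1 ⌊x⌋₊, (ArithmeticFunction.vonMangoldt n : ℂ) * χ n‖ ^ 2) ≤
      ∑ d ∈ Finset.Icc 1 U, (d : ℝ) / d.totient * primSum d
        (fun χ => ‖∑ n ∈ Finset.Icc 1 ⌊x⌋₊, (ArithmeticFunction.vonMangoldt n : ℂ) * χ n‖ ^ 2) := by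
    refine Finset.sum_le_sum_of_subset_of_nonneg (Finset.Icc_subset_Icc_left (by norm_num)) ?_
    intro d _ _
    refine mul_nonneg (by positivity) (finsum_nonneg fun χ => ?_)
    split_ifs <;> positivity
  refine (h3.trans h2).trans ?_
  have h4 := sum_vonMangoldt_sq_le hx
  have h5 := Nat.floor_le (by linarith : 0 ≤ x)
  calc _ ≤ 150 * (x + (U : ℝ) ^ 2) * (6 * x * Real.log x) := by gcongr
    _ = _ := by ring

lemma sum_div_le_of_sum_le {t : ℕ → ℝ} {Q₁ : ℕ} (hQ₁ : 1 ≤ Q₁) {K X : ℝ} (hK : 0 ≤ K) (hX : 0 ≤ X)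
    (h : ∀ U : ℕ, ∑ d ∈ Finset.Ioc Q₁ U, t d ≤ K * (X + U ^ 2)) (U : ℕ) :
    ∑ d ∈ Finset.Ioc Q₁ U, t d / d ≤ K * (X / Q₁ + 2 * U) := by
  rcases lt_or_ge U Q₁ with hU | hU
  · rw [Finset.Ioc_eq_empty_of_le hU.le, Finset.sum_empty]
    positivity
  have hQ₀ : (0 : ℝ) < Q₁ := by exact_mod_cast hQ₁
  have key : ∑ d ∈ Finset.Ioc Q₁ U, t d / d - (∑ d ∈ Finset.Ioc Q₁ U, t d) / U ≤
      K * (X * (1 / Q₁ - 1 / U) + (U - Q₁)) := by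
    induction U, hU using Nat.le_induction with
    | base => simp
    | succ U hU ih =>
      have hU0 : (0 : ℝ) < U := by exact_mod_cast (hQ₁.trans hU)
      rw [← Finset.insert_Ioc_right_eq_Ioc_add_one hU, Finset.sum_insert (by simp),
        Finset.sum_insert (by simp)]
      have h1 := h U
      have h2 : (∑ d ∈ Finset.Ioc Q₁ U, t d) / (U * (U + 1)) ≤
          K * (X * (1 / U - 1 / (U + 1)) + 1) := by
        rw [div_le_iff₀ (by positivity)]
        refine h1.trans ?_
        rw [mul_assoc]
        refine mul_le_mul_of_nonneg_left ?_ hK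
        have : (X * (1 / U - 1 / (U + 1)) + 1) * ((U : ℝ) * (U + 1)) = X + U * (U + 1) := by
          field_simp
          ring
        rw [this]
        nlinarith
      have h3 : (∑ d ∈ Finset.Ioc Q₁ U, t d) / U - (∑ d ∈ Finset.Ioc Q₁ U, t d) / (U + 1) =
          (∑ d ∈ Finset.Ioc Q₁ U, t d) / (U * (U + 1)) := by
        field_simp
        ring
      push_cast
      rw [add_div]
      have e : K * (X * (1 / Q₁ - 1 / (U + 1)) + (U + 1 - Q₁)) =
          K * (X * (1 / Q₁ - 1 / U) + (U - Q₁)) + K * (X * (1 / U - 1 / (U + 1)) + 1) := by ring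
      rw [e]
      linarith
  have hU0 : (0 : ℝ) < U := by exact_mod_cast (hQ₁.trans hU)
  have h1 : (∑ d ∈ Finset.Ioc Q₁ U, t d) / U ≤ K * (X / U + U) := by
    rw [div_le_iff₀ hU0]
    refine (h U).trans (le_of_eq ?_)
    field_simp
  have h2 : K * (X / U + U) + K * (X * (1 / Q₁ - 1 / U) + (U - Q₁)) =
      K * (X / Q₁ + 2 * U) - K * Q₁ := by ring
  have h3 : 0 ≤ K * Q₁ := by positivity
  linarith

lemma sum_Ioc_primErr_div_totient_le {x : ℝ} (hx : 1 ≤ x) {Q₁ : ℕ} (hQ₁ : 1 ≤ Q₁) (U : ℕ) :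
    ∑ d ∈ Finset.Ioc Q₁ U, primErr x d / d.totient ≤
      900 * x * Real.log x * (x / Q₁ + 2 * U) := by
  have hL := Real.log_nonneg hx
  have h := sum_div_le_of_sum_le (t := fun d => (d : ℝ) / d.totient * primErr x d) hQ₁
    (K := 900 * x * Real.log x) (X := x) (by positivity) (by linarith) (fun U => by
      refine le_trans ?_ (sum_primErr_le hx U)
      refine Finset.sum_le_sum_of_subset_of_nonneg ?_ fun d _ _ =>
        mul_nonneg (by positivity) (primErr_nonneg x d)
      intro d hd
      rw [Finset.mem_Ioc] at hd
      exact Finset.mem_Icc.2 ⟨by lia, hd.2⟩) U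
  refine le_trans (le_of_eq (Finset.sum_congr rfl fun d hd => ?_)) h
  have hd0 : (d : ℝ) ≠ 0 := by
    have := (Finset.mem_Ioc.1 hd).1
    exact_mod_cast (by lia : d ≠ 0)
  field_simp

end BDH

namespace BDH
open Set Filter Topology MeasureTheory Complex

lemma sum_Icc_primErr_le {B : ℕ} {C : ℝ} (hC : 0 < C)
    (h : ∀ d : ℕ, 1 ≤ d → ∀ x : ℝ, 1 ≤ x →
      (Real.log x ^ B) ^ 2 * (primErr x d / d.totient) ≤ C * d * x ^ 2)
    {x : ℝ} (hx : 1 ≤ x) (hL : 0 < Real.log x) {Q₁ : ℕ} (hQ₁ : 1 ≤ Q₁) (U : ℕ) :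
    ∑ d ∈ Finset.Icc 1 U, primErr x d / d.totient ≤
      C * Q₁ ^ 2 * x ^ 2 / (Real.log x ^ B) ^ 2 +
        900 * x * Real.log x * (x / Q₁ + 2 * U) := by
  have h0 : ∀ d : ℕ, 0 ≤ primErr x d / d.totient :=
    fun d => div_nonneg (primErr_nonneg x d) (by positivity)
  have h1 : ∑ d ∈ Finset.Icc 1 U, primErr x d / d.totient ≤
      ∑ d ∈ Finset.Icc 1 Q₁, primErr x d / d.totient +
        ∑ d ∈ Finset.Ioc Q₁ U, primErr x d / d.totient := by
    rw [← Finset.sum_union]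
    · refine Finset.sum_le_sum_of_subset_of_nonneg ?_ fun d _ _ => h0 d
      intro d hd
      simp only [Finset.mem_union, Finset.mem_Icc, Finset.mem_Ioc] at hd ⊢
      lia
    · rw [Finset.disjoint_left]
      intro d hd
      simp only [Finset.mem_Icc, Finset.mem_Ioc] at hd ⊢
      lia
  refine h1.trans (add_le_add ?_ (sum_Ioc_primErr_div_totient_le hx hQ₁ U))
  have h2 : ∀ d ∈ Finset.Icc 1 Q₁, primErr x d / d.totient ≤
      C * Q₁ * x ^ 2 / (Real.log x ^ B) ^ 2 := by
    intro d hd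
    rw [Finset.mem_Icc] at hd
    rw [le_div_iff₀' (by positivity)]
    refine (h d hd.1 x hx).trans ?_
    have : (d : ℝ) ≤ Q₁ := by exact_mod_cast hd.2
    gcongr
  refine (Finset.sum_le_card_nsmul _ _ _ h2).trans (le_of_eq ?_)
  rw [nsmul_eq_mul, Nat.card_Icc, Nat.add_sub_cancel]
  ring

lemma card_mul_log_le {x : ℝ} (hL : 1 ≤ Real.log x) (hx : 1 ≤ x) {q : ℕ} (hq : 1 ≤ q)
    (hqx : (q : ℝ) ≤ x) :
    q.primeFactors.card * Nat.log 2 ⌊x⌋₊ * Real.log ⌊x⌋₊ ≤ 4 * Real.log x ^ 3 := by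
  have hN : (0 : ℝ) < ⌊x⌋₊ := by exact_mod_cast Nat.floor_pos.2 hx
  have h1 : Real.log ⌊x⌋₊ ≤ Real.log x := Real.log_le_log hN (Nat.floor_le (by linarith))
  have h0 : 0 ≤ Real.log ⌊x⌋₊ := Real.log_natCast_nonneg _
  have h2 : (q.primeFactors.card : ℝ) ≤ 2 * Real.log x := by
    refine (card_primeFactors_le_log (by lia)).trans ?_
    have := Real.log_le_log (by exact_mod_cast hq) hqx
    linarith
  have h3 : (Nat.log 2 ⌊x⌋₊ : ℝ) ≤ 2 * Real.log x := by
    have h4 : (2 : ℝ) ^ Nat.log 2 ⌊x⌋₊ ≤ ⌊x⌋₊ := by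
      exact_mod_cast Nat.pow_log_le_self 2 (Nat.floor_pos.2 hx).ne'
    have h5 := Real.log_le_log (by positivity) h4
    rw [Real.log_pow] at h5
    have h6 := Real.log_two_gt_d9
    have h7 : (0 : ℝ) ≤ Nat.log 2 ⌊x⌋₊ := by positivity
    nlinarith
  calc _ ≤ 2 * Real.log x * (2 * Real.log x) * Real.log x := by gcongr
    _ = _ := by ring

lemma V_le (k : ℕ) : ∃ C : ℝ, 0 < C ∧ ∀ x Q : ℝ, 1 ≤ Real.log x → 1 ≤ Q → 1 ≤ x → Q ≤ x →
    V x Q ≤ C * (x ^ 2 / Real.log x ^ k + x * Real.log x * Q) := by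
  obtain ⟨C₁, hC₁, h₁⟩ := primErr_div_totient_le (2 * k + 4)
  obtain ⟨C₂, hC₂, h₂⟩ := exists_sum_inv_mul_totient_le
  refine ⟨32 * (k + 6).factorial + 48 * C₁ + 10800 + 3600 * C₂, by positivity,
    fun x Q hL hQ hx hQx => ?_⟩
  set L := Real.log x with hLdef
  have hL0 : 0 < L := by linarith
  set M := ⌊Q⌋₊ with hM
  have hMQ : (M : ℝ) ≤ Q := Nat.floor_le (by linarith)
  have hM1 : 1 ≤ M := Nat.one_le_floor_iff Q |>.2 hQ
  set Q₁ := ⌈L ^ (k + 3)⌉₊ with hQ₁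
  have hLk : 1 ≤ L ^ (k + 3) := one_le_pow₀ hL
  have hQ₁ge : L ^ (k + 3) ≤ Q₁ := Nat.le_ceil _
  have hQ₁le : (Q₁ : ℝ) ≤ 2 * L ^ (k + 3) := by
    have := Nat.ceil_lt_add_one (a := L ^ (k + 3)) (by positivity)
    linarith
  have hQ₁1 : 1 ≤ Q₁ := by exact_mod_cast hLk.trans hQ₁ge
  have step1 : V x Q ≤ M * (2 * (4 * L ^ 3) ^ 2) +
      2 * ∑ m ∈ Finset.Icc 1 M, 1 / (m.totient : ℝ) *
        ∑ d ∈ Finset.Icc 1 (M / m), primErr x d / d.totient := by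
    have h3 : V x Q ≤ ∑ q ∈ Finset.Icc 1 M,
        (2 * (4 * L ^ 3) ^ 2 + 2 * ∑ d ∈ q.divisors, primErr x d / q.totient) := by
      refine Finset.sum_le_sum fun q hq => ?_
      rw [Finset.mem_Icc] at hq
      have : NeZero q := ⟨by lia⟩
      refine sum_sq_le_of_modulus x q (card_mul_log_le hL hx hq.1 ?_)
      have : (q : ℝ) ≤ M := by exact_mod_cast hq.2
      linarith
    rw [Finset.sum_add_distrib, Finset.sum_const, nsmul_eq_mul, Nat.card_Icc, Nat.add_sub_cancel,
      ← Finset.mul_sum] at h3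
    linarith [sum_divisors_primErr_le x M]
  set D := C₁ * Q₁ ^ 2 * x ^ 2 / (L ^ (2 * k + 4)) ^ 2 + 900 * x * L * (x / Q₁) with hD
  have hD0 : 0 ≤ D := by positivity
  have step2 : ∑ m ∈ Finset.Icc 1 M, 1 / (m.totient : ℝ) *
        ∑ d ∈ Finset.Icc 1 (M / m), primErr x d / d.totient ≤
      6 * L ^ 2 * D + 1800 * x * L * Q * C₂ := by
    have h4 : ∀ m ∈ Finset.Icc 1 M, 1 / (m.totient : ℝ) *
        ∑ d ∈ Finset.Icc 1 (M / m), primErr x d / d.totient ≤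
        1 / (m.totient : ℝ) * D + 1800 * x * L * Q * (1 / (m.totient : ℝ) * (1 / m)) := by
      intro m _
      have h5 := sum_Icc_primErr_le hC₁ h₁ hx hL0 hQ₁1 (M / m)
      have h6 : ((M / m : ℕ) : ℝ) ≤ Q * (1 / m) := by
        refine Nat.cast_div_le.trans ?_
        rw [mul_one_div]
        gcongr
      calc _ ≤ 1 / (m.totient : ℝ) * (D + 1800 * x * L * (Q * (1 / m))) := by
            refine mul_le_mul_of_nonneg_left (h5.trans ?_) (by positivity)
            have h7 : 1800 * x * L * ((M / m : ℕ) : ℝ) ≤ 1800 * x * L * (Q * (1 / m)) := by gcongr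
            rw [hD]
            linarith
        _ = _ := by ring
    refine (Finset.sum_le_sum h4).trans ?_
    rw [Finset.sum_add_distrib, ← Finset.sum_mul, ← Finset.mul_sum]
    have h8 : Real.log M ≤ L :=
      Real.log_le_log (by exact_mod_cast hM1) (hMQ.trans hQx)
    gcongr
    · exact sum_inv_totient_le hL h8
    · exact h₂ M
  have hD1 : 6 * L ^ 2 * D ≤ (24 * C₁ + 5400) * (x ^ 2 / L ^ k) := by
    have e1 : C₁ * Q₁ ^ 2 * x ^ 2 / (L ^ (2 * k + 4)) ^ 2 ≤ 4 * C₁ * x ^ 2 / L ^ (k + 2) := by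
      rw [div_le_div_iff₀ (by positivity) (by positivity)]
      calc C₁ * Q₁ ^ 2 * x ^ 2 * L ^ (k + 2)
          ≤ C₁ * (2 * L ^ (k + 3)) ^ 2 * x ^ 2 * L ^ (k + 2) := by gcongr
        _ = 4 * C₁ * x ^ 2 * L ^ (3 * k + 8) := by ring
        _ ≤ 4 * C₁ * x ^ 2 * L ^ (4 * k + 8) :=
            mul_le_mul_of_nonneg_left (pow_le_pow_right₀ hL (by lia)) (by positivity)
        _ = _ := by ring
    have e2 : 900 * x * L * (x / Q₁) ≤ 900 * x ^ 2 / L ^ (k + 2) := by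
      calc 900 * x * L * (x / Q₁) ≤ 900 * x * L * (x / L ^ (k + 3)) := by gcongr
        _ = _ := by
          field_simp
          ring
    calc 6 * L ^ 2 * D ≤ 6 * L ^ 2 * (4 * C₁ * x ^ 2 / L ^ (k + 2) + 900 * x ^ 2 / L ^ (k + 2)) := by
          rw [hD]; gcongr
      _ = _ := by
          field_simp
          ring
  have hE : M * (2 * (4 * L ^ 3) ^ 2) ≤ 32 * (k + 6).factorial * (x ^ 2 / L ^ k) := by
    have h9 := log_pow_le_factorial_mul hx (k + 6)
    rw [mul_div_assoc', le_div_iff₀ (by positivity)]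
    calc M * (2 * (4 * L ^ 3) ^ 2) * L ^ k = 32 * M * L ^ (k + 6) := by ring
      _ ≤ 32 * x * ((k + 6).factorial * x) := by
        gcongr
        exact hMQ.trans hQx
      _ = _ := by ring
  have hpos1 : 0 ≤ x ^ 2 / L ^ k := by positivity
  have hpos2 : 0 ≤ x * L * Q := by positivity
  have hf : (0 : ℝ) ≤ (k + 6).factorial := by positivity
  calc V x Q ≤ 32 * (k + 6).factorial * (x ^ 2 / L ^ k) +
        2 * ((24 * C₁ + 5400) * (x ^ 2 / L ^ k) + 1800 * x * L * Q * C₂) := by linarith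
    _ = (32 * (k + 6).factorial + 48 * C₁ + 10800) * (x ^ 2 / L ^ k) +
        3600 * C₂ * (x * L * Q) := by ring
    _ ≤ (32 * (k + 6).factorial + 48 * C₁ + 10800 + 3600 * C₂) * (x ^ 2 / L ^ k) +
        (32 * (k + 6).factorial + 48 * C₁ + 10800 + 3600 * C₂) * (x * L * Q) := by
        refine add_le_add (mul_le_mul_of_nonneg_right ?_ hpos1)
          (mul_le_mul_of_nonneg_right ?_ hpos2) <;> linarith
    _ = _ := by ring

/-- The trivial bound for `V`. -/
lemma V_le_trivial {x Q : ℝ} (hx : 2 ≤ x) (hQ : 0 ≤ Q) : V x Q ≤ Q ^ 2 * x ^ 4 := by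
  have h1 : ∀ q ∈ Finset.Icc 1 ⌊Q⌋₊, ∀ a ∈ (Finset.Icc 1 q).filter (fun a => Nat.gcd a q = 1),
      (psi x q a - x / (q.totient : ℝ)) ^ 2 ≤ x ^ 4 := by
    intro q hq a _
    have hN : (⌊x⌋₊ : ℝ) ≤ x := Nat.floor_le (by linarith)
    have h2 : psi x q a ≤ x ^ 2 := by
      have h3 : ∀ n ∈ (Finset.Icc 1 ⌊x⌋₊).filter (fun n => n % q = a % q),
          ArithmeticFunction.vonMangoldt n ≤ x := by
        intro n hn
        rw [Finset.mem_filter, Finset.mem_Icc] at hn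
        have h4 : (n : ℝ) ≤ ⌊x⌋₊ := by exact_mod_cast hn.1.2
        have h5 := Real.log_le_self (Nat.cast_nonneg (α := ℝ) n)
        linarith [ArithmeticFunction.vonMangoldt_le_log (n := n)]
      refine (Finset.sum_le_card_nsmul _ _ _ h3).trans ?_
      rw [nsmul_eq_mul, sq]
      refine mul_le_mul_of_nonneg_right (le_trans ?_ hN) (by linarith)
      have := Finset.card_filter_le (Finset.Icc 1 ⌊x⌋₊) (fun n => n % q = a % q)
      rw [Nat.card_Icc, Nat.add_sub_cancel] at this
      exact_mod_cast this
    have h3 : 0 ≤ psi x q a :=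
      Finset.sum_nonneg fun _ _ => ArithmeticFunction.vonMangoldt_nonneg
    have h4 : x / (q.totient : ℝ) ≤ x ^ 2 := by
      have : (1 : ℝ) ≤ q.totient := by
        exact_mod_cast Nat.totient_pos.2 (Finset.mem_Icc.1 hq).1
      exact (div_le_self (by linarith) this).trans (by nlinarith)
    have h5 : 0 ≤ x / (q.totient : ℝ) := by positivity
    rw [show x ^ 4 = (x ^ 2) ^ 2 by ring]
    exact sq_le_sq' (by linarith) (by linarith)
  have hM : (⌊Q⌋₊ : ℝ) ≤ Q := Nat.floor_le hQ
  have h2 : ∀ q ∈ Finset.Icc 1 ⌊Q⌋₊, ∑ a ∈ (Finset.Icc 1 q).filter (fun a => Nat.gcd a q = 1),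
      (psi x q a - x / (q.totient : ℝ)) ^ 2 ≤ Q * x ^ 4 := by
    intro q hq
    refine (Finset.sum_le_card_nsmul _ _ _ (h1 q hq)).trans ?_
    rw [nsmul_eq_mul]
    refine mul_le_mul_of_nonneg_right (le_trans ?_ hM) (by positivity)
    have := Finset.card_filter_le (Finset.Icc 1 q) (fun a => Nat.gcd a q = 1)
    rw [Nat.card_Icc, Nat.add_sub_cancel] at this
    exact_mod_cast this.trans (Finset.mem_Icc.1 hq).2
  refine (Finset.sum_le_card_nsmul _ _ _ h2).trans ?_
  rw [nsmul_eq_mul, Nat.card_Icc, Nat.add_sub_cancel, sq, mul_assoc]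
  gcongr

end BDH

/-- Barban–Davenport–Halberstam (with Gallagher's B = A + 1): for every A > 0
there is C such that V(x,Q) ≤ C x² (log x)^{-A} for 1 ≤ Q ≤ x (log x)^{-(A+1)}. -/
theorem barban_davenport_halberstam (A : ℝ) (hA : 0 < A) :
    ∃ C : ℝ, 0 < C ∧ ∀ x Q : ℝ, 2 ≤ x → 1 ≤ Q → Q ≤ x * Real.log x ^ (-(A + 1)) →
      V x Q ≤ C * x ^ 2 * Real.log x ^ (-A) := by
  obtain ⟨C, hC, h⟩ := BDH.V_le ⌈A⌉₊
  refine ⟨2 * C + (Real.exp 1 * Real.log 2 ^ (-(A + 1))) ^ 2 * Real.exp 1 ^ 2, by positivity,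
    fun x Q hx hQ hQx => ?_⟩
  have hlog2 : 0 < Real.log 2 := Real.log_pos (by norm_num)
  have hlog : Real.log 2 ≤ Real.log x := Real.log_le_log (by norm_num) hx
  have hL0 : 0 < Real.log x := by linarith
  rcases le_total 1 (Real.log x) with hL | hL
  · have hpow1 : Real.log x ^ (-(A + 1)) ≤ 1 := Real.rpow_le_one_of_one_le_of_nonpos hL (by linarith)
    have hQx' : Q ≤ x := hQx.trans (mul_le_of_le_one_right (by linarith) hpow1)
    have h1 : x ^ 2 / Real.log x ^ ⌈A⌉₊ ≤ x ^ 2 * Real.log x ^ (-A) := by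
      have h3 : Real.log x ^ A ≤ Real.log x ^ ⌈A⌉₊ := by
        rw [← Real.rpow_natCast]
        exact Real.rpow_le_rpow_of_exponent_le hL (Nat.le_ceil A)
      rw [Real.rpow_neg hL0.le, ← div_eq_mul_inv]
      gcongr
    have h2 : x * Real.log x * Q ≤ x ^ 2 * Real.log x ^ (-A) := by
      calc x * Real.log x * Q ≤ x * Real.log x * (x * Real.log x ^ (-(A + 1))) := by gcongr
        _ = x ^ 2 * (Real.log x ^ (1 : ℝ) * Real.log x ^ (-(A + 1))) := by
          rw [Real.rpow_one]; ring
        _ = _ := by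
          rw [← Real.rpow_add hL0]
          congr 2
          ring
    calc V x Q ≤ C * (x ^ 2 / Real.log x ^ ⌈A⌉₊ + x * Real.log x * Q) := h x Q hL hQ (by linarith) hQx'
      _ ≤ C * (x ^ 2 * Real.log x ^ (-A) + x ^ 2 * Real.log x ^ (-A)) := by gcongr
      _ = 2 * C * x ^ 2 * Real.log x ^ (-A) := by ring
      _ ≤ _ := by
        gcongr
        exact le_add_of_nonneg_right (by positivity)
  · have hxe : x ≤ Real.exp 1 := by
      rw [← Real.exp_log (by linarith : 0 < x)]
      exact Real.exp_le_exp.2 hL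
    have hpow : Real.log x ^ (-(A + 1)) ≤ Real.log 2 ^ (-(A + 1)) :=
      Real.rpow_le_rpow_of_nonpos hlog2 hlog (by linarith)
    have hpow1 : 1 ≤ Real.log x ^ (-A) := Real.one_le_rpow_of_pos_of_le_one_of_nonpos hL0 hL (by linarith)
    have hQ' : Q ≤ Real.exp 1 * Real.log 2 ^ (-(A + 1)) := hQx.trans (by gcongr)
    calc V x Q ≤ Q ^ 2 * x ^ 4 := BDH.V_le_trivial hx (by linarith)
      _ = Q ^ 2 * x ^ 2 * x ^ 2 := by ring
      _ ≤ (Real.exp 1 * Real.log 2 ^ (-(A + 1))) ^ 2 * Real.exp 1 ^ 2 * x ^ 2 := by gcongr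
      _ ≤ (2 * C + (Real.exp 1 * Real.log 2 ^ (-(A + 1))) ^ 2 * Real.exp 1 ^ 2) * x ^ 2 := by
        gcongr
        linarith
      _ ≤ _ := le_mul_of_one_le_right (by positivity) hpow1
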